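/- Suppose Assumption 1 holds and that γ·(σ−1) ≤ 1. Then V satisfies the dynamic programming principle: for every (k₀,h₀) ∈ (0,∞)² and every family (τ_c)_{c ∈ 𝓐(k₀,h₀)} of (𝓕_t)-stopping times (the stopping time may depend on the control), one has V(k₀,h₀) = sup_{c ∈ 𝓐(k₀,h₀)} E[ ∫₀^{τ_c} (e^{−θt}/(1−σ))·(h_t^γ/c_t)^{σ−1} dt + e^{−θ·τ_c}·V(k_{τ_c}, h_{τ_c}) ], where (k,h) is the state pair associated with c and, on the event {τ_c = ∞}, the term e^{−θ·τ_c}·V(k_{τ_c}, h_{τ_c}) is taken to be 0. -/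

import Mathlib

open MeasureTheory ProbabilityTheory Real Set Matrix
open scoped ENNReal NNReal

noncomputable section

namespace HabitModel

/-- A standard Brownian motion with respect to the filtration `F`: adapted, with continuous
paths started at `0`, whose increments are independent of the past and Gaussian. -/
structure IsStdBM {Ω : Type*} {mΩ : MeasurableSpace Ω} (P : Measure Ω)
    (F : Filtration ℝ mΩ) (W : ℝ → Ω → ℝ) : Prop where
  adapted : Adapted F W
  cont : ∀ ω, Continuous fun t => W t ω
  init : ∀ ω, W 0 ω = 0
  indep_incr : ∀ s t : ℝ, 0 ≤ s → s ≤ t →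
    Indep (MeasurableSpace.comap (fun ω => W t ω - W s ω) inferInstance) (F s) P
  gauss_incr : ∀ s t : ℝ, 0 ≤ s → s ≤ t →
    P.map (fun ω => W t ω - W s ω) = gaussianReal 0 (Real.toNNReal (t - s))

/-- The stochastic setting of the model: a filtered probability space carrying two
independent standard Brownian motions, together with the model parameters. -/
structure Setting (Ω : Type*) [mΩ : MeasurableSpace Ω] where
  P : Measure Ω
  isProb : IsProbabilityMeasure P
  F : Filtration ℝ mΩ
  W1 : ℝ → Ω → ℝ
  W2 : ℝ → Ω → ℝ
  bm1 : IsStdBM P F W1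
  bm2 : IsStdBM P F W2
  indepW : Indep (⨆ t : ℝ, MeasurableSpace.comap (W1 t) inferInstance)
      (⨆ t : ℝ, MeasurableSpace.comap (W2 t) inferInstance) P
  B : ℝ
  β₁ : ℝ
  β₂ : ℝ
  ρ : ℝ
  θ : ℝ
  σ : ℝ
  γ : ℝ
  R : ℝ
  hB : 0 ≤ B
  hβ₁ : 0 < β₁
  hβ₂ : 0 < β₂
  hρ₀ : 0 < ρ
  hρ₁ : ρ < 1
  hθ : 0 < θ
  hσ : 1 < σ
  hγ₀ : 0 ≤ γ
  hγ₁ : γ < 1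
  hR : 0 < R

variable {Ω : Type*} [mΩ : MeasurableSpace Ω]

/-- Pathwise-explicit solution of `dk_t = (B k_t - c_t) dt + β₁ k_t dW¹_t`, `k_0 = k₀`. -/
def kProc (S : Setting Ω) (k₀ : ℝ) (c : ℝ → Ω → ℝ) (t : ℝ) (ω : Ω) : ℝ :=
  Real.exp ((S.B - S.β₁ ^ 2 / 2) * t + S.β₁ * S.W1 t ω) *
    (k₀ - ∫ s in (0:ℝ)..t, c s ω * Real.exp (-((S.B - S.β₁ ^ 2 / 2) * s) - S.β₁ * S.W1 s ω))

/-- Pathwise-explicit solution of `dh_t = ρ (c_t - h_t) dt + β₂ h_t dW²_t`, `h_0 = h₀`. -/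
def hProc (S : Setting Ω) (h₀ : ℝ) (c : ℝ → Ω → ℝ) (t : ℝ) (ω : Ω) : ℝ :=
  Real.exp ((-S.ρ - S.β₂ ^ 2 / 2) * t + S.β₂ * S.W2 t ω) *
    (h₀ + S.ρ * ∫ s in (0:ℝ)..t, c s ω * Real.exp ((S.ρ + S.β₂ ^ 2 / 2) * s - S.β₂ * S.W2 s ω))

/-- Admissibility of a control `c` for the initial condition `(k₀, h₀)`: progressively
measurable, a.s. locally integrable trajectories, `c > 0` ℙ⊗dt-a.e., positive state
processes, and `c ≤ R·k` ℙ⊗dt-a.e. -/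
structure IsAdmissible (S : Setting Ω) (k₀ h₀ : ℝ) (c : ℝ → Ω → ℝ) : Prop where
  prog : ProgMeasurable S.F c
  locInt : ∀ᵐ ω ∂S.P, ∀ t : ℝ, 0 ≤ t → IntervalIntegrable (fun s => c s ω) volume 0 t
  cpos : ∀ᵐ ω ∂S.P, ∀ᵐ t ∂(volume.restrict (Set.Ici (0:ℝ))), 0 < c t ω
  kpos : ∀ᵐ ω ∂S.P, ∀ t : ℝ, 0 ≤ t → 0 < kProc S k₀ c t ω
  hpos : ∀ᵐ ω ∂S.P, ∀ t : ℝ, 0 ≤ t → 0 < hProc S h₀ c t ω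
  cbdd : ∀ᵐ ω ∂S.P, ∀ᵐ t ∂(volume.restrict (Set.Ici (0:ℝ))), c t ω ≤ S.R * kProc S k₀ c t ω

/-- The (nonnegative) cost `-J(k₀,h₀;c) ∈ [0,∞]`; note that
`(1/(1-σ))·(c/h^γ)^(1-σ) = -(1/(σ-1))·(h^γ/c)^(σ-1)`. -/
def Jcost (S : Setting Ω) (k₀ h₀ : ℝ) (c : ℝ → Ω → ℝ) : ℝ≥0∞ :=
  ∫⁻ ω, (∫⁻ t in Set.Ioi (0:ℝ),
    ENNReal.ofReal ((S.σ - 1)⁻¹ * ((hProc S h₀ c t ω) ^ S.γ / c t ω) ^ (S.σ - 1) *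
      Real.exp (-S.θ * t))) ∂S.P

/-- The utility functional `J(k₀,h₀;c) ∈ [-∞,0]`. -/
def J (S : Setting Ω) (k₀ h₀ : ℝ) (c : ℝ → Ω → ℝ) : EReal := -(Jcost S k₀ h₀ c : EReal)

/-- The infimum of the costs `-J(k₀,h₀;c)` over admissible controls. -/
def Vcost (S : Setting Ω) (k₀ h₀ : ℝ) : ℝ≥0∞ :=
  ⨅ c : {c : ℝ → Ω → ℝ // IsAdmissible S k₀ h₀ c}, Jcost S k₀ h₀ c.1

/-- The value function `V(k₀,h₀) = sup_{c ∈ 𝓐(k₀,h₀)} J(k₀,h₀;c) ∈ [-∞,0]`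
(the supremum of `J = -Jcost` equals minus the infimum of the costs). -/
def V (S : Setting Ω) (k₀ h₀ : ℝ) : EReal := -(Vcost S k₀ h₀ : EReal)

/-- Assumption 1 on the model parameters (with `λ = max{2, 1/(γ(σ-1))}`; it forces `γ > 0`). -/
def Assumption1 (S : Setting Ω) : Prop :=
  S.B ≤ S.R ∧ 0 < S.γ ∧
    (S.ρ + (S.β₂ ^ 2 - S.β₁ ^ 2) / 2 ≤ 0 →
      (S.σ - 1) * (-S.γ * S.ρ - (S.γ * S.β₂ ^ 2 - S.β₁ ^ 2) / 2 +
        max 2 (1 / (S.γ * (S.σ - 1))) * (S.σ - 1) * (S.β₁ ^ 2 + S.γ ^ 2 * S.β₂ ^ 2)) < S.θ) ∧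
    (0 < S.ρ + (S.β₂ ^ 2 - S.β₁ ^ 2) / 2 →
      (S.σ - 1) * (S.β₁ ^ 2 * (1 - S.γ) / 2 +
        max 2 (1 / (S.γ * (S.σ - 1))) * (S.σ - 1) * (S.β₁ ^ 2 + S.γ ^ 2 * S.β₂ ^ 2)) < S.θ)

/-- An `[0,∞]`-valued stopping time for the filtration `F`. -/
def IsStoppingTimeE (F : Filtration ℝ mΩ) (τ : Ω → ℝ≥0∞) : Prop :=
  ∀ t : ℝ, 0 ≤ t → MeasurableSet[F t] {ω | τ ω ≤ ENNReal.ofReal t}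

/-- The expected reward obtained by running the admissible control `c` up to the stopping
time `τ` and collecting `e^{-θτ}·V(k_τ,h_τ)` at `τ` (taken `0` on `{τ = ∞}`); writing
`V = -Vcost`, it equals minus the corresponding expected cost. -/
def stoppedReward (S : Setting Ω) (k₀ h₀ : ℝ) (c : ℝ → Ω → ℝ) (τ : Ω → ℝ≥0∞) : EReal :=
  -((∫⁻ ω, ((∫⁻ t in {t : ℝ | 0 < t ∧ ENNReal.ofReal t < τ ω},
        ENNReal.ofReal ((S.σ - 1)⁻¹ * ((hProc S h₀ c t ω) ^ S.γ / c t ω) ^ (S.σ - 1) *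
          Real.exp (-S.θ * t)))
      + (if τ ω = ∞ then 0 else
          ENNReal.ofReal (Real.exp (-S.θ * (τ ω).toReal)) *
            Vcost S (kProc S k₀ c ((τ ω).toReal) ω) (hProc S h₀ c ((τ ω).toReal) ω)))
      ∂S.P : ℝ≥0∞) : EReal)


set_option linter.all false

open Filter (Tendsto atTop liminf Eventually)
open ENNReal (ofReal_ne_top toReal_nonneg ofReal_mul ofReal_le_ofReal measurable_ofReal ofReal_lt_top ofReal_le_one)
local notation "oR" => ENNReal.ofReal

section

structure Par where
  B : ℝ
  β₁ : ℝ
  β₂ : ℝ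
  ρ : ℝ
  θ : ℝ
  b : ℝ
  a : ℝ
  R : ℝ
  hB : 0 ≤ B
  hβ₁ : 0 < β₁
  hβ₂ : 0 < β₂
  hρ₀ : 0 < ρ
  hθ : 0 < θ
  hb : 0 < b
  ha : 0 < a
  hab : a < b
  ha1 : a ≤ 1
  hR : 0 < R
  hBR : B ≤ R
  as1 : ρ + (β₂ ^ 2 - β₁ ^ 2) / 2 ≤ 0 → -a * ρ - (a * β₂ ^ 2 - b * β₁ ^ 2) / 2 + max 2 (1 / a) * (b ^ 2 * β₁ ^ 2 + a ^ 2 * β₂ ^ 2) < θ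
  as2 : 0 < ρ + (β₂ ^ 2 - β₁ ^ 2) / 2 → β₁ ^ 2 * (b - a) / 2 + max 2 (1 / a) * (b ^ 2 * β₁ ^ 2 + a ^ 2 * β₂ ^ 2) < θ

abbrev Path := C(ℝ, ℝ × ℝ)

instance instMSPath : MeasurableSpace Path :=
  MeasurableSpace.comap (fun (w : Path) (t : ℝ) => w t) MeasurableSpace.pi

lemma measurable_path_iff {X : Type*} [MeasurableSpace X] {f : X → Path} : Measurable f ↔ ∀ t, Measurable fun x => f x t := by
  rw [measurable_comap_iff, measurable_pi_iff]; rfl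

lemma measurable_eval (t : ℝ) : Measurable fun w : Path => w t :=
  (measurable_path_iff (f := fun w : Path => w)).1 measurable_id t

lemma measurable_eval₂ : Measurable fun q : ℝ × Path => q.2 q.1 :=
  measurable_uncurry_of_continuous_of_measurable (u := fun (t : ℝ) (w : Path) => w t) (fun w => w.continuous) (fun t => measurable_eval t)

lemma Meas.eval {X : Type*} [MeasurableSpace X] {f : X → Path} {t : X → ℝ} (hf : Measurable f) (ht : Measurable t) : Measurable fun x => f x (t x) :=
  measurable_eval₂.comp (ht.prodMk hf)

def shift (s : ℝ) (w : Path) : Path :=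
  ⟨fun t => w (s + max t 0) - w s, by fun_prop⟩

def frz (s : ℝ) (w : Path) : Path := ⟨fun t => w (min t s), by fun_prop⟩

@[simp] lemma shift_apply (s : ℝ) (w : Path) (t : ℝ) : shift s w t = w (s + max t 0) - w s := rfl
@[simp] lemma frz_apply (s : ℝ) (w : Path) (t : ℝ) : frz s w t = w (min t s) := rfl

lemma Meas.shift {X : Type*} [MeasurableSpace X] {f : X → Path} {t : X → ℝ} (hf : Measurable f) (ht : Measurable t) : Measurable fun x => shift (t x) (f x) := by
  rw [measurable_path_iff]; intro r
  exact (Meas.eval hf (ht.add_const _)).sub (Meas.eval hf ht)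

lemma Meas.frz {X : Type*} [MeasurableSpace X] {f : X → Path} {t : X → ℝ} (hf : Measurable f) (ht : Measurable t) : Measurable fun x => frz (t x) (f x) := by
  rw [measurable_path_iff]; intro r
  exact measurable_eval₂.comp ((measurable_const.min ht).prodMk hf)

lemma shift_shift {s r : ℝ} (hr : 0 ≤ r) (w : Path) : shift r (shift s w) = shift (s + r) w := by
  ext t <;> simp [hr, add_nonneg hr (le_max_right t 0), add_assoc]

variable (p : Par)

structure OkU (u : ℝ → ℝ) : Prop where
  meas : Measurable u
  pos : ∀ t, 0 < u t
  le : ∀ t, u t ≤ p.R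

def E1 (w : Path) (t : ℝ) : ℝ := rexp ((p.B - p.β₁ ^ 2 / 2) * t + p.β₁ * (w t).1)
def E2 (w : Path) (t : ℝ) : ℝ := rexp ((-p.ρ - p.β₂ ^ 2 / 2) * t + p.β₂ * (w t).2)
def Kx (k : ℝ) (u : ℝ → ℝ) (w : Path) (t : ℝ) : ℝ :=
  k * E1 p w t * rexp (-∫ s in 0..t, u s)
def Hi (k : ℝ) (u : ℝ → ℝ) (w : Path) (t : ℝ) : ℝ := u t * Kx p k u w t / E2 p w t
def Hx (k h : ℝ) (u : ℝ → ℝ) (w : Path) (t : ℝ) : ℝ :=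
  E2 p w t * (h + p.ρ * ∫ s in 0..t, Hi p k u w s)
def cf (H x K : ℝ) : ℝ := p.b⁻¹ * (H ^ p.a * x ^ (-p.b) * K ^ (-p.b))
def run (k h : ℝ) (u : ℝ → ℝ) (w : Path) (t : ℝ) : ℝ≥0∞ :=
  oR (cf p (Hx p k h u w t) (u t) (Kx p k u w t) * rexp (-p.θ * t))
def cst (k h : ℝ) (u : ℝ → ℝ) (w : Path) : ℝ≥0∞ := ∫⁻ t in Ioi (0:ℝ), run p k h u w t

variable {p}

lemma E1_pos (w : Path) (t : ℝ) : 0 < E1 p w t := exp_pos _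
lemma E2_pos (w : Path) (t : ℝ) : 0 < E2 p w t := exp_pos _
lemma E1_cont (w : Path) : Continuous (E1 p w) := by unfold E1; fun_prop
lemma E2_cont (w : Path) : Continuous (E2 p w) := by unfold E2; fun_prop

lemma OkU.intble {u : ℝ → ℝ} (hu : OkU p u) (s t : ℝ) : IntervalIntegrable u volume s t := by
  have : IntervalIntegrable (fun _ => p.R) volume s t := intervalIntegrable_const
  refine this.mono_fun' hu.meas.aestronglyMeasurable (ae_of_all _ fun x => ?_)
  simp only [Real.norm_of_nonneg (hu.pos x).le]; exact hu.le x

lemma OkU.shift {u : ℝ → ℝ} (hu : OkU p u) (s : ℝ) : OkU p (fun t => u (s + t)) :=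
  ⟨hu.meas.comp (measurable_const_add s), fun t => hu.pos _, fun t => hu.le _⟩

lemma OkU.int_nonneg {u : ℝ → ℝ} (hu : OkU p u) {t : ℝ} (ht : 0 ≤ t) : 0 ≤ ∫ s in 0..t, u s :=
  intervalIntegral.integral_nonneg ht fun x _ => (hu.pos x).le

lemma OkU.int_le {u : ℝ → ℝ} (hu : OkU p u) {t : ℝ} (ht : 0 ≤ t) : ∫ s in 0..t, u s ≤ p.R * t := by
  have := intervalIntegral.integral_mono_on ht (hu.intble 0 t) (intervalIntegrable_const (c := p.R)) (fun x _ => hu.le x)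
  simpa [mul_comm] using this

lemma OkU.int_cont {u : ℝ → ℝ} (hu : OkU p u) : Continuous fun t => ∫ s in 0..t, u s :=
  intervalIntegral.continuous_primitive (fun a b => hu.intble a b) 0

lemma Kx_pos {k : ℝ} (hk : 0 < k) (u : ℝ → ℝ) (w : Path) (t : ℝ) : 0 < Kx p k u w t := by
  unfold Kx; have := E1_pos (p := p) w t; positivity

lemma Kx_cont {k : ℝ} {u : ℝ → ℝ} (hu : OkU p u) (w : Path) : Continuous (Kx p k u w) := by
  unfold Kx
  exact (continuous_const.mul (E1_cont w)).mul (Real.continuous_exp.comp hu.int_cont.neg)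

lemma Hi_intble {k : ℝ} {u : ℝ → ℝ} (hu : OkU p u) (w : Path) (s t : ℝ) : IntervalIntegrable (Hi p k u w) volume s t := by
  have : Continuous fun t => Kx p k u w t / E2 p w t :=
    (Kx_cont hu w).div₀ (E2_cont w) fun t => (E2_pos w t).ne'
  have h2 := (hu.intble s t).mul_continuousOn this.continuousOn
  refine h2.congr (fun x _ => ?_)
  simp only [Hi]; ring

lemma Hi_pos {k : ℝ} (hk : 0 < k) {u : ℝ → ℝ} (hu : OkU p u) (w : Path) (t : ℝ) : 0 < Hi p k u w t := by
  have := Kx_pos (p := p) hk u w t; have := hu.pos t; have := E2_pos (p := p) w t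
  unfold Hi; positivity

lemma Hi_int_nonneg {k : ℝ} (hk : 0 < k) {u : ℝ → ℝ} (hu : OkU p u) (w : Path) {t : ℝ} (ht : 0 ≤ t) : 0 ≤ ∫ s in 0..t, Hi p k u w s :=
  intervalIntegral.integral_nonneg ht fun x _ => (Hi_pos hk hu w x).le

lemma Hx_pos {k h : ℝ} (hk : 0 < k) (hh : 0 < h) {u : ℝ → ℝ} (hu : OkU p u) (w : Path) {t : ℝ} (ht : 0 ≤ t) : 0 < Hx p k h u w t := by
  have := Hi_int_nonneg hk hu w ht; have := E2_pos (p := p) w t; have := p.hρ₀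
  unfold Hx; positivity

lemma Hx_cont {k h : ℝ} {u : ℝ → ℝ} (hu : OkU p u) (w : Path) : Continuous (Hx p k h u w) := by
  unfold Hx
  refine (E2_cont w).mul (continuous_const.add (continuous_const.mul ?_))
  exact intervalIntegral.continuous_primitive (fun a b => Hi_intble hu w a b) 0

/- flow -/
lemma E1_flow (w : Path) (s : ℝ) {t : ℝ} (ht : 0 ≤ t) : E1 p w (s + t) = E1 p w s * E1 p (shift s w) t := by
  unfold E1; rw [← exp_add]; congr 1; simp [ht]; ring

lemma E2_flow (w : Path) (s : ℝ) {t : ℝ} (ht : 0 ≤ t) : E2 p w (s + t) = E2 p w s * E2 p (shift s w) t := by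
  unfold E2; rw [← exp_add]; congr 1; simp [ht]; ring

lemma Kx_flow (k : ℝ) {u : ℝ → ℝ} (hu : OkU p u) (w : Path) (s : ℝ) {t : ℝ} (ht : 0 ≤ t) : Kx p k u w (s + t) = Kx p (Kx p k u w s) (fun r => u (s + r)) (shift s w) t := by
  unfold Kx
  have h1 : ∫ r in 0..t, u (s + r) = ∫ r in s..(s + t), u r := by
    rw [intervalIntegral.integral_comp_add_left (fun r => u r) s]; simp
  rw [h1, ← intervalIntegral.integral_add_adjacent_intervals (hu.intble 0 s) (hu.intble s (s+t)), E1_flow w s ht, neg_add, exp_add]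
  ring

lemma Hi_flow (k : ℝ) {u : ℝ → ℝ} (hu : OkU p u) (w : Path) (s : ℝ) {t : ℝ} (ht : 0 ≤ t) : Hi p k u w (s + t) * E2 p w s = Hi p (Kx p k u w s) (fun r => u (s + r)) (shift s w) t := by
  unfold Hi
  rw [Kx_flow k hu w s ht, E2_flow w s ht]
  have := (E2_pos (p := p) w s).ne'; have := (E2_pos (p := p) (shift s w) t).ne'
  field_simp

lemma Hx_flow (k h : ℝ) {u : ℝ → ℝ} (hu : OkU p u) (w : Path) (s : ℝ) {t : ℝ} (ht : 0 ≤ t) : Hx p k h u w (s + t) = Hx p (Kx p k u w s) (Hx p k h u w s) (fun r => u (s + r)) (shift s w) t := by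
  have h1 : ∫ r in 0..t, Hi p (Kx p k u w s) (fun r => u (s + r)) (shift s w) r = (∫ r in s..(s + t), Hi p k u w r) * E2 p w s := by
    have : ∫ r in s..(s + t), Hi p k u w r = ∫ r in 0..t, Hi p k u w (s + r) := by
      rw [intervalIntegral.integral_comp_add_left (fun r => Hi p k u w r) s]; simp
    rw [this, ← intervalIntegral.integral_mul_const]
    refine intervalIntegral.integral_congr fun r hr => ?_
    rw [uIcc_of_le ht] at hr
    exact (Hi_flow k hu w s hr.1).symm
  rw [Hx, Hx, Hx, h1, ← intervalIntegral.integral_add_adjacent_intervals (Hi_intble hu w 0 s) (Hi_intble hu w s (s+t)), E2_flow w s ht]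
  ring

lemma run_flow (k h : ℝ) {u : ℝ → ℝ} (hu : OkU p u) (w : Path) (s : ℝ) {t : ℝ} (ht : 0 ≤ t) : run p k h u w (s + t) = oR (rexp (-p.θ * s)) * run p (Kx p k u w s) (Hx p k h u w s) (fun r => u (s + r)) (shift s w) t := by
  unfold run
  rw [← ofReal_mul (exp_pos _).le, Kx_flow k hu w s ht, Hx_flow k h hu w s ht]
  congr 1
  rw [mul_add, exp_add]; ring

lemma lintegral_Ioi_shift (f : ℝ → ℝ≥0∞) (s : ℝ) : ∫⁻ t in Ioi s, f t = ∫⁻ t in Ioi (0:ℝ), f (s + t) := by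
  have := (measurePreserving_add_left (volume : Measure ℝ) s).setLIntegral_comp_preimage_emb (measurableEmbedding_addLeft s) f (Ioi s)
  rw [← this]; congr 2; ext; simp

lemma cst_flow (k h : ℝ) {u : ℝ → ℝ} (hu : OkU p u) (w : Path) (s : ℝ) : ∫⁻ t in Ioi s, run p k h u w t = oR (rexp (-p.θ * s)) * cst p (Kx p k u w s) (Hx p k h u w s) (fun r => u (s + r)) (shift s w) := by
  rw [lintegral_Ioi_shift, cst, ← lintegral_const_mul' _ _ ofReal_ne_top]
  exact setLIntegral_congr_fun measurableSet_Ioi fun t ht => run_flow k h hu w s (le_of_lt ht)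

lemma cst_split (k h : ℝ) {u : ℝ → ℝ} (hu : OkU p u) (w : Path) {s : ℝ} (hs : 0 ≤ s) : cst p k h u w = (∫⁻ t in Ioc 0 s, run p k h u w t) + oR (rexp (-p.θ * s)) * cst p (Kx p k u w s) (Hx p k h u w s) (fun r => u (s + r)) (shift s w) := by
  rw [← cst_flow k h hu w s, cst, ← Ioc_union_Ioi_eq_Ioi hs, lintegral_union measurableSet_Ioi (by
      rw [Set.disjoint_left]; intro x hx hx'; exact absurd hx.2 (not_le.2 hx'))]

/- congruence: dependence only on the past -/
lemma Kx_congr {k : ℝ} {u u' : ℝ → ℝ} {w w' : Path} {t : ℝ} (ht : 0 ≤ t) (hu : ∀ s, 0 < s → s ≤ t → u s = u' s) (hw : w t = w' t) : Kx p k u w t = Kx p k u' w' t := by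
  unfold Kx E1
  rw [hw, intervalIntegral.integral_congr_ae]
  rw [uIoc_of_le ht]
  exact ae_of_all _ fun s hs => hu s hs.1 hs.2

lemma Hx_congr {k h : ℝ} {u u' : ℝ → ℝ} {w w' : Path} {t : ℝ} (ht : 0 ≤ t) (hu : ∀ s, 0 < s → s ≤ t → u s = u' s) (hw : ∀ s, 0 ≤ s → s ≤ t → w s = w' s) : Hx p k h u w t = Hx p k h u' w' t := by
  unfold Hx E2
  rw [hw t ht le_rfl, intervalIntegral.integral_congr_ae]
  rw [uIoc_of_le ht]
  refine ae_of_all _ fun s hs => ?_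
  unfold Hi E2
  rw [Kx_congr hs.1.le (fun r hr hr' => hu r hr (hr'.trans hs.2)) (hw s hs.1.le hs.2), hw s hs.1.le hs.2, hu s hs.1 hs.2]

lemma run_congr {k h : ℝ} {u u' : ℝ → ℝ} {w w' : Path} {t : ℝ} (ht : 0 < t) (hu : ∀ s, 0 < s → s ≤ t → u s = u' s) (hw : ∀ s, 0 ≤ s → s ≤ t → w s = w' s) : run p k h u w t = run p k h u' w' t := by
  unfold run
  rw [Hx_congr ht.le hu hw, Kx_congr ht.le hu (hw t ht.le le_rfl), hu t ht le_rfl]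

/- comparison -/
lemma cf_nonneg {H x K : ℝ} (hH : 0 ≤ H) (hx : 0 ≤ x) (hK : 0 ≤ K) : 0 ≤ cf p H x K := by
  unfold cf; have := p.hb; positivity

lemma cf_le {H x K H' x' K' c d e : ℝ} (hH : 0 < H) (hx : 0 < x) (hK : 0 < K) (hH' : 0 < H') (hx' : 0 < x') (hK' : 0 < K') (hd : 0 < d) (he : 0 < e) (h1 : H' ≤ c * H) (h2 : d * x ≤ x') (h3 : e * K ≤ K') : cf p H' x' K' ≤ c ^ p.a * d ^ (-p.b) * e ^ (-p.b) * cf p H x K := by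
  have hc : 0 < c := by
    by_contra hc; push Not at hc; nlinarith
  have g1 : H' ^ p.a ≤ c ^ p.a * H ^ p.a := by
    rw [← Real.mul_rpow hc.le hH.le]; exact rpow_le_rpow hH'.le h1 p.ha.le
  have g2 : x' ^ (-p.b) ≤ d ^ (-p.b) * x ^ (-p.b) := by
    rw [← Real.mul_rpow hd.le hx.le]
    exact rpow_le_rpow_of_nonpos (by positivity) h2 (by linarith [p.hb])
  have g3 : K' ^ (-p.b) ≤ e ^ (-p.b) * K ^ (-p.b) := by
    rw [← Real.mul_rpow he.le hK.le]
    exact rpow_le_rpow_of_nonpos (by positivity) h3 (by linarith [p.hb])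
  have hb := p.hb
  calc cf p H' x' K' ≤ p.b⁻¹ * ((c ^ p.a * H ^ p.a) * (d ^ (-p.b) * x ^ (-p.b)) * (e ^ (-p.b) * K ^ (-p.b))) := by unfold cf; gcongr
    _ = _ := by unfold cf; ring

end

section

section meas
variable {X : Type*} [MeasurableSpace X] {p : Par}

lemma meas_int {g : ℝ → X → ℝ} (hg : Measurable fun q : ℝ × X => g q.1 q.2) {T : X → ℝ} (hT : Measurable T) : Measurable fun x => ∫ s in 0..T x, g s x := by
  have key : ∀ {A B : X → ℝ}, Measurable A → Measurable B → Measurable fun x => ∫ s in Ioc (A x) (B x), g s x := by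
    intro A B hA hB
    have h1 : Measurable fun q : X × ℝ =>
        (if A q.1 < q.2 ∧ q.2 ≤ B q.1 then g q.2 q.1 else 0) := by
      refine Measurable.ite ?_ (hg.comp (measurable_snd.prodMk measurable_fst)) measurable_const
      exact (measurableSet_lt (hA.comp measurable_fst) measurable_snd).inter (measurableSet_le measurable_snd (hB.comp measurable_fst))
    have h2 := (h1.stronglyMeasurable.integral_prod_right' (ν := (volume : Measure ℝ))).measurable
    convert h2 using 2 with x
    rw [← integral_indicator measurableSet_Ioc]
    refine integral_congr_ae (ae_of_all _ fun y => ?_)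
    simp [Set.indicator_apply]
  simp only [intervalIntegral]
  exact (key measurable_const hT).sub (key hT measurable_const)

variable {u : ℝ → X → ℝ} (hu : Measurable fun q : ℝ × X => u q.1 q.2) {f : X → Path} (hf : Measurable f) {K H T : X → ℝ} (hK : Measurable K) (hH : Measurable H) (hT : Measurable T)

include hf hT in
lemma meas_E1 : Measurable fun x => E1 p (f x) (T x) := by
  unfold E1
  exact Real.measurable_exp.comp (((measurable_const.mul hT)).add (measurable_const.mul (measurable_fst.comp (Meas.eval hf hT))))

include hf hT in
lemma meas_E2 : Measurable fun x => E2 p (f x) (T x) := by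
  unfold E2
  exact Real.measurable_exp.comp (((measurable_const.mul hT)).add (measurable_const.mul (measurable_snd.comp (Meas.eval hf hT))))

include hu hf hK hT in
lemma meas_Kx : Measurable fun x => Kx p (K x) (fun s => u s x) (f x) (T x) := by
  unfold Kx
  exact (hK.mul (meas_E1 hf hT)).mul (Real.measurable_exp.comp (meas_int hu hT).neg)

include hu hf hK hT in
lemma meas_Hi : Measurable fun x => Hi p (K x) (fun s => u s x) (f x) (T x) := by
  unfold Hi
  exact ((hu.comp (hT.prodMk measurable_id)).mul (meas_Kx hu hf hK hT)).div (meas_E2 hf hT)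

include hu in
lemma meas_lift {Y : Type*} [MeasurableSpace Y] : Measurable fun q : ℝ × (Y × X) => u q.1 q.2.2 :=
  hu.comp (measurable_fst.prodMk (measurable_snd.comp measurable_snd))

include hu hf hK hH hT in
lemma meas_Hx : Measurable fun x => Hx p (K x) (H x) (fun s => u s x) (f x) (T x) := by
  unfold Hx
  refine (meas_E2 hf hT).mul (hH.add (measurable_const.mul ?_))
  refine meas_int (g := fun s x => Hi p (K x) (fun s => u s x) (f x) s) ?_ hT
  exact meas_Hi (X := ℝ × X) (u := fun s q => u s q.2) (f := fun q => f q.2) (K := fun q => K q.2) (T := fun q => q.1) (meas_lift hu) (hf.comp measurable_snd) (hK.comp measurable_snd) measurable_fst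

include hu hf hK hH hT in
lemma meas_run : Measurable fun x => run p (K x) (H x) (fun s => u s x) (f x) (T x) := by
  unfold run cf
  refine measurable_ofReal.comp ?_
  have h1 := meas_Hx (p := p) hu hf hK hH hT
  have h2 := meas_Kx (p := p) hu hf hK hT
  have h3 := (hu.comp (hT.prodMk measurable_id))
  exact (measurable_const.mul (((h1.pow_const _).mul (h3.pow_const _)).mul (h2.pow_const _))).mul (Real.measurable_exp.comp (measurable_const.mul hT))

include hu hf hK hH in
lemma meas_run₂ : Measurable fun q : ℝ × X =>
    run p (K q.2) (H q.2) (fun s => u s q.2) (f q.2) q.1 :=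
  meas_run (X := ℝ × X) (u := fun s q => u s q.2) (f := fun q => f q.2) (K := fun q => K q.2) (H := fun q => H q.2) (T := fun q => q.1) (meas_lift hu) (hf.comp measurable_snd) (hK.comp measurable_snd) (hH.comp measurable_snd) measurable_fst

include hu hf hK hH in
lemma meas_runset {D : X → Set ℝ} (hD : MeasurableSet {q : X × ℝ | q.2 ∈ D q.1}) : Measurable fun x => ∫⁻ t in D x, run p (K x) (H x) (fun s => u s x) (f x) t := by
  have h1 : Measurable fun q : X × ℝ => ({q : X × ℝ | q.2 ∈ D q.1}).indicator (fun q => run p (K q.1) (H q.1) (fun s => u s q.1) (f q.1) q.2) q :=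
    ((meas_run₂ hu hf hK hH).comp measurable_swap).indicator hD
  have h2 := h1.lintegral_prod_right' (ν := (volume : Measure ℝ))
  convert h2 using 2 with x
  have hDx : MeasurableSet (D x) := measurable_prodMk_left hD
  rw [← lintegral_indicator hDx]
  rfl

include hu hf hK hH in
lemma meas_cst : Measurable fun x => cst p (K x) (H x) (fun s => u s x) (f x) := by
  unfold cst
  exact meas_runset hu hf hK hH (D := fun _ => Ioi 0) (measurableSet_lt measurable_const measurable_snd)

end meas

variable {p : Par}

lemma OkU.const {x : ℝ} (hx : 0 < x) (hx' : x ≤ p.R) : OkU p fun _ => x :=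
  ⟨measurable_const, fun _ => hx, fun _ => hx'⟩

lemma run_meas (k h : ℝ) {u : ℝ → ℝ} (hu : OkU p u) (w : Path) : Measurable (run p k h u w) :=
  meas_run (X := ℝ) (u := fun t _ => u t) (hu.meas.comp measurable_fst) (f := fun _ => w) measurable_const (K := fun _ => k) measurable_const (H := fun _ => h)
    measurable_const (T := fun t => t) measurable_id

lemma Hx_le_of {k h k' h' c : ℝ} (hk : 0 < k) (hk' : 0 < k') {u u' : ℝ → ℝ} (hu : OkU p u) (hu' : OkU p u') (w : Path) {t : ℝ} (ht : 0 ≤ t) (hh : h' ≤ c * h) (hi : ∀ s, 0 ≤ s → s ≤ t → Hi p k' u' w s ≤ c * Hi p k u w s) : Hx p k' h' u' w t ≤ c * Hx p k h u w t := by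
  unfold Hx
  have h1 : ∫ s in 0..t, Hi p k' u' w s ≤ c * ∫ s in 0..t, Hi p k u w s := by
    rw [← intervalIntegral.integral_const_mul]
    refine intervalIntegral.integral_mono_on ht (Hi_intble hu' w 0 t) ((Hi_intble hu w 0 t).const_mul c) (fun x hx => hi x hx.1 hx.2)
  have := E2_pos (p := p) w t
  have := p.hρ₀
  calc _ ≤ E2 p w t * (c * h + p.ρ * (c * ∫ s in 0..t, Hi p k u w s)) := by gcongr
    _ = _ := by ring

lemma run_le_of {k h k' h' c d e : ℝ} (hk : 0 < k) (hh : 0 < h) (hk' : 0 < k') (hh' : 0 < h') {u u' : ℝ → ℝ} (hu : OkU p u) (hu' : OkU p u') (w : Path) {t : ℝ} (ht : 0 ≤ t) (hd : 0 < d) (he : 0 < e) (h1 : Hx p k' h' u' w t ≤ c * Hx p k h u w t) (h2 : d * u t ≤ u' t) (h3 : e * Kx p k u w t ≤ Kx p k' u' w t) : run p k' h' u' w t ≤ oR (c ^ p.a * d ^ (-p.b) * e ^ (-p.b)) * run p k h u w t := by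
  have hc : 0 < c := by
    have := Hx_pos hk hh hu w ht; have := Hx_pos hk' hh' hu' w ht
    by_contra hc; push Not at hc; nlinarith
  unfold run
  rw [← ofReal_mul (by positivity), ← mul_assoc]
  refine ofReal_le_ofReal (mul_le_mul_of_nonneg_right ?_ (exp_pos _).le)
  exact cf_le (Hx_pos hk hh hu w ht) (hu.pos t) (Kx_pos hk u w t) (Hx_pos hk' hh' hu' w ht) (hu'.pos t) (Kx_pos hk' u' w t) hd he h1 h2 h3

lemma run_scale {k h k' h' c e : ℝ} (hk : 0 < k) (hh : 0 < h) (hk' : 0 < k') (hh' : 0 < h') {u : ℝ → ℝ} (hu : OkU p u) (w : Path) (he : 0 < e) (h1 : e * k ≤ k') (h2 : k' ≤ c * k) (h3 : h' ≤ c * h) {t : ℝ} (ht : 0 ≤ t) : run p k' h' u w t ≤ oR (c ^ p.a * e ^ (-p.b)) * run p k h u w t := by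
  have hKx : ∀ x s, Kx p x u w s = x * Kx p 1 u w s := by intro x s; unfold Kx; ring
  have hHi : ∀ x s, Hi p x u w s = x * Hi p 1 u w s := by
    intro x s; unfold Hi; rw [hKx x]; ring
  have := run_le_of (c := c) (d := 1) (e := e) hk hh hk' hh' hu hu w ht one_pos he (Hx_le_of hk hk' hu hu w ht h3 fun s hs hs' => by
      rw [hHi k', hHi k, ← mul_assoc]
      exact mul_le_mul_of_nonneg_right h2 (Hi_pos one_pos hu w s).le) (by simp)
    (by rw [hKx k', hKx k, ← mul_assoc]
        exact mul_le_mul_of_nonneg_right h1 (Kx_pos one_pos u w t).le)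
  simpa using this

lemma cst_scale {k h k' h' c e : ℝ} (hk : 0 < k) (hh : 0 < h) (hk' : 0 < k') (hh' : 0 < h') {u : ℝ → ℝ} (hu : OkU p u) (w : Path) (he : 0 < e) (h1 : e * k ≤ k') (h2 : k' ≤ c * k) (h3 : h' ≤ c * h) : cst p k' h' u w ≤ oR (c ^ p.a * e ^ (-p.b)) * cst p k h u w := by
  unfold cst
  rw [← lintegral_const_mul' _ _ ofReal_ne_top]
  exact setLIntegral_mono' measurableSet_Ioi fun t ht =>
    run_scale hk hh hk' hh' hu w he h1 h2 h3 (le_of_lt ht)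

end

section

lemma path_ext {ν₁ ν₂ : Measure Path} [IsFiniteMeasure ν₁] [IsFiniteMeasure ν₂] (h : ∀ I : Finset ℝ, ν₁.map (fun w (i : I) => w i) = ν₂.map (fun w (i : I) => w i)) : ν₁ = ν₂ := by
  have hev : Measurable (fun (w : Path) (t : ℝ) => w t) :=
    measurable_pi_iff.2 measurable_eval
  have hI : ∀ I : Finset ℝ, Measurable (fun (w : ℝ → ℝ × ℝ) => I.restrict w) := fun I => by
    fun_prop
  have h1 : ν₁.map (fun (w : Path) (t : ℝ) => w t) = ν₂.map (fun (w : Path) (t : ℝ) => w t) := by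
    have P1 : IsProjectiveLimit (ν₁.map (fun (w : Path) (t : ℝ) => w t)) (fun I : Finset ℝ => (ν₁.map (fun (w : Path) (t : ℝ) => w t)).map I.restrict) :=
      fun I => rfl
    have P2 : IsProjectiveLimit (ν₂.map (fun (w : Path) (t : ℝ) => w t)) (fun I : Finset ℝ => (ν₁.map (fun (w : Path) (t : ℝ) => w t)).map I.restrict) := by
      intro I
      have e1 := Measure.map_map (μ := ν₁) (hI I) hev
      have e2 := Measure.map_map (μ := ν₂) (hI I) hev
      exact e2.trans ((h I).symm.trans e1.symm)
    exact P1.unique P2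
  refine Measure.ext fun s hs => ?_
  obtain ⟨t, ht, rfl⟩ := hs
  have := congrArg (fun m => m t) h1
  simpa [Measure.map_apply hev ht] using this

lemma path_ext_bcf {ν₁ ν₂ : Measure Path} [IsFiniteMeasure ν₁] [IsFiniteMeasure ν₂] (h : ∀ (I : Finset ℝ) (g : BoundedContinuousFunction (I → ℝ × ℝ) ℝ), ∫ w, g (fun i => w i) ∂ν₁ = ∫ w, g (fun i => w i) ∂ν₂) : ν₁ = ν₂ := by
  refine path_ext fun I => ?_
  have hm : Measurable (fun (w : Path) (i : I) => w i) := measurable_pi_iff.2 fun i => measurable_eval _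
  refine ext_of_forall_integral_eq_of_IsFiniteMeasure fun g => ?_
  rw [integral_map hm.aemeasurable g.continuous.aestronglyMeasurable, integral_map hm.aemeasurable g.continuous.aestronglyMeasurable]
  exact h I g

structure Sys (μ : Measure Path) (P : Measure Ω) (F : Filtration ℝ mΩ) (W : Ω → Path) : Prop where
  fin : IsFiniteMeasure P
  prob : IsProbabilityMeasure μ
  adapted : ∀ t, 0 ≤ t → Measurable[F t] (fun ω => W ω t)
  zero : ∀ ω t, t ≤ 0 → W ω t = 0
  markov : ∀ s, 0 ≤ s → ∀ A, MeasurableSet[F s] A → (P.restrict A).map (fun ω => shift s (W ω)) = P A • μ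

def shiftF (F : Filtration ℝ mΩ) (s : ℝ) : Filtration ℝ mΩ where
  seq t := F (s + t)
  mono' := fun _ _ h => F.mono (by linarith)
  le' := fun t => F.le _

variable {μ : Measure Path} {P : Measure Ω} {F : Filtration ℝ mΩ} {W : Ω → Path}

lemma Sys.evalF (hS : Sys μ P F W) {s t : ℝ} (ht : 0 ≤ t) (hst : s ≤ t) : Measurable[F t] (fun ω => W ω s) := by
  rcases le_total s 0 with h | h
  · have : (fun ω => W ω s) = fun _ => 0 := funext fun ω => hS.zero ω s h
    rw [this]; exact measurable_const
  · exact (hS.adapted s h).mono (F.mono hst) le_rfl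

lemma Sys.measW (hS : Sys μ P F W) : Measurable W := by
  rw [measurable_path_iff]; intro t
  exact (hS.evalF (le_max_right t 0) (le_max_left t 0)).mono (F.le _) le_rfl

lemma Sys.frzF (hS : Sys μ P F W) {t : ℝ} (ht : 0 ≤ t) : Measurable[F t] (fun ω => frz t (W ω)) := by
  refine (@measurable_path_iff Ω (F t) _).2 fun s => ?_
  exact hS.evalF ht (min_le_right s t)

lemma Sys.restrict (hS : Sys μ P F W) {A : Set Ω} (hA : MeasurableSet[F 0] A) : Sys μ (P.restrict A) F W := by
  have := hS.fin
  refine ⟨inferInstance, hS.prob, hS.adapted, hS.zero, fun s hs C hC => ?_⟩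
  have hC' := F.le _ _ hC
  rw [Measure.restrict_restrict hC', Measure.restrict_apply hC', hS.markov s hs _ (hC.inter (F.mono hs _ hA))]

lemma Sys.shift (hS : Sys μ P F W) {s : ℝ} (hs : 0 ≤ s) : Sys μ P (shiftF F s) (fun ω => HabitModel.shift s (W ω)) := by
  refine ⟨hS.fin, hS.prob, fun t ht => ?_, fun ω t ht => by simp [ht], fun r hr A hA => ?_⟩
  · have h1 := hS.evalF (s := s + max t 0) (t := s + t) (by linarith) (by simp [ht])
    have h2 := hS.evalF (s := s) (t := s + t) (by linarith) (by linarith)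
    exact h1.sub h2
  · simp only [shift_shift hr]
    exact hS.markov (s + r) (by linarith) A hA

lemma prod_of_markov {Y Z : Type*} [MeasurableSpace Y] [MeasurableSpace Z] {P : Measure Ω} [IsFiniteMeasure P] {μ : Measure Z} [IsProbabilityMeasure μ] {X : Ω → Y} {f : Ω → Z} (hX : Measurable X) (hf : Measurable f) (h : ∀ D, MeasurableSet D → (P.restrict (X ⁻¹' D)).map f = P (X ⁻¹' D) • μ) : P.map (fun ω => (X ω, f ω)) = (P.map X).prod μ := by
  symm
  refine Measure.prod_eq fun s t hs ht => ?_
  rw [Measure.map_apply (hX.prodMk hf) (hs.prod ht), Measure.map_apply hX hs]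
  have := congrArg (fun m => m t) (h s hs)
  simp only [Measure.smul_apply, smul_eq_mul] at this
  rw [← this, Measure.map_apply hf ht, Measure.restrict_apply (hf ht)]
  congr 1; ext ω; simp [and_comm]

lemma Sys.markov_prod (hS : Sys μ P F W) {s : ℝ} (hs : 0 ≤ s) {Y : Type*} [MeasurableSpace Y] {X : Ω → Y} (hX : Measurable[F s] X) : P.map (fun ω => (X ω, HabitModel.shift s (W ω))) = (P.map X).prod μ := by
  have := hS.fin; have := hS.prob
  refine prod_of_markov (hX.mono (F.le _) le_rfl) (Meas.shift hS.measW measurable_const) fun D hD => hS.markov s hs _ (hX hD)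

def dyc (m : ℕ) (x : ℝ) : ℝ := (⌈x * 2 ^ m⌉₊ : ℝ) / 2 ^ m

lemma le_dyc (m : ℕ) (x : ℝ) : x ≤ dyc m x := by
  unfold dyc; rw [le_div_iff₀ (by positivity)]; exact Nat.le_ceil _

lemma dyc_le (m : ℕ) {x : ℝ} (hx : 0 ≤ x) : dyc m x ≤ x + (1/2) ^ m := by
  unfold dyc; rw [div_le_iff₀ (by positivity), add_mul, ← mul_pow]
  have := (Nat.ceil_lt_add_one (a := x * 2 ^ m) (by positivity)).le
  simpa using this

lemma dyc_tendsto {x : ℝ} (hx : 0 ≤ x) : Tendsto (fun m => dyc m x) atTop (nhds x) := by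
  refine tendsto_of_tendsto_of_tendsto_of_le_of_le tendsto_const_nhds ?_ (fun m => le_dyc m x) (fun m => dyc_le m hx)
  simpa using (tendsto_pow_atTop_nhds_zero_of_lt_one (r := (1/2:ℝ)) (by norm_num) (by norm_num)).const_add x

lemma dyc_meas (m : ℕ) : Measurable (dyc m) := by
  unfold dyc
  have : Measurable fun x : ℝ => ⌈x * 2 ^ m⌉₊ := Nat.measurable_ceil.comp (measurable_id.mul_const _)
  exact (measurable_from_nat.comp this).div_const _

lemma dyc_slice {A : Set Ω} {T : Ω → ℝ} (hA : ∀ t, 0 ≤ t → MeasurableSet[F t] (A ∩ {ω | T ω ≤ t})) (m j : ℕ) : MeasurableSet[F (j / 2 ^ m)] (A ∩ {ω | ⌈T ω * 2 ^ m⌉₊ = j}) := by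
  have hp : (0:ℝ) < 2 ^ m := by positivity
  rcases j with _ | j
  · have := hA 0 le_rfl
    have e : (A ∩ {ω | ⌈T ω * 2 ^ m⌉₊ = 0}) = A ∩ {ω | T ω ≤ 0} := by
      ext ω; simp only [mem_inter_iff, mem_setOf_eq, Nat.ceil_eq_zero, and_congr_right_iff]
      intro _; constructor
      · intro h; by_contra h'; push Not at h'; nlinarith
      · intro h; nlinarith
    rw [e, show ((0 : ℕ) : ℝ) / 2 ^ m = 0 by simp]; exact this
  · have h1 := hA ((j + 1 : ℕ) / 2 ^ m) (by positivity)
    have h2 := F.mono (show (j : ℝ) / 2 ^ m ≤ (j + 1 : ℕ) / 2 ^ m by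
      gcongr; simp) _ (hA ((j : ℝ) / 2 ^ m) (by positivity))
    have e : (A ∩ {ω | ⌈T ω * 2 ^ m⌉₊ = j + 1}) = (A ∩ {ω | T ω ≤ (j + 1 : ℕ) / 2 ^ m}) \ (A ∩ {ω | T ω ≤ (j : ℝ) / 2 ^ m}) := by
      ext ω
      simp only [mem_inter_iff, mem_setOf_eq, mem_diff, not_and]
      rw [le_div_iff₀ hp, le_div_iff₀ hp, ← Nat.ceil_le (n := j), ← Nat.ceil_le]
      constructor
      · rintro ⟨h, h'⟩; exact ⟨⟨h, h'.le⟩, fun _ => by omega⟩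
      · rintro ⟨⟨h, h'⟩, h''⟩; exact ⟨h, by have := h'' h; omega⟩
    rw [e]; exact h1.diff h2

lemma stime_meas {A : Set Ω} {T : Ω → ℝ} (hA : ∀ t, 0 ≤ t → MeasurableSet[F t] (A ∩ {ω | T ω ≤ t})) : MeasurableSet A := by
  have : A = ⋃ n : ℕ, A ∩ {ω | T ω ≤ n} := by
    ext ω; simp only [mem_iUnion, mem_inter_iff, mem_setOf_eq, exists_and_left, iff_self_and]
    intro _; exact exists_nat_ge _
  rw [this]; exact MeasurableSet.iUnion fun n => F.le _ _ (hA n (by positivity))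

lemma Sys.sm_dyadic (hS : Sys μ P F W) {A : Set Ω} {T : Ω → ℝ} (hT : Measurable T) (hA : ∀ t, 0 ≤ t → MeasurableSet[F t] (A ∩ {ω | T ω ≤ t})) (m : ℕ) : (P.restrict A).map (fun ω => HabitModel.shift (dyc m (T ω)) (W ω)) = P A • μ := by
  have hAm := stime_meas hA
  have hZ : Measurable fun ω => HabitModel.shift (dyc m (T ω)) (W ω) :=
    Meas.shift hS.measW ((dyc_meas m).comp hT)
  have hsl := dyc_slice hA m
  have hU : A = ⋃ j : ℕ, A ∩ {ω | ⌈T ω * 2 ^ m⌉₊ = j} := by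
    ext ω; simp
  have hd : Pairwise (Function.onFun Disjoint fun j : ℕ => A ∩ {ω | ⌈T ω * 2 ^ m⌉₊ = j}) := by
    intro i j hij
    rw [Function.onFun, Set.disjoint_left]
    rintro ω ⟨_, h1⟩ ⟨_, h2⟩; exact hij (h1.symm.trans h2)
  have hsl' := fun j => F.le _ _ (hsl j)
  refine Measure.ext fun E hE => ?_
  rw [Measure.map_apply hZ hE]
  conv_lhs => rw [hU]
  conv_rhs => rw [hU]
  rw [Measure.restrict_iUnion hd hsl', Measure.sum_apply _ (hZ hE)]
  simp only [Measure.smul_apply, smul_eq_mul]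
  rw [measure_iUnion hd hsl', ← ENNReal.tsum_mul_right]
  refine tsum_congr fun j => ?_
  have := congrArg (fun m => m E) (hS.markov (j / 2 ^ m) (by positivity) _ (hsl j))
  simp only [Measure.smul_apply, smul_eq_mul] at this
  have hZ2 : Measurable fun ω => HabitModel.shift (j / 2 ^ m) (W ω) :=
    Meas.shift hS.measW measurable_const
  rw [← this, Measure.map_apply hZ2 hE, Measure.restrict_apply (hZ hE), Measure.restrict_apply (hZ2 hE)]
  congr 1; ext ω
  simp only [mem_inter_iff, mem_preimage, mem_setOf_eq, and_congr_left_iff]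
  rintro ⟨_, h⟩
  rw [dyc, h]

lemma Sys.sm (hS : Sys μ P F W) {A : Set Ω} {T : Ω → ℝ} (hT : Measurable T) (hT0 : ∀ ω ∈ A, 0 ≤ T ω) (hA : ∀ t, 0 ≤ t → MeasurableSet[F t] (A ∩ {ω | T ω ≤ t})) : (P.restrict A).map (fun ω => HabitModel.shift (T ω) (W ω)) = P A • μ := by
  have := hS.fin; have := hS.prob
  have hAm := stime_meas hA
  have hZ : Measurable fun ω => HabitModel.shift (T ω) (W ω) := Meas.shift hS.measW hT
  have : IsFiniteMeasure (P A • μ) := by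
    refine ⟨?_⟩; simp
  refine path_ext_bcf fun I g => ?_
  have hm : Measurable (fun (w : Path) (i : I) => w i) := measurable_pi_iff.2 fun i => measurable_eval _
  have hg : Measurable fun w : Path => g (fun i => w i) := g.continuous.measurable.comp hm
  rw [integral_map hZ.aemeasurable hg.aestronglyMeasurable]
  have key : Tendsto (fun m => ∫ ω in A, g (fun i => HabitModel.shift (dyc m (T ω)) (W ω) i) ∂P)
      atTop (nhds (∫ ω in A, g (fun i => HabitModel.shift (T ω) (W ω) i) ∂P)) := by
    refine tendsto_integral_of_dominated_convergence (fun _ => ‖g‖) (fun m => ?_) (integrable_const _) (fun m => ae_of_all _ fun ω => g.norm_coe_le_norm _) ?_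
    · exact (hg.comp (Meas.shift hS.measW ((dyc_meas m).comp hT))).aestronglyMeasurable
    · filter_upwards [ae_restrict_mem hAm] with ω hω
      refine (g.continuous.tendsto _).comp (tendsto_pi_nhds.2 fun i => ?_)
      have h1 := dyc_tendsto (hT0 ω hω)
      simp only [shift_apply]
      exact (((W ω).continuous.tendsto _).comp (h1.add_const _)).sub (((W ω).continuous.tendsto _).comp h1)
  refine tendsto_nhds_unique key (tendsto_const_nhds.congr fun m => ?_)
  have h3 : Measurable fun ω => HabitModel.shift (dyc m (T ω)) (W ω) :=
    Meas.shift hS.measW ((dyc_meas m).comp hT)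
  rw [← hS.sm_dyadic hT hA m, integral_map h3.aemeasurable hg.aestronglyMeasurable]

lemma Sys.sm_prod (hS : Sys μ P F W) {A : Set Ω} {T : Ω → ℝ} (hT : Measurable T) (hT0 : ∀ ω ∈ A, 0 ≤ T ω) {Y : Type*} [MeasurableSpace Y] {X : Ω → Y} (hX : Measurable X) (hA : ∀ D, MeasurableSet D → ∀ t, 0 ≤ t → MeasurableSet[F t] ((A ∩ X ⁻¹' D) ∩ {ω | T ω ≤ t})) : (P.restrict A).map (fun ω => (X ω, HabitModel.shift (T ω) (W ω))) = ((P.restrict A).map X).prod μ := by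
  have := hS.fin; have := hS.prob
  refine prod_of_markov hX (Meas.shift hS.measW hT) fun D hD => ?_
  rw [Measure.restrict_restrict (hX hD), Set.inter_comm, hS.sm hT (fun ω hω => hT0 ω hω.1) (hA D hD), Measure.restrict_apply (hX hD), Set.inter_comm]

end

section

section levy
variable {P : Measure Ω} [IsProbabilityMeasure P] {F : Filtration ℝ mΩ}

/-- exponential increments -/
def lA (W : ℝ → Ω → ℝ) (a s d : ℝ) (j : ℕ) (ω : Ω) : ℂ :=
  Complex.exp (((a * (W (s + (j + 1) * d) ω - W (s + j * d) ω) : ℝ) : ℂ) * Complex.I + ((a ^ 2 * d / 2 : ℝ) : ℂ))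

def lZ (W : ℝ → Ω → ℝ) (a s d : ℝ) (j : ℕ) (ω : Ω) : ℂ :=
  ∏ i ∈ Finset.range j, lA W a s d i ω

def lP (W : ℝ → Ω → ℝ) (a s d : ℝ) (j : ℕ) (ω : Ω) : ℂ :=
  lZ W a s d j ω * (lA W a s d j ω - 1)

lemma lA_norm (W : ℝ → Ω → ℝ) (a s d : ℝ) (j : ℕ) (ω : Ω) : ‖lA W a s d j ω‖ = rexp (a ^ 2 * d / 2) := by
  unfold lA
  rw [Complex.norm_exp]
  simp only [Complex.add_re, Complex.re_ofReal_mul, Complex.I_re, mul_zero, Complex.ofReal_re, zero_add]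

lemma lZ_norm (W : ℝ → Ω → ℝ) (a s d : ℝ) (j : ℕ) (ω : Ω) : ‖lZ W a s d j ω‖ = rexp (a ^ 2 * d / 2) ^ j := by
  unfold lZ; rw [norm_prod]; simp [lA_norm]

variable {W : ℝ → Ω → ℝ} (hW : IsStdBM P F W) {s d : ℝ} (hs : 0 ≤ s) (hd : 0 ≤ d) (a : ℝ)

lemma lA_meas_of {m : MeasurableSpace Ω} {j : ℕ} (h1 : Measurable[m] (W (s + (j+1) * d))) (h2 : Measurable[m] (W (s + j * d))) : Measurable[m] (lA W a s d j) := by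
  unfold lA
  exact Complex.measurable_exp.comp (((Complex.measurable_ofReal.comp (measurable_const.mul (h1.sub h2))).mul measurable_const).add measurable_const)

include hW hd in
lemma lA_meas {j k : ℕ} (hjk : j < k) : Measurable[F (s + k * d)] (lA W a s d j) := by
  have h1 : (j : ℝ) + 1 ≤ k := by exact_mod_cast hjk
  refine lA_meas_of a ((hW.adapted _).mono (F.mono ?_) le_rfl) ((hW.adapted _).mono (F.mono ?_) le_rfl) <;> nlinarith

include hW hd in
lemma lZ_meas {j k : ℕ} (hjk : j ≤ k) : Measurable[F (s + k * d)] (lZ W a s d j) := by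
  unfold lZ
  exact Finset.measurable_fun_prod _ fun i hi =>
    lA_meas hW hd a (lt_of_lt_of_le (Finset.mem_range.1 hi) hjk)

lemma lA_measW (j : ℕ) : Measurable[⨆ t : ℝ, MeasurableSpace.comap (W t) inferInstance] (lA W a s d j) :=
  lA_meas_of a ((comap_measurable _).mono (le_iSup (fun t => MeasurableSpace.comap (W t) _) _) le_rfl) ((comap_measurable _).mono (le_iSup (fun t => MeasurableSpace.comap (W t) _) _) le_rfl)

lemma lZ_measW (j : ℕ) : Measurable[⨆ t : ℝ, MeasurableSpace.comap (W t) inferInstance] (lZ W a s d j) := by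
  unfold lZ
  exact Finset.measurable_fun_prod _ fun i hi => lA_measW a i

lemma lP_measW (j : ℕ) : Measurable[⨆ t : ℝ, MeasurableSpace.comap (W t) inferInstance] (lP W a s d j) :=
  (lZ_measW a j).mul ((lA_measW a j).sub measurable_const)

include hW in
lemma supW_le : (⨆ t : ℝ, MeasurableSpace.comap (W t) inferInstance) ≤ mΩ :=
  iSup_le fun t => ((hW.adapted t).mono (F.le t) le_rfl).comap_le

lemma intb {f : Ω → ℂ} (hf : Measurable f) {C : ℝ} (hC : ∀ ω, ‖f ω‖ ≤ C) : Integrable f P :=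
  Integrable.of_bound hf.aestronglyMeasurable C (ae_of_all _ hC)

include hW hs hd in
lemma lA_int (j : ℕ) : ∫ ω, lA W a s d j ω ∂P = 1 := by
  have h0 : 0 ≤ s + j * d := by positivity
  have h1 : s + j * d ≤ s + (j + 1) * d := by nlinarith
  have hg := hW.gauss_incr _ _ h0 h1
  have hm : Measurable fun ω => W (s + (j + 1) * d) ω - W (s + j * d) ω :=
    ((hW.adapted _).mono (F.le _) le_rfl).sub ((hW.adapted _).mono (F.le _) le_rfl)
  have hc := charFun_gaussianReal (μ := 0) (v := Real.toNNReal (s + (j + 1) * d - (s + j * d))) a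
  rw [← hg, charFun_apply_real, integral_map hm.aemeasurable (by fun_prop)] at hc
  unfold lA
  simp only [Complex.exp_add]
  rw [integral_mul_const]
  have e : ∀ ω, Complex.exp (((a * (W (s + (j + 1) * d) ω - W (s + j * d) ω) : ℝ) : ℂ) * Complex.I) = Complex.exp (a * ((W (s + (j + 1) * d) ω - W (s + j * d) ω : ℝ) : ℂ) * Complex.I) := by
    intro ω; push_cast; ring_nf
  simp_rw [e]
  rw [hc, ← Complex.exp_add]
  have : (Real.toNNReal (s + (j + 1) * d - (s + j * d)) : ℝ) = d := by
    rw [Real.coe_toNNReal _ (by linarith)]; ring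
  rw [← Complex.exp_zero]; congr 1
  have e2 : ((Real.toNNReal (s + (j + 1) * d - (s + j * d)) : ℝ) : ℂ) = d := by rw [this]
  have e3 : ((Real.toNNReal (s + (j + 1) * d - (s + j * d)) : ℝ≥0) : ℂ) = d := by
    rw [← e2]
  rw [e3]; push_cast; ring_nf

include hW hs hd in
lemma lA_indep (j : ℕ) {X : Ω → ℂ} (hX : Measurable[F (s + j * d)] X) : ∫ ω, X ω * lA W a s d j ω ∂P = ∫ ω, X ω ∂P := by
  have h0 : 0 ≤ s + j * d := by positivity
  have h1 : s + j * d ≤ s + (j + 1) * d := by nlinarith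
  have hi := hW.indep_incr _ _ h0 h1
  have hm : Measurable fun ω => W (s + (j + 1) * d) ω - W (s + j * d) ω :=
    ((hW.adapted _).mono (F.le _) le_rfl).sub ((hW.adapted _).mono (F.le _) le_rfl)
  have hXD : IndepFun (fun ω => W (s + (j + 1) * d) ω - W (s + j * d) ω) X P := by
    rw [IndepFun_iff_Indep]
    exact indep_of_indep_of_le_right hi hX.comap_le
  have hφ : Measurable fun x : ℝ => Complex.exp (((a * x : ℝ) : ℂ) * Complex.I + ((a ^ 2 * d / 2 : ℝ) : ℂ)) := by fun_prop
  have h2 : IndepFun X (lA W a s d j) P := (hXD.comp hφ measurable_id).symm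
  rw [h2.integral_fun_mul_eq_mul_integral (hX.mono (F.le _) le_rfl).aestronglyMeasurable (hφ.comp hm).aestronglyMeasurable, lA_int hW hs hd a j, mul_one]

include hW hs hd in
lemma lA_indep' (j : ℕ) {X : Ω → ℂ} (hX : Measurable[F (s + j * d)] X) {C : ℝ} (hC : ∀ ω, ‖X ω‖ ≤ C) : ∫ ω, X ω * (lA W a s d j ω - 1) ∂P = 0 := by
  have hXm := hX.mono (F.le _) le_rfl
  have hAm := (lA_meas hW hd a (s := s) (Nat.lt_succ_self j)).mono (F.le _) le_rfl
  simp_rw [mul_sub, mul_one]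
  rw [integral_sub _ (intb hXm hC), lA_indep hW hs hd a j hX, sub_self]
  refine intb (hXm.mul hAm) (C := C * rexp (a ^ 2 * d / 2)) fun ω => ?_
  rw [norm_mul, lA_norm]
  exact mul_le_mul_of_nonneg_right (hC ω) (exp_pos _).le

lemma lP_norm (j : ℕ) (ω : Ω) : ‖lP W a s d j ω‖ ≤ rexp (a ^ 2 * d / 2) ^ j * (rexp (a ^ 2 * d / 2) + 1) := by
  unfold lP
  rw [norm_mul, lZ_norm]
  have := norm_sub_le (lA W a s d j ω) 1
  rw [lA_norm, norm_one] at this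
  gcongr

include hW hs hd in
lemma lP_orth {j k : ℕ} (hjk : j < k) : ∫ ω, lP W a s d k ω * (starRingEnd ℂ) (lP W a s d j ω) ∂P = 0 := by
  have hm : Measurable[F (s + k * d)] (lP W a s d j) :=
    (lZ_meas hW hd a hjk.le).mul ((lA_meas hW hd a hjk).sub measurable_const)
  have hX : Measurable[F (s + k * d)] fun ω => lZ W a s d k ω * (starRingEnd ℂ) (lP W a s d j ω) :=
    (lZ_meas hW hd a le_rfl).mul ((Complex.continuous_conj.measurable).comp hm)
  rw [← lA_indep' hW hs hd a k hX (C := rexp (a ^ 2 * d / 2) ^ k * (rexp (a ^ 2 * d / 2) ^ j * (rexp (a ^ 2 * d / 2) + 1)))]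
  · congr 1; ext ω; rw [lP]; ring
  · intro ω
    rw [norm_mul, lZ_norm, RCLike.norm_conj]
    exact mul_le_mul_of_nonneg_left (lP_norm a j ω) (by positivity)

include hW hs hd in
lemma lP_diag (j : ℕ) : ∫ ω, lP W a s d j ω * (starRingEnd ℂ) (lP W a s d j ω) ∂P = ((rexp (a ^ 2 * d) ^ j * (rexp (a ^ 2 * d) - 1) : ℝ) : ℂ) := by
  have hAm := (lA_meas hW hd a (s := s) (Nat.lt_succ_self j)).mono (F.le _) le_rfl
  have hAi : Integrable (lA W a s d j) P := intb hAm fun ω => (lA_norm W a s d j ω).le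
  have hAc : Integrable (fun ω => (starRingEnd ℂ) (lA W a s d j ω)) P :=
    intb ((Complex.continuous_conj.measurable).comp hAm) (C := rexp (a ^ 2 * d / 2)) fun ω => by rw [RCLike.norm_conj]; exact (lA_norm W a s d j ω).le
  have hn : ∀ z : ℂ, z * (starRingEnd ℂ) z = ((‖z‖ ^ 2 : ℝ) : ℂ) := fun z => by
    rw [Complex.mul_conj']; push_cast; rfl
  have e : ∀ ω, lP W a s d j ω * (starRingEnd ℂ) (lP W a s d j ω) = ((rexp (a ^ 2 * d) ^ j : ℝ) : ℂ) * (((rexp (a ^ 2 * d) : ℝ) : ℂ) + 1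
        - lA W a s d j ω - (starRingEnd ℂ) (lA W a s d j ω)) := by
    intro ω
    have h1 := hn (lZ W a s d j ω)
    have h2 := hn (lA W a s d j ω)
    rw [lZ_norm, ← pow_mul, mul_comm j 2, pow_mul, ← exp_nat_mul, show ((2 : ℕ) : ℝ) * (a ^ 2 * d / 2) = a ^ 2 * d by push_cast; ring] at h1
    rw [lA_norm, ← exp_nat_mul, show ((2 : ℕ) : ℝ) * (a ^ 2 * d / 2) = a ^ 2 * d by push_cast; ring] at h2
    rw [← h1, ← h2, lP]
    simp only [map_mul, map_sub, map_one]; ring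
  simp_rw [e]
  rw [integral_const_mul, integral_sub (f := fun ω => ((rexp (a ^ 2 * d) : ℝ) : ℂ) + 1 - lA W a s d j ω) ((integrable_const _).sub hAi) hAc, integral_sub (integrable_const _) hAi, lA_int hW hs hd a j, integral_conj, lA_int hW hs hd a j]
  simp

lemma lZ_eq (W : ℝ → Ω → ℝ) (a s d : ℝ) (j : ℕ) (ω : Ω) : lZ W a s d j ω = Complex.exp (((a * (W (s + j * d) ω - W s ω) : ℝ) : ℂ) * Complex.I + ((a ^ 2 * (j * d) / 2 : ℝ) : ℂ)) := by
  induction j with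
  | zero => simp [lZ]
  | succ j ih =>
    have : lZ W a s d (j + 1) ω = lZ W a s d j ω * lA W a s d j ω := by
      unfold lZ; rw [Finset.prod_range_succ]
    rw [this, ih, lA, ← Complex.exp_add]; congr 1; push_cast; ring

lemma exp_sub_one_le' {x : ℝ} : rexp x - 1 ≤ x * rexp x := by
  have := Real.add_one_le_exp (-x)
  have h := exp_pos x
  have h2 : rexp (-x) * rexp x = 1 := by rw [← exp_add]; simp
  nlinarith

lemma levy_bound {W1 W2 : ℝ → Ω → ℝ} (h1 : IsStdBM P F W1) (h2 : IsStdBM P F W2) (hi : Indep (⨆ t : ℝ, MeasurableSpace.comap (W1 t) inferInstance) (⨆ t : ℝ, MeasurableSpace.comap (W2 t) inferInstance) P) {s d : ℝ} (hs : 0 ≤ s) (hd : 0 ≤ d) (a b : ℝ) {ξ : Ω → ℂ} (hξ : Measurable[F s] ξ) {C : ℝ} (hC : ∀ ω, ‖ξ ω‖ ≤ C) (n : ℕ) {ε : ℝ} (hε : 0 < ε) : ‖∫ ω, ξ ω * (lZ W1 a s d n ω * lZ W2 b s d n ω) ∂P - ∫ ω, ξ ω ∂P‖ ≤ C * (ε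 / 2 + (∑ j ∈ Finset.range n, (rexp (a ^ 2 * d) ^ j * (rexp (a ^ 2 * d) - 1)) * (rexp (b ^ 2 * d) ^ j * (rexp (b ^ 2 * d) - 1))) / (2 * ε)) := by
  have mξ := hξ.mono (F.le _) le_rfl
  have hZF1 := fun j => lZ_meas h1 hd a (s := s) (le_refl j)
  have hZF2 := fun j => lZ_meas h2 hd b (s := s) (le_refl j)
  have mZ1 := fun j => (hZF1 j).mono (F.le _) le_rfl
  have mZ2 := fun j => (hZF2 j).mono (F.le _) le_rfl
  have mP1 := fun j => (lP_measW a (W := W1) (s := s) (d := d) j).mono (supW_le h1) le_rfl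
  have mP2 := fun j => (lP_measW b (W := W2) (s := s) (d := d) j).mono (supW_le h2) le_rfl
  have mA1 := fun j => (lA_measW a (W := W1) (s := s) (d := d) j).mono (supW_le h1) le_rfl
  have mA2 := fun j => (lA_measW b (W := W2) (s := s) (d := d) j).mono (supW_le h2) le_rfl
  have hmul : ∀ {f g : Ω → ℂ} {c c' : ℝ}, (∀ ω, ‖f ω‖ ≤ c) → (∀ ω, ‖g ω‖ ≤ c') → ∀ ω, ‖f ω * g ω‖ ≤ c * c' := by
    intro f g c c' hf hg ω
    rw [norm_mul]; exact mul_le_mul (hf ω) (hg ω) (norm_nonneg _) ((norm_nonneg _).trans (hf ω))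
  have bZ1 := fun j ω => (lZ_norm W1 a s d j ω).le
  have bZ2 := fun j ω => (lZ_norm W2 b s d j ω).le
  have bP1 := fun j ω => lP_norm (W := W1) (s := s) (d := d) a j ω
  have bP2 := fun j ω => lP_norm (W := W2) (s := s) (d := d) b j ω
  have iPQ : ∀ j, Integrable (fun ω => ξ ω * (lP W1 a s d j ω * lP W2 b s d j ω)) P := fun j =>
    intb (mξ.mul ((mP1 j).mul (mP2 j))) (hmul hC (hmul (bP1 j) (bP2 j)))
  have c1 : ∀ m, ∫ ω, ξ ω * (lZ W1 a s d m ω * lZ W2 b s d m ω) ∂P = ∫ ω, ξ ω ∂P + ∑ j ∈ Finset.range m, ∫ ω, ξ ω * (lP W1 a s d j ω * lP W2 b s d j ω) ∂P := by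
    intro m
    induction m with
    | zero => simp [lZ]
    | succ m ih =>
      rw [Finset.sum_range_succ, ← add_assoc, ← ih]
      have hY : Measurable[F (s + m * d)] fun ω => ξ ω * (lZ W1 a s d m ω * lZ W2 b s d m ω) :=
        (hξ.mono (F.mono (by nlinarith [Nat.cast_nonneg (α := ℝ) m])) le_rfl).mul ((hZF1 m).mul (hZF2 m))
      have bY := hmul hC (hmul (bZ1 m) (bZ2 m))
      have mY := hY.mono (F.le _) le_rfl
      have z1 := lA_indep' h1 hs hd a m hY bY
      have z2 := lA_indep' h2 hs hd b m hY bY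
      have bA1 : ∀ ω, ‖lA W1 a s d m ω - 1‖ ≤ rexp (a ^ 2 * d / 2) + 1 := fun ω => by
        have := norm_sub_le (lA W1 a s d m ω) 1
        rwa [lA_norm, norm_one] at this
      have bA2 : ∀ ω, ‖lA W2 b s d m ω - 1‖ ≤ rexp (b ^ 2 * d / 2) + 1 := fun ω => by
        have := norm_sub_le (lA W2 b s d m ω) 1
        rwa [lA_norm, norm_one] at this
      have i0 := intb (P := P) mY bY
      have i1 : Integrable (fun ω => ξ ω * (lZ W1 a s d m ω * lZ W2 b s d m ω) * (lA W1 a s d m ω - 1)) P :=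
        intb (P := P) (mY.mul ((mA1 m).sub measurable_const)) (hmul bY bA1)
      have i2 : Integrable (fun ω => ξ ω * (lZ W1 a s d m ω * lZ W2 b s d m ω) * (lA W2 b s d m ω - 1)) P :=
        intb (P := P) (mY.mul ((mA2 m).sub measurable_const)) (hmul bY bA2)
      have e : ∀ ω, ξ ω * (lZ W1 a s d (m+1) ω * lZ W2 b s d (m+1) ω) = (ξ ω * (lZ W1 a s d m ω * lZ W2 b s d m ω) + ξ ω * (lP W1 a s d m ω * lP W2 b s d m ω)) + (ξ ω * (lZ W1 a s d m ω * lZ W2 b s d m ω) * (lA W1 a s d m ω - 1) + ξ ω * (lZ W1 a s d m ω * lZ W2 b s d m ω) * (lA W2 b s d m ω - 1)) := by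
        intro ω
        have s1 : lZ W1 a s d (m + 1) ω = lZ W1 a s d m ω * lA W1 a s d m ω := by
          unfold lZ; rw [Finset.prod_range_succ]
        have s2 : lZ W2 b s d (m + 1) ω = lZ W2 b s d m ω * lA W2 b s d m ω := by
          unfold lZ; rw [Finset.prod_range_succ]
        rw [s1, s2, lP, lP]; ring
      simp_rw [e]
      have g1 := integral_add (i0.add (iPQ m)) (i1.add i2)
      have g2 := integral_add i0 (iPQ m)
      have g3 := integral_add i1 i2
      simp only [Pi.add_apply] at g1
      rw [z1, z2, add_zero] at g3
      rw [g3, g2, add_zero] at g1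
      exact g1
  set M : Ω → ℂ := fun ω => ∑ j ∈ Finset.range n, lP W1 a s d j ω * lP W2 b s d j ω with hM
  have mM : Measurable M := Finset.measurable_fun_sum _ fun j _ => (mP1 j).mul (mP2 j)
  obtain ⟨CM, bM⟩ : ∃ CM, ∀ ω, ‖M ω‖ ≤ CM := ⟨_, fun ω =>
    (norm_sum_le _ _).trans (Finset.sum_le_sum fun j _ => hmul (bP1 j) (bP2 j) ω)⟩
  have c2 : ∫ ω, ξ ω * (lZ W1 a s d n ω * lZ W2 b s d n ω) ∂P - ∫ ω, ξ ω ∂P = ∫ ω, ξ ω * M ω ∂P := by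
    rw [c1 n, add_sub_cancel_left, ← integral_finset_sum _ fun j _ => iPQ j]
    simp only [hM, Finset.mul_sum]
  have icr : ∀ j k, Integrable (fun ω => (lP W1 a s d k ω * lP W2 b s d k ω) * (starRingEnd ℂ) (lP W1 a s d j ω * lP W2 b s d j ω)) P := fun j k =>
    intb (((mP1 k).mul (mP2 k)).mul ((Complex.continuous_conj.measurable).comp ((mP1 j).mul (mP2 j)))) (hmul (hmul (bP1 k) (bP2 k)) (fun ω => by
        rw [RCLike.norm_conj]; exact hmul (bP1 j) (bP2 j) ω))
  have cross : ∀ j k, ∫ ω, (lP W1 a s d k ω * lP W2 b s d k ω) * (starRingEnd ℂ) (lP W1 a s d j ω * lP W2 b s d j ω) ∂P = (∫ ω, lP W1 a s d k ω * (starRingEnd ℂ) (lP W1 a s d j ω) ∂P) * (∫ ω, lP W2 b s d k ω * (starRingEnd ℂ) (lP W2 b s d j ω) ∂P) := by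
    intro j k
    have m1 : Measurable[⨆ t : ℝ, MeasurableSpace.comap (W1 t) inferInstance] fun ω => lP W1 a s d k ω * (starRingEnd ℂ) (lP W1 a s d j ω) :=
      (lP_measW a k).mul ((Complex.continuous_conj.measurable).comp (lP_measW a j))
    have m2 : Measurable[⨆ t : ℝ, MeasurableSpace.comap (W2 t) inferInstance] fun ω => lP W2 b s d k ω * (starRingEnd ℂ) (lP W2 b s d j ω) :=
      (lP_measW b k).mul ((Complex.continuous_conj.measurable).comp (lP_measW b j))
    have hI : IndepFun (fun ω => lP W1 a s d k ω * (starRingEnd ℂ) (lP W1 a s d j ω)) (fun ω => lP W2 b s d k ω * (starRingEnd ℂ) (lP W2 b s d j ω)) P := by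
      rw [IndepFun_iff_Indep]
      exact indep_of_indep_of_le_left (indep_of_indep_of_le_right hi m2.comap_le) m1.comap_le
    rw [← hI.integral_fun_mul_eq_mul_integral (m1.mono (supW_le h1) le_rfl).aestronglyMeasurable (m2.mono (supW_le h2) le_rfl).aestronglyMeasurable]
    congr 1; ext ω; simp only [map_mul]; ring
  have czero : ∀ j k, j ≠ k → ∫ ω, (lP W1 a s d k ω * lP W2 b s d k ω) * (starRingEnd ℂ) (lP W1 a s d j ω * lP W2 b s d j ω) ∂P = 0 := by
    intro j k hjk
    rw [cross]
    rcases lt_or_gt_of_ne hjk with h | h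
    · rw [lP_orth h1 hs hd a h, zero_mul]
    · have := lP_orth h1 hs hd a h
      have h' : ∫ ω, lP W1 a s d k ω * (starRingEnd ℂ) (lP W1 a s d j ω) ∂P = 0 := by
        rw [← map_zero (starRingEnd ℂ), ← this, ← integral_conj]
        congr 1; ext ω; simp [mul_comm]
      rw [h', zero_mul]
  have c3 : ∫ ω, M ω * (starRingEnd ℂ) (M ω) ∂P = ((∑ j ∈ Finset.range n, (rexp (a ^ 2 * d) ^ j * (rexp (a ^ 2 * d) - 1)) * (rexp (b ^ 2 * d) ^ j * (rexp (b ^ 2 * d) - 1)) : ℝ) : ℂ) := by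
    simp only [hM, map_sum, Finset.sum_mul_sum]
    rw [integral_finset_sum _ fun k _ => integrable_finset_sum _ fun j _ => icr j k]
    push_cast
    refine Finset.sum_congr rfl fun k hk => ?_
    rw [integral_finset_sum _ fun j _ => icr j k, Finset.sum_eq_single k (fun j _ hj => czero j k hj) (fun h => absurd hk h), cross, lP_diag h1 hs hd a, lP_diag h2 hs hd b]
    push_cast; ring
  have c4 : ∫ ω, ‖M ω‖ ^ 2 ∂P = ∑ j ∈ Finset.range n, (rexp (a ^ 2 * d) ^ j * (rexp (a ^ 2 * d) - 1)) * (rexp (b ^ 2 * d) ^ j * (rexp (b ^ 2 * d) - 1)) := by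
    have e : ∀ ω, M ω * (starRingEnd ℂ) (M ω) = ((‖M ω‖ ^ 2 : ℝ) : ℂ) := fun ω => by
      rw [Complex.mul_conj']; push_cast; rfl
    simp_rw [e] at c3
    rw [integral_complex_ofReal] at c3
    exact_mod_cast c3
  have hC0 : 0 ≤ C := by
    have : Nonempty Ω := nonempty_of_isProbabilityMeasure P
    exact (norm_nonneg _).trans (hC (Classical.arbitrary Ω))
  have iM : Integrable (fun ω => ‖M ω‖) P := (intb mM bM).norm
  have iM2 : Integrable (fun ω => ‖M ω‖ ^ 2) P := by
    refine Integrable.of_bound (mM.norm.pow_const 2).aestronglyMeasurable (CM ^ 2) (ae_of_all _ fun ω => ?_)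
    rw [norm_pow, norm_norm]; exact pow_le_pow_left₀ (norm_nonneg _) (bM ω) 2
  rw [c2, ← c4]
  calc ‖∫ ω, ξ ω * M ω ∂P‖ ≤ ∫ ω, C * (ε / 2 + ‖M ω‖ ^ 2 / (2 * ε)) ∂P := by
        refine norm_integral_le_of_norm_le (((integrable_const _).add (iM2.div_const _)).const_mul C) (ae_of_all _ fun ω => ?_)
        rw [norm_mul]
        refine mul_le_mul (hC ω) ?_ (norm_nonneg _) hC0
        have : ε / 2 + ‖M ω‖ ^ 2 / (2 * ε) - ‖M ω‖ = (‖M ω‖ - ε) ^ 2 / (2 * ε) := by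
          field_simp; ring
        have h3 : 0 ≤ (‖M ω‖ - ε) ^ 2 / (2 * ε) := by positivity
        linarith
    _ = _ := by
        rw [integral_const_mul, integral_add (integrable_const _) (iM2.div_const _), integral_div (2 * ε)]; simp

lemma levy_char {W1 W2 : ℝ → Ω → ℝ} (h1 : IsStdBM P F W1) (h2 : IsStdBM P F W2) (hi : Indep (⨆ t : ℝ, MeasurableSpace.comap (W1 t) inferInstance) (⨆ t : ℝ, MeasurableSpace.comap (W2 t) inferInstance) P) {s t : ℝ} (hs : 0 ≤ s) (hst : s ≤ t) (a b : ℝ) {ξ : Ω → ℂ} (hξ : Measurable[F s] ξ) {C : ℝ} (hC : ∀ ω, ‖ξ ω‖ ≤ C) : ∫ ω, ξ ω * (lZ W1 a s (t - s) 1 ω * lZ W2 b s (t - s) 1 ω) ∂P = ∫ ω, ξ ω ∂P := by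
  have hC0 : 0 ≤ C := by
    have : Nonempty Ω := nonempty_of_isProbabilityMeasure P
    exact (norm_nonneg _).trans (hC (Classical.arbitrary Ω))
  set D := t - s with hD
  have hD0 : 0 ≤ D := by linarith
  set A := a ^ 2 * D * rexp (a ^ 2 * D) * rexp (a ^ 2 * D) with hA
  set B := b ^ 2 * D * rexp (b ^ 2 * D) * rexp (b ^ 2 * D) with hB
  have hA0 : 0 ≤ A := by positivity
  have hB0 : 0 ≤ B := by positivity
  have key : ∀ n : ℕ, 0 < n → ∀ ε : ℝ, 0 < ε → ‖∫ ω, ξ ω * (lZ W1 a s D 1 ω * lZ W2 b s D 1 ω) ∂P - ∫ ω, ξ ω ∂P‖ ≤ C * (ε / 2 + (A * B / n) / (2 * ε)) := by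
    intro n hn ε hε
    have hn' : (0:ℝ) < n := by exact_mod_cast hn
    have hn1 : (1:ℝ) ≤ n := by exact_mod_cast hn
    have := levy_bound h1 h2 hi hs (d := D / n) (by positivity) a b hξ hC n hε
    have e : ∀ (W : ℝ → Ω → ℝ) (a : ℝ) ω, lZ W a s (D / n) n ω = lZ W a s D 1 ω := by
      intro W a ω
      rw [lZ_eq, lZ_eq, mul_div_cancel₀ _ hn'.ne']; simp
    simp_rw [e] at this
    refine this.trans ?_
    have aux : ∀ c : ℝ, ∀ j ∈ Finset.range n, rexp (c ^ 2 * (D / n)) ^ j * (rexp (c ^ 2 * (D / n)) - 1) ≤ (c ^ 2 * D * rexp (c ^ 2 * D) * rexp (c ^ 2 * D)) / n := by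
      intro c j hj
      have hjn : (j:ℝ) ≤ n := by exact_mod_cast (Finset.mem_range.1 hj).le
      have q1 : rexp (c ^ 2 * (D / n)) ^ j ≤ rexp (c ^ 2 * D) := by
        rw [← exp_nat_mul]; apply exp_le_exp.2
        have : (j:ℝ) * (c ^ 2 * (D / n)) = (c ^ 2 * D) * (j / n) := by field_simp
        rw [this]
        exact mul_le_of_le_one_right (by positivity) ((div_le_one hn').2 hjn)
      have q3 : D / n ≤ D := div_le_self hD0 hn1
      have q2 : rexp (c ^ 2 * (D / n)) - 1 ≤ c ^ 2 * (D / n) * rexp (c ^ 2 * D) :=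
        exp_sub_one_le'.trans (by gcongr)
      have q4 : 0 ≤ rexp (c ^ 2 * (D / n)) - 1 := by
        have := Real.add_one_le_exp (c ^ 2 * (D / n))
        have : 0 ≤ c ^ 2 * (D / n) := by positivity
        linarith
      calc _ ≤ rexp (c ^ 2 * D) * (c ^ 2 * (D / n) * rexp (c ^ 2 * D)) :=
            mul_le_mul q1 q2 q4 (exp_pos _).le
        _ = _ := by ring
    have nn : ∀ c : ℝ, 0 ≤ rexp (c ^ 2 * (D / n)) - 1 := fun c => by
        have := Real.add_one_le_exp (c ^ 2 * (D / n))
        have : 0 ≤ c ^ 2 * (D / n) := by positivity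
        linarith
    have hsum : (∑ j ∈ Finset.range n, (rexp (a ^ 2 * (D / n)) ^ j * (rexp (a ^ 2 * (D / n)) - 1)) * (rexp (b ^ 2 * (D / n)) ^ j * (rexp (b ^ 2 * (D / n)) - 1))) ≤ A * B / n := by
      calc _ ≤ ∑ j ∈ Finset.range n, (A / n) * (B / n) := by
            refine Finset.sum_le_sum fun j hj => mul_le_mul (aux a j hj) (aux b j hj) (mul_nonneg (by positivity) (nn b)) (by positivity)
        _ = _ := by
            rw [Finset.sum_const, Finset.card_range, nsmul_eq_mul]; field_simp
    gcongr
  rw [← sub_eq_zero, ← norm_le_zero_iff]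
  refine le_of_forall_pos_le_add fun ε hε => ?_
  set ε' := ε / (C + 1) with hε'
  have hε'0 : 0 < ε' := by positivity
  obtain ⟨n, hn⟩ := exists_nat_gt (A * B / ε' ^ 2)
  have hn0 : (0:ℝ) < n := lt_of_le_of_lt (by positivity) hn
  have := key n (by exact_mod_cast hn0) ε' hε'0
  have h4 : (A * B / n) / (2 * ε') ≤ ε' / 2 := by
    rw [div_lt_iff₀ (by positivity)] at hn
    rw [div_div, div_le_iff₀ (by positivity)]; nlinarith
  have h5 : C * ε' ≤ ε := by
    rw [hε', mul_div_assoc', div_le_iff₀ (by positivity)]; nlinarith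
  nlinarith [mul_le_mul_of_nonneg_left h4 hC0]
end levy

end

section

section setsys
variable {P : Measure Ω} [IsProbabilityMeasure P] {F : Filtration ℝ mΩ} {W1 W2 : ℝ → Ω → ℝ}

def g2 (d : ℝ) : Measure (ℝ × ℝ) := (gaussianReal 0 d.toNNReal).prod (gaussianReal 0 d.toNNReal)

instance (d : ℝ) : IsProbabilityMeasure (g2 d) := by unfold g2; infer_instance

lemma levy_J (h1 : IsStdBM P F W1) (h2 : IsStdBM P F W2) (hi : Indep (⨆ t : ℝ, MeasurableSpace.comap (W1 t) inferInstance) (⨆ t : ℝ, MeasurableSpace.comap (W2 t) inferInstance) P) {s t : ℝ} (hs : 0 ≤ s) (hst : s ≤ t) {A : Set Ω} (hA : MeasurableSet[F s] A) : (P.restrict A).map (fun ω => (W1 t ω - W1 s ω, W2 t ω - W2 s ω)) = P A • g2 (t - s) := by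
  have hAm := F.le _ _ hA
  have m1 : ∀ t, Measurable (W1 t) := fun t => (h1.adapted t).mono (F.le _) le_rfl
  have m2 : ∀ t, Measurable (W2 t) := fun t => (h2.adapted t).mono (F.le _) le_rfl
  have hm : Measurable (fun ω => (W1 t ω - W1 s ω, W2 t ω - W2 s ω)) :=
    ((m1 t).sub (m1 s)).prodMk ((m2 t).sub (m2 s))
  have : IsFiniteMeasure (P A • g2 (t - s)) := by refine ⟨?_⟩; simp
  refine Measure.ext_of_charFunDual ?_
  ext L
  rw [charFunDual_apply, charFunDual_apply, integral_map hm.aemeasurable (by fun_prop), integral_smul_measure]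
  set a := L (1, 0) with ha
  set b := L (0, 1) with hb
  have hL : ∀ x y : ℝ, L (x, y) = a * x + b * y := by
    intro x y
    have : ((x, y) : ℝ × ℝ) = x • (1, 0) + y • (0, 1) := by simp
    rw [this, map_add, map_smul, map_smul]; simp [← ha, ← hb, mul_comm]
  have hd : (0:ℝ) ≤ t - s := by linarith
  have hg : ∀ c : ℝ, ∫ x, Complex.exp (((c * x : ℝ) : ℂ) * Complex.I) ∂(gaussianReal 0 (t - s).toNNReal) = Complex.exp (-((c ^ 2 * (t - s) / 2 : ℝ) : ℂ)) := by
    intro c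
    have := charFun_gaussianReal (μ := 0) (v := (t - s).toNNReal) c
    rw [charFun_apply_real] at this
    simp only [Complex.ofReal_mul]
    rw [this]; congr 1
    have e3 : (((t - s).toNNReal : ℝ≥0) : ℂ) = ((t - s : ℝ) : ℂ) := by
      rw [← Real.coe_toNNReal _ hd]; simp
    rw [e3]; push_cast; ring
  have r2 : ∫ x, Complex.exp (((L x : ℝ) : ℂ) * Complex.I) ∂(g2 (t - s)) = Complex.exp (-((a ^ 2 * (t - s) / 2 : ℝ) : ℂ)) * Complex.exp (-((b ^ 2 * (t - s) / 2 : ℝ) : ℂ)) := by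
    rw [← hg a, ← hg b, ← integral_prod_mul, g2]
    congr 1; ext x
    obtain ⟨x, y⟩ := x
    rw [hL, ← Complex.exp_add]; congr 1; push_cast; ring
  rw [r2]
  have hξ : Measurable[F s] (A.indicator (fun _ => (1:ℂ))) := measurable_const.indicator hA
  have key := levy_char h1 h2 hi hs hst a b hξ (C := 1) (fun ω => by
    by_cases h : ω ∈ A <;> simp [h])
  have e : ∀ ω, A.indicator (fun _ => (1:ℂ)) ω * (lZ W1 a s (t - s) 1 ω * lZ W2 b s (t - s) 1 ω) = A.indicator (fun ω => Complex.exp (((L (W1 t ω - W1 s ω, W2 t ω - W2 s ω) : ℝ) : ℂ) * Complex.I) * (Complex.exp (((a ^ 2 * (t - s) / 2 : ℝ) : ℂ)) * Complex.exp (((b ^ 2 * (t - s) / 2 : ℝ) : ℂ)))) ω := by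
    intro ω
    by_cases h : ω ∈ A
    · simp only [h, indicator_of_mem, one_mul]
      rw [lZ_eq, lZ_eq, hL, ← Complex.exp_add, ← Complex.exp_add, ← Complex.exp_add]
      congr 1
      simp only [Nat.cast_one, one_mul, show s + (t - s) = t by ring]
      push_cast; ring
    · simp [h]
  simp_rw [e] at key
  rw [integral_indicator hAm, integral_indicator hAm, integral_mul_const] at key
  rw [← mul_right_inj' (a := Complex.exp (((a ^ 2 * (t - s) / 2 : ℝ) : ℂ)) * Complex.exp (((b ^ 2 * (t - s) / 2 : ℝ) : ℂ))) (mul_ne_zero (Complex.exp_ne_zero _) (Complex.exp_ne_zero _)), mul_comm, key]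
  rw [mul_smul_comm, ← Complex.exp_add, ← Complex.exp_add, ← Complex.exp_add]
  rw [show ((a ^ 2 * (t - s) / 2 : ℝ) : ℂ) + ((b ^ 2 * (t - s) / 2 : ℝ) : ℂ) + (-((a ^ 2 * (t - s) / 2 : ℝ) : ℂ) + -((b ^ 2 * (t - s) / 2 : ℝ) : ℂ)) = 0 by ring]
  simp [Measure.real]

def ext1 (n : ℕ) (q : (ℕ → ℝ × ℝ) × (ℝ × ℝ)) : ℕ → ℝ × ℝ :=
  fun j => if j ≤ n then q.1 j else q.1 n + q.2

lemma ext1_meas (n : ℕ) : Measurable (ext1 n) := by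
  refine measurable_pi_iff.2 fun j => ?_
  unfold ext1; split_ifs <;> fun_prop

def nuf (r : ℕ → ℝ) : ℕ → Measure (ℕ → ℝ × ℝ)
  | 0 => Measure.dirac 0
  | n + 1 => ((nuf r n).prod (g2 (r (n + 1) - r n))).map (ext1 n)

lemma nuf_prob (r : ℕ → ℝ) (n : ℕ) : IsProbabilityMeasure (nuf r n) := by
  induction n with
  | zero => unfold nuf; infer_instance
  | succ n ih => unfold nuf; exact Measure.isProbabilityMeasure_map (ext1_meas n).aemeasurable

lemma nuf_law (h1 : IsStdBM P F W1) (h2 : IsStdBM P F W2) (hi : Indep (⨆ t : ℝ, MeasurableSpace.comap (W1 t) inferInstance) (⨆ t : ℝ, MeasurableSpace.comap (W2 t) inferInstance) P) {s : ℝ} (hs : 0 ≤ s) {A : Set Ω} (hA : MeasurableSet[F s] A) {r : ℕ → ℝ} (hr : Monotone r) (hr0 : r 0 = 0) (n : ℕ) : (P.restrict A).map (fun ω (j : ℕ) => (W1 (s + r (min j n)) ω - W1 s ω, W2 (s + r (min j n)) ω - W2 s ω)) = P A • nuf r n := by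
  have hrn : ∀ n, 0 ≤ r n := fun n => hr0 ▸ hr (Nat.zero_le n)
  have mF : ∀ n, Measurable[F (s + r n)] (fun ω (j : ℕ) => (W1 (s + r (min j n)) ω - W1 s ω, W2 (s + r (min j n)) ω - W2 s ω)) := by
    intro n
    refine @measurable_pi_lambda _ _ _ (F (s + r n)) _ _ fun j => ?_
    have q := hr (min_le_right j n)
    have q1 := F.mono (show s + r (min j n) ≤ s + r n by linarith)
    have q2 := F.mono (show s ≤ s + r n by linarith [hrn n])
    exact (((h1.adapted _).mono q1 le_rfl).sub ((h1.adapted _).mono q2 le_rfl)).prodMk (((h2.adapted _).mono q1 le_rfl).sub ((h2.adapted _).mono q2 le_rfl))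
  induction n with
  | zero =>
    simp only [Nat.min_zero, hr0, add_zero, sub_self, nuf]
    rw [show (fun (_:Ω) (_:ℕ) => ((0:ℝ),(0:ℝ))) = fun _ => (0 : ℕ → ℝ × ℝ) from rfl, Measure.map_const]
    simp
  | succ n ih =>
    have hm : Measurable (fun ω => (W1 (s + r (n+1)) ω - W1 (s + r n) ω, W2 (s + r (n+1)) ω - W2 (s + r n) ω)) := by
      have m1 : ∀ t, Measurable (W1 t) := fun t => (h1.adapted t).mono (F.le _) le_rfl
      have m2 : ∀ t, Measurable (W2 t) := fun t => (h2.adapted t).mono (F.le _) le_rfl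
      exact ((m1 _).sub (m1 _)).prodMk ((m2 _).sub (m2 _))
    have mX := (mF n).mono (F.le _) le_rfl
    have := prod_of_markov (P := P.restrict A) (μ := g2 (r (n+1) - r n)) mX hm (fun D hD => by
      rw [Measure.restrict_restrict (mX hD), Measure.restrict_apply (mX hD)]
      rw [levy_J h1 h2 hi (s := s + r n) (t := s + r (n+1)) (by linarith [hrn n]) (by linarith [hr (Nat.le_succ n)]) ((mF n hD).inter (F.mono (by linarith [hrn n]) _ hA))]
      congr 2; ring)
    have hp := nuf_prob r n
    rw [ih, Measure.prod_smul_left] at this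
    rw [nuf, ← Measure.map_smul, ← this, Measure.map_map (ext1_meas n) (mX.prodMk hm)]
    congr 1
    funext ω j
    simp only [Function.comp, ext1]
    split_ifs with h
    · rw [min_eq_left h, min_eq_left (h.trans (Nat.le_succ n))]
    · rw [min_eq_right (by omega)]; simp

lemma exists_grid (I : Finset ℝ) : ∃ (r : ℕ → ℝ) (n : ℕ), Monotone r ∧ r 0 = 0 ∧ ∀ i ∈ I, ∃ j ≤ n, r j = max i 0 := by
  classical
  set I' := insert 0 (I.image fun i => max i 0) with hI
  have hpos : 0 < I'.card := Finset.card_pos.2 ⟨0, by simp [hI]⟩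
  obtain ⟨N, hN⟩ : ∃ N, I'.card = N + 1 := ⟨I'.card - 1, by omega⟩
  set e := I'.orderEmbOfFin hN with he
  refine ⟨fun j => e ⟨min j N, by omega⟩, N, ?_, ?_, ?_⟩
  · intro i j hij
    apply e.monotone
    simp only [Fin.mk_le_mk]; omega
  · have h0 : (0:ℝ) ∈ I' := by simp [hI]
    obtain ⟨k, hk⟩ : (0:ℝ) ∈ Set.range e := by rw [he, Finset.range_orderEmbOfFin]; exact h0
    apply le_antisymm
    · rw [← hk]; apply e.monotone; simp [Fin.le_def]
    · have : e ⟨min 0 N, by omega⟩ ∈ I' := Finset.orderEmbOfFin_mem _ _ _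
      rw [hI, Finset.mem_insert, Finset.mem_image] at this
      rcases this with h | ⟨i, _, h⟩
      · exact h.ge
      · exact (le_max_right i 0).trans h.le
  · intro i hi
    obtain ⟨k, hk⟩ : max i 0 ∈ Set.range e := by
      rw [he, Finset.range_orderEmbOfFin, hI]
      exact Finset.mem_coe.2 (Finset.mem_insert_of_mem (Finset.mem_image_of_mem _ hi))
    have hk2 := k.2
    refine ⟨(k : ℕ), by omega, ?_⟩
    rw [← hk]; exact congrArg e (Fin.ext (a := ⟨min (k:ℕ) N, by omega⟩) (b := k) (min_eq_left (Nat.lt_succ_iff.1 hk2)))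

def Wpath (h1 : IsStdBM P F W1) (h2 : IsStdBM P F W2) (ω : Ω) : Path :=
  ⟨fun t => (W1 (max t 0) ω, W2 (max t 0) ω), ((h1.cont ω).comp (g := fun t => W1 t ω) (by fun_prop : Continuous fun t : ℝ => max t 0)).prodMk ((h2.cont ω).comp (g := fun t => W2 t ω) (by fun_prop : Continuous fun t : ℝ => max t 0))⟩

lemma Wpath_sys (h1 : IsStdBM P F W1) (h2 : IsStdBM P F W2) (hi : Indep (⨆ t : ℝ, MeasurableSpace.comap (W1 t) inferInstance) (⨆ t : ℝ, MeasurableSpace.comap (W2 t) inferInstance) P) : Sys (P.map (Wpath h1 h2)) P F (Wpath h1 h2) := by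
  have mW : Measurable (Wpath h1 h2) := by
    rw [measurable_path_iff]; intro t
    exact ((h1.adapted _).mono (F.le _) le_rfl).prodMk ((h2.adapted _).mono (F.le _) le_rfl)
  have hpr : IsProbabilityMeasure (P.map (Wpath h1 h2)) :=
    Measure.isProbabilityMeasure_map mW.aemeasurable
  have key : ∀ I : Finset ℝ, ∃ ν : Measure (I → ℝ × ℝ), ∀ s, 0 ≤ s → ∀ A, MeasurableSet[F s] A → ((P.restrict A).map (fun ω => shift s (Wpath h1 h2 ω))).map (fun w (i : I) => w i) = P A • ν := by
    intro I
    obtain ⟨r, n, hr, hr0, hj⟩ := exists_grid I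
    choose j hjn hjr using hj
    have mj : Measurable (fun (x : ℕ → ℝ × ℝ) (i : I) => x (j i i.2)) :=
      measurable_pi_iff.2 fun i => measurable_pi_apply _
    refine ⟨(nuf r n).map (fun x i => x (j i i.2)), fun s hs A hA => ?_⟩
    have mm : Measurable (fun (w : Path) (i : I) => w i) :=
      measurable_pi_iff.2 fun i => measurable_eval _
    rw [← Measure.map_smul, ← nuf_law h1 h2 hi hs hA hr hr0 n, Measure.map_map mm (Meas.shift mW measurable_const), Measure.map_map mj]
    · congr 1
      funext ω i
      have hi0 := le_max_right (i:ℝ) 0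
      simp only [Function.comp, shift_apply, Wpath, ContinuousMap.coe_mk, min_eq_left (hjn i i.2), hjr i i.2, max_eq_left hs, max_eq_left (add_nonneg hs hi0), Prod.mk_sub_mk]
    · have m1 : ∀ t, Measurable (W1 t) := fun t => (h1.adapted t).mono (F.le _) le_rfl
      have m2 : ∀ t, Measurable (W2 t) := fun t => (h2.adapted t).mono (F.le _) le_rfl
      exact measurable_pi_iff.2 fun k => ((m1 _).sub (m1 _)).prodMk ((m2 _).sub (m2 _))
  refine ⟨inferInstance, hpr, fun t ht => ?_, fun ω t ht => ?_, fun s hs A hA => ?_⟩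
  · have : Measurable[F t] fun ω => (W1 t ω, W2 t ω) := (h1.adapted t).prodMk (h2.adapted t)
    simpa [Wpath, ht] using this
  · simp only [Wpath, ContinuousMap.coe_mk, max_eq_right ht, h1.init, h2.init]; rfl
  · have : IsFiniteMeasure (P A • P.map (Wpath h1 h2)) := by refine ⟨?_⟩; simp
    refine path_ext fun I => ?_
    obtain ⟨ν, hν⟩ := key I
    have e0 : (fun ω => shift 0 (Wpath h1 h2 ω)) = Wpath h1 h2 := by
      funext ω
      refine ContinuousMap.ext fun t => ?_
      simp [Wpath, h1.init, h2.init]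
    have h0 := hν 0 le_rfl univ MeasurableSet.univ
    rw [Measure.restrict_univ, e0, measure_univ, one_smul] at h0
    rw [hν s hs A hA, Measure.map_smul, h0]

end setsys

end

section

structure Gau (μ : Measure Path) : Prop where
  law : ∀ s t, 0 ≤ s → s ≤ t → μ.map (fun w => (w s, w t - w s)) = (g2 s).prod (g2 (t - s))

lemma Wpath_gau {P : Measure Ω} [IsProbabilityMeasure P] {F : Filtration ℝ mΩ} {W1 W2 : ℝ → Ω → ℝ} (h1 : IsStdBM P F W1) (h2 : IsStdBM P F W2) (hi : Indep (⨆ t : ℝ, MeasurableSpace.comap (W1 t) inferInstance) (⨆ t : ℝ, MeasurableSpace.comap (W2 t) inferInstance) P) : Gau (P.map (Wpath h1 h2)) := by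
  refine ⟨fun s t hs hst => ?_⟩
  have hS := Wpath_sys h1 h2 hi
  have m1 : ∀ t, Measurable (W1 t) := fun t => (h1.adapted t).mono (F.le _) le_rfl
  have m2 : ∀ t, Measurable (W2 t) := fun t => (h2.adapted t).mono (F.le _) le_rfl
  have hm : Measurable fun w : Path => (w s, w t - w s) :=
    (measurable_eval s).prodMk ((measurable_eval t).sub (measurable_eval s))
  rw [Measure.map_map hm hS.measW]
  have hF : Measurable[F s] fun ω => (W1 s ω, W2 s ω) := (h1.adapted s).prodMk (h2.adapted s)
  have := prod_of_markov (P := P) (μ := g2 (t - s)) (X := fun ω => (W1 s ω, W2 s ω)) (f := fun ω => (W1 t ω - W1 s ω, W2 t ω - W2 s ω)) ((m1 s).prodMk (m2 s)) (((m1 t).sub (m1 s)).prodMk ((m2 t).sub (m2 s))) (fun D hD => levy_J h1 h2 hi hs hst (hF hD))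
  have h0 := levy_J h1 h2 hi le_rfl hs (A := univ) MeasurableSet.univ
  simp only [Measure.restrict_univ, h1.init, h2.init, sub_zero, measure_univ, one_smul] at h0
  rw [h0] at this
  rw [← this]
  congr 1
  funext ω
  simp [Wpath, hs, hs.trans hst]

lemma g2_exp {d : ℝ} (hd : 0 ≤ d) (x y : ℝ) : ∫⁻ z, oR (rexp (x * z.1 + y * z.2)) ∂(g2 d) = oR (rexp (d * (x ^ 2 + y ^ 2) / 2)) := by
  have h1 : ∀ x : ℝ, ∫⁻ z, oR (rexp (x * z)) ∂(gaussianReal 0 d.toNNReal) = oR (rexp (d * x ^ 2 / 2)) := by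
    intro x
    rw [← ofReal_integral_eq_lintegral_ofReal (integrable_exp_mul_gaussianReal x) (ae_of_all _ fun _ => (exp_pos _).le)]
    have := congrFun (mgf_fun_id_gaussianReal (μ := 0) (v := d.toNNReal)) x
    unfold mgf at this
    rw [this, Real.coe_toNNReal _ hd]; simp
  simp_rw [exp_add, ofReal_mul (exp_pos _).le]
  rw [g2, lintegral_prod_mul (f := fun a => oR (rexp (x * a))) (g := fun a => oR (rexp (y * a))) (by fun_prop) (by fun_prop), h1, h1, ← ofReal_mul (exp_pos _).le, ← exp_add]
  congr 2; ring

variable {μ : Measure Path} {p : Par}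

lemma Gau.mgf (hG : Gau μ) {s t : ℝ} (hs : 0 ≤ s) (hst : s ≤ t) (c x y x' y' : ℝ) : ∫⁻ w, oR (rexp (c + (x * (w t).1 + y * (w t).2) + (x' * (w s).1 + y' * (w s).2))) ∂μ = oR (rexp (c + s * ((x + x') ^ 2 + (y + y') ^ 2) / 2 + (t - s) * (x ^ 2 + y ^ 2) / 2)) := by
  have hm : Measurable fun w : Path => (w s, w t - w s) :=
    (measurable_eval s).prodMk ((measurable_eval t).sub (measurable_eval s))
  have e : ∀ w : Path, oR (rexp (c + (x * (w t).1 + y * (w t).2) + (x' * (w s).1 + y' * (w s).2))) = (fun q : (ℝ × ℝ) × (ℝ × ℝ) =>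
        oR (rexp c) * (
        oR (rexp ((x + x') * q.1.1 + (y + y') * q.1.2)) *
        oR (rexp (x * q.2.1 + y * q.2.2)))) (w s, w t - w s) := by
    intro w
    simp only
    rw [← ofReal_mul (exp_pos _).le, ← ofReal_mul (exp_pos _).le, ← exp_add, ← exp_add]
    congr 2; simp only [Prod.fst_sub, Prod.snd_sub]; ring
  rw [lintegral_congr e]
  refine (lintegral_map (μ := μ) (f := fun q : (ℝ × ℝ) × (ℝ × ℝ) =>
        oR (rexp c) * (
        oR (rexp ((x + x') * q.1.1 + (y + y') * q.1.2)) *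
        oR (rexp (x * q.2.1 + y * q.2.2)))) (by fun_prop) hm).symm.trans ?_
  rw [hG.law s t hs hst, lintegral_const_mul _ (by fun_prop), lintegral_prod_mul (f := fun q : ℝ × ℝ => oR (rexp ((x + x') * q.1 + (y + y') * q.2))) (g := fun q : ℝ × ℝ => oR (rexp (x * q.1 + y * q.2))) (by fun_prop) (by fun_prop), g2_exp hs, g2_exp (by linarith), ← ofReal_mul (exp_pos _).le, ← ofReal_mul (exp_pos _).le, ← exp_add, ← exp_add]
  congr 2; ring

def yE (p : Par) (u : ℝ) : ℝ := p.a * (-p.ρ - p.β₂ ^ 2 / 2) + p.a ^ 2 * p.β₂ ^ 2 / 2 + p.b * (p.β₁ ^ 2 / 2 + u - p.B) + p.b ^ 2 * p.β₁ ^ 2 / 2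
def qE (p : Par) (u : ℝ) : ℝ := (p.ρ + p.β₂ ^ 2 / 2 - p.β₁ ^ 2 / 2) + (p.B - u) + (p.β₁ ^ 2 + p.β₂ ^ 2) / 2 - p.b * p.β₁ ^ 2 - p.a * p.β₂ ^ 2

lemma par_S : 0 < p.b ^ 2 * p.β₁ ^ 2 + p.a ^ 2 * p.β₂ ^ 2 := by
  have := p.hb; have := p.hβ₁; have := p.ha; positivity

lemma par_gap (p : Par) : ∃ u, 0 < u ∧ u ≤ p.R ∧ yE p u < p.θ ∧ yE p u + p.a * max (qE p u) 0 < p.θ := by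
  have ha := p.ha; have hb := p.hb; have hab := p.hab
  set S := p.b ^ 2 * p.β₁ ^ 2 + p.a ^ 2 * p.β₂ ^ 2 with hS
  have hSp : 0 < S := par_S
  set L := max 2 (1 / p.a) with hL
  have hL2 : (2:ℝ) ≤ L := le_max_left _ _
  have hL1 : 1 ≤ p.a * L := by
    have : 1 / p.a ≤ L := le_max_right _ _
    rw [div_le_iff₀ ha] at this; linarith
  have hq : p.a * (p.β₁ ^ 2 + p.β₂ ^ 2) ≤ L * S := by
    have h1 : p.a ^ 2 * (p.β₁ ^ 2 + p.β₂ ^ 2) ≤ S := by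
      have : p.a ^ 2 ≤ p.b ^ 2 := by nlinarith
      nlinarith [mul_le_mul_of_nonneg_right this (sq_nonneg p.β₁)]
    calc p.a * (p.β₁ ^ 2 + p.β₂ ^ 2) ≤ (p.a * L) * (p.a * (p.β₁ ^ 2 + p.β₂ ^ 2)) :=
          le_mul_of_one_le_left (by positivity) hL1
      _ = L * (p.a ^ 2 * (p.β₁ ^ 2 + p.β₂ ^ 2)) := by ring
      _ ≤ L * S := by gcongr
  have hLS : 2 * S ≤ L * S := by gcongr
  have g0 : 0 ≤ p.a * (p.b * p.β₁ ^ 2 + p.a * p.β₂ ^ 2) := by positivity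
  have base : yE p p.B + p.a * max (qE p p.B) 0 < p.θ ∧ yE p p.B < p.θ := by
    have key : yE p p.B < p.θ ∧ yE p p.B + p.a * qE p p.B < p.θ := by
      unfold yE qE
      rcases le_or_gt (p.ρ + (p.β₂ ^ 2 - p.β₁ ^ 2) / 2) 0 with h | h
      · have := p.as1 h
        rw [← hS, ← hL] at this
        have h2 := mul_nonneg ha.le (neg_nonneg.2 h)
        constructor <;> nlinarith
      · have := p.as2 h
        rw [← hS, ← hL] at this
        have h2 := mul_pos ha h
        constructor <;> nlinarith
    refine ⟨?_, key.1⟩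
    rcases max_cases (qE p p.B) 0 with ⟨h, _⟩ | ⟨h, _⟩ <;> rw [h]
    · exact key.2
    · simpa using key.1
  have hc1 : Continuous fun u => yE p u := by unfold yE; fun_prop
  have hc2 : Continuous fun u => yE p u + p.a * max (qE p u) 0 := by unfold yE qE; fun_prop
  have ev1 := (hc1.tendsto p.B).eventually (gt_mem_nhds base.2)
  have ev2 := (hc2.tendsto p.B).eventually (gt_mem_nhds base.1)
  rcases p.hB.lt_or_eq with hB | hB
  · exact ⟨p.B, hB, p.hBR, base.2, base.1⟩
  · rw [← hB] at ev1 ev2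
    have ev := ((ev1.and ev2).filter_mono nhdsWithin_le_nhds).and (Ioc_mem_nhdsGT p.hR)
    obtain ⟨u, ⟨h1, h2⟩, h3⟩ := ev.exists
    exact ⟨u, h3.1, h3.2, h1, h2⟩

def Yx (p : Par) (u : ℝ) (w : Path) (t : ℝ) : ℝ :=
  rexp ((p.a * (-p.ρ - p.β₂ ^ 2 / 2) + p.b * (p.β₁ ^ 2 / 2 + u - p.B)) * t + (-p.b * p.β₁ * (w t).1 + p.a * p.β₂ * (w t).2))
def Xx (p : Par) (u : ℝ) (w : Path) (t : ℝ) : ℝ :=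
  rexp ((p.B - p.β₁ ^ 2 / 2 - u + p.ρ + p.β₂ ^ 2 / 2) * t + (p.β₁ * (w t).1 + (-p.β₂) * (w t).2))

lemma Yx_meas (u t : ℝ) : Measurable fun w => Yx p u w t := by
  unfold Yx
  exact Real.measurable_exp.comp (measurable_const.add ((measurable_const.mul (measurable_fst.comp (measurable_eval t))).add (measurable_const.mul (measurable_snd.comp (measurable_eval t)))))

lemma Xx_cont (u : ℝ) (w : Path) : Continuous (Xx p u w) := by unfold Xx; fun_prop

lemma Xx_meas₂ (u : ℝ) : Measurable fun q : Path × ℝ => Xx p u q.1 q.2 := by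
  unfold Xx
  have : Measurable fun q : Path × ℝ => q.1 q.2 := measurable_eval₂.comp measurable_swap
  fun_prop

lemma Gau.Y (hG : Gau μ) (u : ℝ) {t : ℝ} (ht : 0 ≤ t) : ∫⁻ w, oR (Yx p u w t) ∂μ = oR (rexp (yE p u * t)) := by
  have := hG.mgf ht le_rfl ((p.a * (-p.ρ - p.β₂ ^ 2 / 2) + p.b * (p.β₁ ^ 2 / 2 + u - p.B)) * t) (-p.b * p.β₁) (p.a * p.β₂) 0 0
  simp only [zero_mul, add_zero] at this
  simp only [Yx]
  rw [this]; congr 2; unfold yE; ring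

lemma Gau.YX (hG : Gau μ) (u : ℝ) {s t : ℝ} (hs : 0 ≤ s) (hst : s ≤ t) : ∫⁻ w, oR (Yx p u w t * Xx p u w s) ∂μ = oR (rexp (yE p u * t + qE p u * s)) := by
  have := hG.mgf hs hst ((p.a * (-p.ρ - p.β₂ ^ 2 / 2) + p.b * (p.β₁ ^ 2 / 2 + u - p.B)) * t + (p.B - p.β₁ ^ 2 / 2 - u + p.ρ + p.β₂ ^ 2 / 2) * s) (-p.b * p.β₁) (p.a * p.β₂) p.β₁ (-p.β₂)
  have e : ∀ w : Path, Yx p u w t * Xx p u w s = rexp ((p.a * (-p.ρ - p.β₂ ^ 2 / 2) + p.b * (p.β₁ ^ 2 / 2 + u - p.B)) * t + (p.B - p.β₁ ^ 2 / 2 - u + p.ρ + p.β₂ ^ 2 / 2) * s + (-p.b * p.β₁ * (w t).1 + p.a * p.β₂ * (w t).2) + (p.β₁ * (w s).1 + (-p.β₂) * (w s).2)) := by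
    intro w; unfold Yx Xx; rw [← exp_add]; congr 1; ring
  simp_rw [e]
  rw [this]; congr 2; unfold yE qE; ring

lemma cf_const_le {u k h : ℝ} (hu : 0 < u) (hk : 0 < k) (hh : 0 < h) (w : Path) {t : ℝ} (ht : 0 ≤ t) {G : ℝ} (hG : 0 < G) : cf p (Hx p k h (fun _ => u) w t) u (Kx p k (fun _ => u) w t) ≤ (p.b⁻¹ * u ^ (-p.b) * k ^ (-p.b)) * (h ^ p.a * Yx p u w t + (p.ρ * u * k) ^ p.a * G ^ p.a * (Yx p u w t + G⁻¹ * ∫ s in 0..t, Yx p u w t * Xx p u w s)) := by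
  have hb := p.hb; have ha := p.ha; have hρ := p.hρ₀
  have hHi : ∀ s, Hi p k (fun _ => u) w s = u * k * Xx p u w s := by
    intro s
    unfold Hi Kx E1 E2 Xx
    rw [intervalIntegral.integral_const, mul_assoc k, ← exp_add, mul_div_assoc, mul_div_assoc, ← exp_sub, mul_assoc]
    congr 3; simp; ring
  set I := ∫ s in 0..t, Xx p u w s with hI
  have hI0 : 0 ≤ I := intervalIntegral.integral_nonneg ht fun s _ => (exp_pos _).le
  have hH : Hx p k h (fun _ => u) w t = E2 p w t * (h + p.ρ * u * k * I) := by
    unfold Hx; simp_rw [hHi]; rw [intervalIntegral.integral_const_mul]; ring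
  have e1 : (h + p.ρ * u * k * I) ^ p.a ≤ h ^ p.a + (p.ρ * u * k) ^ p.a * (G ^ p.a * (1 + G⁻¹ * I)) := by
    have s1 : (h + p.ρ * u * k * I) ^ p.a ≤ h ^ p.a + (p.ρ * u * k * I) ^ p.a :=
      rpow_add_le_add_rpow hh.le (by positivity) ha.le p.ha1
    have s2 : I ^ p.a ≤ G ^ p.a * (1 + G⁻¹ * I) := by
      calc I ^ p.a ≤ (G * (1 + G⁻¹ * I)) ^ p.a := by
            apply rpow_le_rpow hI0 _ ha.le
            rw [mul_add, mul_inv_cancel_left₀ hG.ne']; linarith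
        _ = G ^ p.a * (1 + G⁻¹ * I) ^ p.a := Real.mul_rpow hG.le (by positivity)
        _ ≤ G ^ p.a * (1 + G⁻¹ * I) := by
            gcongr
            apply rpow_le_self_of_one_le _ p.ha1
            have : 0 ≤ G⁻¹ * I := by positivity
            linarith
    rw [Real.mul_rpow (x := p.ρ * u * k) (by positivity) hI0] at s1
    exact s1.trans (by gcongr)
  have hY : E2 p w t ^ p.a * (Kx p k (fun _ => u) w t) ^ (-p.b) = k ^ (-p.b) * Yx p u w t := by
    unfold E2 Kx E1 Yx
    rw [intervalIntegral.integral_const, mul_assoc k, ← exp_add, Real.mul_rpow hk.le (exp_pos _).le, ← exp_mul, ← exp_mul, mul_left_comm, ← exp_add]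
    congr 2; simp; ring
  unfold cf
  rw [hH, Real.mul_rpow (E2_pos w t).le (by positivity), intervalIntegral.integral_const_mul]
  calc _ = p.b⁻¹ * u ^ (-p.b) * (E2 p w t ^ p.a * (Kx p k (fun _ => u) w t) ^ (-p.b)) * (h + p.ρ * u * k * I) ^ p.a := by ring
    _ ≤ p.b⁻¹ * u ^ (-p.b) * (E2 p w t ^ p.a * (Kx p k (fun _ => u) w t) ^ (-p.b)) * (h ^ p.a + (p.ρ * u * k) ^ p.a * (G ^ p.a * (1 + G⁻¹ * I))) := by
        have := E2_pos (p := p) w t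
        have := Kx_pos (p := p) hk (fun _ => u) w t
        gcongr
    _ = _ := by rw [hY]; ring

def phi (p : Par) (k h : ℝ) : ℝ := h ^ p.a * k ^ (-p.b) + k ^ (p.a - p.b)

lemma phi_pos {k h : ℝ} (hk : 0 < k) (hh : 0 < h) : 0 < phi p k h := by unfold phi; positivity

lemma meas_run_const {u k h : ℝ} : Measurable fun q : ℝ × Path => run p k h (fun _ => u) q.2 q.1 :=
  meas_run₂ (X := Path) (u := fun _ _ => u) measurable_const (f := fun w => w) measurable_id (K := fun _ => k) measurable_const (H := fun _ => h) measurable_const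

lemma Gau.run_le (hG : Gau μ) [IsProbabilityMeasure μ] {u k h : ℝ} (hu : 0 < u) (hk : 0 < k) (hh : 0 < h) {t : ℝ} (ht : 0 ≤ t) : ∫⁻ w, run p k h (fun _ => u) w t ∂μ ≤ oR ((p.b⁻¹ * u ^ (-p.b) * (1 + 2 * (p.ρ * u) ^ p.a)) * phi p k h * ((1 + t) * rexp (-(p.θ - (yE p u + p.a * max (qE p u) 0)) * t))) := by
  have hb := p.hb; have ha := p.ha; have hρ := p.hρ₀
  set q := max (qE p u) 0 with hq
  have hq0 : 0 ≤ q := le_max_right _ _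
  set G := (1 + t) * rexp (q * t) with hGd
  have hGp : 0 < G := by positivity
  set A0 := p.b⁻¹ * u ^ (-p.b) * k ^ (-p.b) with hA0
  have hA0p : 0 ≤ A0 := by positivity
  have hYX : ∫⁻ w, oR (∫ s in 0..t, Yx p u w t * Xx p u w s) ∂μ ≤ oR (t * rexp (yE p u * t + q * t)) := by
    have e : ∀ w : Path, oR (∫ s in 0..t, Yx p u w t * Xx p u w s) = ∫⁻ s in Ioc 0 t, oR (Yx p u w t * Xx p u w s) := by
      intro w
      rw [intervalIntegral.integral_of_le ht, ofReal_integral_eq_lintegral_ofReal]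
      · exact ((continuous_const.mul (Xx_cont u w)).integrableOn_Icc).mono_set Ioc_subset_Icc_self
      · exact ae_of_all _ fun s => (mul_pos (exp_pos _) (exp_pos _)).le
    simp_rw [e]
    rw [lintegral_lintegral_swap]
    · calc _ ≤ ∫⁻ s in Ioc 0 t, oR (rexp (yE p u * t + q * t)) := by
            refine setLIntegral_mono measurable_const fun s hs => ?_
            rw [hG.YX u hs.1.le hs.2]
            apply ofReal_le_ofReal; apply exp_le_exp.2
            have : qE p u * s ≤ q * t := by
              calc qE p u * s ≤ q * s := mul_le_mul_of_nonneg_right (le_max_left _ _) hs.1.le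
                _ ≤ q * t := mul_le_mul_of_nonneg_left hs.2 hq0
            linarith
        _ = _ := by
            rw [setLIntegral_const, Real.volume_Ioc, sub_zero, mul_comm, ofReal_mul ht]
    · exact (((Yx_meas u t).comp measurable_fst).mul (Xx_meas₂ u)).ennreal_ofReal.aemeasurable
  have hmI : Measurable fun w : Path => oR (Yx p u w t) := (Yx_meas u t).ennreal_ofReal
  calc ∫⁻ w, run p k h (fun _ => u) w t ∂μ ≤ ∫⁻ w, oR (A0 * rexp (-p.θ * t)) * (oR (h ^ p.a) * oR (Yx p u w t) + oR ((p.ρ * u * k) ^ p.a * G ^ p.a) * (oR (Yx p u w t) + oR G⁻¹ * oR (∫ s in 0..t, Yx p u w t * Xx p u w s))) ∂μ := by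
        refine lintegral_mono fun w => ?_
        have hI0 : 0 ≤ ∫ s in 0..t, Yx p u w t * Xx p u w s :=
          intervalIntegral.integral_nonneg ht fun s _ => (mul_pos (exp_pos _) (exp_pos _)).le
        have hY0 : 0 ≤ Yx p u w t := (exp_pos _).le
        have := cf_const_le (p := p) hu hk hh w ht hGp
        rw [← ofReal_mul (by positivity), ← ofReal_mul (by positivity), ← ENNReal.ofReal_add (by positivity) (by positivity), ← ofReal_mul (by positivity), ← ENNReal.ofReal_add (by positivity) (by positivity), ← ofReal_mul (by positivity)]
        apply ofReal_le_ofReal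
        calc _ ≤ _ := mul_le_mul_of_nonneg_right this (exp_pos _).le
          _ = _ := by ring
    _ = oR (A0 * rexp (-p.θ * t)) * (oR (h ^ p.a) * oR (rexp (yE p u * t)) + oR ((p.ρ * u * k) ^ p.a * G ^ p.a) * (oR (rexp (yE p u * t)) + oR G⁻¹ * ∫⁻ w, oR (∫ s in 0..t, Yx p u w t * Xx p u w s) ∂μ)) := by
        rw [lintegral_const_mul' _ _ (by simp), lintegral_add_left (hmI.const_mul _), lintegral_const_mul' _ _ (by simp), lintegral_const_mul' _ _ (by simp), lintegral_add_left hmI, lintegral_const_mul' _ _ (by simp), hG.Y u ht]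
    _ ≤ oR (A0 * rexp (-p.θ * t)) * (oR (h ^ p.a) * oR (rexp (yE p u * t)) + oR ((p.ρ * u * k) ^ p.a * G ^ p.a) * (oR (rexp (yE p u * t)) + oR G⁻¹ * oR (t * rexp (yE p u * t + q * t)))) := by gcongr
    _ ≤ _ := by
        rw [← ofReal_mul (by positivity), ← ofReal_mul (by positivity), ← ENNReal.ofReal_add (by positivity) (by positivity), ← ofReal_mul (by positivity), ← ENNReal.ofReal_add (by positivity) (by positivity), ← ofReal_mul (by positivity)]
        apply ofReal_le_ofReal
        have hGt : G⁻¹ * (t * rexp (yE p u * t + q * t)) ≤ rexp (yE p u * t) := by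
          rw [inv_mul_le_iff₀ hGp, exp_add, hGd]
          nlinarith [mul_pos (exp_pos (yE p u * t)) (exp_pos (q * t))]
        have hGa : G ^ p.a ≤ (1 + t) * rexp (p.a * q * t) := by
          rw [hGd, Real.mul_rpow (by positivity) (exp_pos _).le, ← exp_mul]
          apply mul_le_mul (rpow_le_self_of_one_le (by linarith) p.ha1) _ (by positivity) (by positivity)
          apply exp_le_exp.2; linarith
        have hk2 : (p.ρ * u * k) ^ p.a = (p.ρ * u) ^ p.a * k ^ p.a :=
          Real.mul_rpow (by positivity) hk.le
        have hk3 : k ^ (p.a - p.b) = k ^ p.a * k ^ (-p.b) := by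
          rw [← rpow_add hk]; rfl
        have hee : rexp (-p.θ * t) * rexp (yE p u * t) * rexp (p.a * q * t) = rexp (-(p.θ - (yE p u + p.a * q)) * t) := by
          rw [← exp_add, ← exp_add]; congr 1; ring
        have h1e : 1 ≤ rexp (p.a * q * t) := Real.one_le_exp (by positivity)
        calc A0 * rexp (-p.θ * t) * (h ^ p.a * rexp (yE p u * t) + (p.ρ * u * k) ^ p.a * G ^ p.a * (rexp (yE p u * t) + G⁻¹ * (t * rexp (yE p u * t + q * t)))) ≤ A0 * rexp (-p.θ * t) * (h ^ p.a * rexp (yE p u * t) * ((1 + t) * rexp (p.a * q * t)) + (p.ρ * u * k) ^ p.a * ((1 + t) * rexp (p.a * q * t)) * (rexp (yE p u * t) + rexp (yE p u * t))) := by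
              have : 1 ≤ (1 + t) * rexp (p.a * q * t) := by nlinarith
              have h5 : h ^ p.a * rexp (yE p u * t) ≤ h ^ p.a * rexp (yE p u * t) * ((1 + t) * rexp (p.a * q * t)) :=
                le_mul_of_one_le_right (by positivity) this
              gcongr
          _ = p.b⁻¹ * u ^ (-p.b) * (h ^ p.a * k ^ (-p.b) + 2 * (p.ρ * u) ^ p.a * k ^ (p.a - p.b)) * ((1 + t) * rexp (-(p.θ - (yE p u + p.a * q)) * t)) := by
              rw [← hee, hk2, hk3, hA0]; ring
          _ ≤ _ := by
              unfold phi
              have h6 : 0 < h ^ p.a * k ^ (-p.b) := by positivity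
              have h7 : 0 < k ^ (p.a - p.b) := by positivity
              have h8 : 0 < (p.ρ * u) ^ p.a := by positivity
              have : h ^ p.a * k ^ (-p.b) + 2 * (p.ρ * u) ^ p.a * k ^ (p.a - p.b) ≤ (1 + 2 * (p.ρ * u) ^ p.a) * (h ^ p.a * k ^ (-p.b) + k ^ (p.a - p.b)) := by nlinarith
              have h9 : 0 ≤ p.b⁻¹ * u ^ (-p.b) := by have := p.hb; positivity
              refine (mul_le_mul_of_nonneg_right (mul_le_mul_of_nonneg_left this h9) (by positivity)).trans (le_of_eq ?_)
              ring

lemma exp_poly_int {κ : ℝ} (hκ : 0 < κ) : ∃ C : ℝ, 0 ≤ C ∧ ∫⁻ t in Ioi (0:ℝ), oR ((1 + t) * rexp (-κ * t)) ≤ oR C := by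
  have hI : IntegrableOn (fun t => (1 + 2 / κ) * rexp (-(κ / 2) * t)) (Ioi (0:ℝ)) :=
    (exp_neg_integrableOn_Ioi 0 (by positivity)).const_mul _
  refine ⟨∫ t in Ioi (0:ℝ), (1 + 2 / κ) * rexp (-(κ / 2) * t), setIntegral_nonneg measurableSet_Ioi fun t _ => by positivity, ?_⟩
  rw [ofReal_integral_eq_lintegral_ofReal hI (ae_of_all _ fun t => by positivity)]
  refine setLIntegral_mono (by fun_prop) fun t ht => ofReal_le_ofReal ?_
  have ht : (0:ℝ) < t := ht
  have e1 := Real.add_one_le_exp (κ / 2 * t)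
  have e2 : (1 + t) ≤ (1 + 2 / κ) * rexp (κ / 2 * t) := by
    have : t = 2 / κ * (κ / 2 * t) := by field_simp
    have h3 : 0 < κ / 2 * t := by positivity
    have h2 : 2 / κ * (κ / 2 * t) ≤ 2 / κ * rexp (κ / 2 * t) := by gcongr; linarith
    nlinarith
  calc (1 + t) * rexp (-κ * t) ≤ (1 + 2 / κ) * rexp (κ / 2 * t) * rexp (-κ * t) := by gcongr
    _ = _ := by rw [mul_assoc, ← exp_add]; congr 2; ring

lemma Gau.M1 (hG : Gau μ) [IsProbabilityMeasure μ] (p : Par) : ∃ u C : ℝ, 0 < u ∧ u ≤ p.R ∧ 0 ≤ C ∧ ∀ k h : ℝ, 0 < k → 0 < h → ∫⁻ w, cst p k h (fun _ => u) w ∂μ ≤ oR (C * phi p k h) := by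
  obtain ⟨u, hu, huR, hy, hyq⟩ := par_gap p
  obtain ⟨C, hC, hCb⟩ := exp_poly_int (κ := p.θ - (yE p u + p.a * max (qE p u) 0)) (by linarith)
  have hb := p.hb; have ha := p.ha; have hρ := p.hρ₀
  refine ⟨u, (p.b⁻¹ * u ^ (-p.b) * (1 + 2 * (p.ρ * u) ^ p.a)) * C, hu, huR, by positivity, fun k h hk hh => ?_⟩
  have hphi := phi_pos (p := p) hk hh
  unfold cst
  rw [lintegral_lintegral_swap (meas_run_const.comp measurable_swap).aemeasurable]
  calc _ ≤ ∫⁻ t in Ioi (0:ℝ), oR ((p.b⁻¹ * u ^ (-p.b) * (1 + 2 * (p.ρ * u) ^ p.a)) * phi p k h) * oR ((1 + t) * rexp (-(p.θ - (yE p u + p.a * max (qE p u) 0)) * t)) := by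
        refine setLIntegral_mono (by fun_prop) fun t ht => ?_
        rw [← ofReal_mul (by positivity)]
        exact hG.run_le hu hk hh (le_of_lt ht)
    _ ≤ _ := by
        rw [lintegral_const_mul' _ _ (by simp)]
        refine (mul_le_mul_right hCb _).trans ?_
        rw [← ofReal_mul (by positivity)]
        apply ofReal_le_ofReal; apply le_of_eq; ring

end

section

/- canonical controls and the value -/
section canon

variable {p : Par} {μ : Measure Path}

variable (p) in
structure Can (φ : ℝ → Path → ℝ) : Prop where
  meas : Measurable fun q : ℝ × Path => φ q.1 q.2
  pos : ∀ t w, 0 < φ t w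
  le : ∀ t w, φ t w ≤ p.R
  nonant : ∀ t w, φ t w = φ t (frz (max t 0) w)

lemma Can.ok {φ : ℝ → Path → ℝ} (hφ : Can p φ) (w : Path) : OkU p (fun t => φ t w) :=
  ⟨hφ.meas.comp measurable_prodMk_right, fun t => hφ.pos t w, fun t => hφ.le t w⟩

lemma Can.const {x : ℝ} (hx : 0 < x) (hx' : x ≤ p.R) : Can p fun _ _ => x :=
  ⟨measurable_const, fun _ _ => hx, fun _ _ => hx', fun _ _ => rfl⟩

variable (p μ) in
def vv (k h : ℝ) : ℝ≥0∞ := ⨅ φ : {φ : ℝ → Path → ℝ // Can p φ}, ∫⁻ w, cst p (rexp (Real.log k)) (rexp (Real.log h)) (fun t => φ.1 t w) w ∂μ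

lemma vv_le {φ : ℝ → Path → ℝ} (hφ : Can p φ) {k h : ℝ} (hk : 0 < k) (hh : 0 < h) : vv p μ k h ≤ ∫⁻ w, cst p k h (fun t => φ t w) w ∂μ := by
  unfold vv
  rw [exp_log hk, exp_log hh]
  exact iInf_le (fun φ : {φ : ℝ → Path → ℝ // Can p φ} =>
    ∫⁻ w, cst p k h (fun t => φ.1 t w) w ∂μ) ⟨φ, hφ⟩

lemma cst_exp_scale {φ : ℝ → Path → ℝ} (hφ : Can p φ) {x y x' y' d : ℝ} (hx : |x' - x| ≤ d) (hy : |y' - y| ≤ d) : ∫⁻ w, cst p (rexp x') (rexp y') (fun t => φ t w) w ∂μ ≤ oR (rexp ((p.a + p.b) * d)) * ∫⁻ w, cst p (rexp x) (rexp y) (fun t => φ t w) w ∂μ := by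
  rw [← lintegral_const_mul' _ _ ofReal_ne_top]
  refine lintegral_mono fun w => ?_
  have hx := abs_le.1 hx
  have hy := abs_le.1 hy
  have := cst_scale (p := p) (c := rexp d) (e := rexp (-d)) (exp_pos x) (exp_pos y) (exp_pos x') (exp_pos y') (hφ.ok w) w (exp_pos _) (by rw [← exp_add]; exact exp_le_exp.2 (by linarith)) (by rw [← exp_add]; exact exp_le_exp.2 (by linarith)) (by rw [← exp_add]; exact exp_le_exp.2 (by linarith))
  convert this using 3
  rw [← exp_mul, ← exp_mul, ← exp_add]; congr 1; ring

lemma vv_scale {k h k' h' d : ℝ} (hk : |Real.log k' - Real.log k| ≤ d) (hh : |Real.log h' - Real.log h| ≤ d) : vv p μ k' h' ≤ oR (rexp ((p.a + p.b) * d)) * vv p μ k h := by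
  unfold vv
  rw [ENNReal.mul_iInf_of_ne (by simp [exp_pos]) ofReal_ne_top]
  exact iInf_mono fun φ => cst_exp_scale φ.2 hk hh

lemma vx_cont : Continuous fun z : ℝ × ℝ => vv p μ (rexp z.1) (rexp z.2) := by
  rw [continuous_iff_continuousAt]
  intro z
  have hd : Tendsto (fun z' : ℝ × ℝ => dist z' z) (nhds z) (nhds 0) := by
    have : Continuous fun z' : ℝ × ℝ => dist z' z := by fun_prop
    simpa using this.tendsto z
  have h1 : ∀ c : ℝ, Tendsto (fun z' : ℝ × ℝ => oR (rexp (c * dist z' z)) * vv p μ (rexp z.1) (rexp z.2)) (nhds z) (nhds (vv p μ (rexp z.1) (rexp z.2))) := by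
    intro c
    have : Tendsto (fun z' : ℝ × ℝ => oR (rexp (c * dist z' z))) (nhds z) (nhds 1) := by
      have h0 : Continuous fun x : ℝ => oR (rexp (c * x)) :=
        ENNReal.continuous_ofReal.comp (by fun_prop)
      have h2 := (h0.tendsto 0).comp hd
      simp only [mul_zero, exp_zero, ENNReal.ofReal_one] at h2
      exact h2
    simpa using ENNReal.Tendsto.mul_const this (Or.inl one_ne_zero)
  have hl : ∀ z z' : ℝ × ℝ, vv p μ (rexp z'.1) (rexp z'.2) ≤ oR (rexp ((p.a + p.b) * dist z' z)) * vv p μ (rexp z.1) (rexp z.2) := by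
    intro z z'
    refine vv_scale ?_ ?_
    · simp only [log_exp, ← Real.dist_eq]; rw [Prod.dist_eq]; exact le_max_left _ _
    · simp only [log_exp, ← Real.dist_eq]; rw [Prod.dist_eq]; exact le_max_right _ _
  refine tendsto_of_tendsto_of_tendsto_of_le_of_le (h1 (-(p.a + p.b))) (h1 (p.a + p.b)) ?_ (hl z)
  intro z'
  have h3 := hl z' z
  calc _ ≤ oR (rexp (-(p.a + p.b) * dist z' z)) * (oR (rexp ((p.a + p.b) * dist z z')) * vv p μ (rexp z'.1) (rexp z'.2)) := by
        exact mul_le_mul_right h3 _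
    _ = _ := by
        rw [← mul_assoc, ← ofReal_mul (exp_pos _).le, ← exp_add, dist_comm z z', show -(p.a + p.b) * dist z' z + (p.a + p.b) * dist z' z = 0 by ring]
        simp

lemma vv_explog (k h : ℝ) : vv p μ k h = vv p μ (rexp (Real.log k)) (rexp (Real.log h)) := by
  unfold vv; simp only [log_exp]

lemma vv_meas : Measurable fun z : ℝ × ℝ => vv p μ z.1 z.2 := by
  have h1 : Measurable fun z : ℝ × ℝ => ((Real.log z.1, Real.log z.2) : ℝ × ℝ) :=
    (Real.measurable_log.comp measurable_fst).prodMk (Real.measurable_log.comp measurable_snd)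
  have := (vx_cont (p := p) (μ := μ)).measurable.comp h1
  have e : (fun z : ℝ × ℝ => vv p μ z.1 z.2) = (fun z : ℝ × ℝ => vv p μ (rexp z.1) (rexp z.2)) ∘ fun z : ℝ × ℝ => ((Real.log z.1, Real.log z.2) : ℝ × ℝ) := funext fun z => vv_explog _ _
  rw [e]; exact this

lemma vv_tendsto {ι : Type*} {l : Filter ι} {f g : ι → ℝ} {k h : ℝ} (hk : 0 < k) (hh : 0 < h) (hf : Tendsto f l (nhds k)) (hg : Tendsto g l (nhds h)) : Tendsto (fun i => vv p μ (f i) (g i)) l (nhds (vv p μ k h)) := by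
  have h1 : Tendsto (fun i => ((Real.log (f i), Real.log (g i)) : ℝ × ℝ)) l (nhds (Real.log k, Real.log h)) :=
    ((Real.continuousAt_log hk.ne').tendsto.comp hf).prodMk_nhds ((Real.continuousAt_log hh.ne').tendsto.comp hg)
  have := ((vx_cont (p := p) (μ := μ)).tendsto _).comp h1
  rw [vv_explog]
  refine this.congr fun i => ?_
  exact (vv_explog _ _).symm

lemma vv_lt_top [IsProbabilityMeasure μ] (hG : Gau μ) (k h : ℝ) : vv p μ k h < ∞ := by
  obtain ⟨u, C, hu, hu', hC, hM⟩ := hG.M1 p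
  rw [vv_explog]
  refine (vv_le (Can.const hu hu') (exp_pos _) (exp_pos _)).trans_lt ?_
  exact (hM _ _ (exp_pos _) (exp_pos _)).trans_lt ofReal_lt_top

variable (p) in
structure Fam (Φ : ℝ × ℝ → ℝ → Path → ℝ) : Prop where
  meas : Measurable fun q : (ℝ × ℝ) × (ℝ × Path) => Φ q.1 q.2.1 q.2.2
  can : ∀ z, Can p (Φ z)

lemma Fam.const {x : ℝ} (hx : 0 < x) (hx' : x ≤ p.R) : Fam p fun _ _ _ => x :=
  ⟨measurable_const, fun _ => Can.const hx hx'⟩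

variable (p) in
def gF (Φ : ℝ × ℝ → ℝ → Path → ℝ) (q : (ℝ × ℝ) × Path) : ℝ≥0∞ :=
  cst p q.1.1 q.1.2 (fun t => Φ q.1 t q.2) q.2

lemma Fam.gmeas {Φ : ℝ × ℝ → ℝ → Path → ℝ} (hΦ : Fam p Φ) : Measurable (gF p Φ) := by
  refine meas_cst (X := (ℝ × ℝ) × Path) (u := fun t q => Φ q.1 t q.2) ?_ measurable_snd (measurable_fst.comp measurable_fst) (measurable_snd.comp measurable_fst)
  exact hΦ.meas.comp ((measurable_fst.comp measurable_snd).prodMk (measurable_fst.prodMk (measurable_snd.comp measurable_snd)))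

lemma exists_fam [IsProbabilityMeasure μ] (hG : Gau μ) {δ : ℝ} (hδ : 0 < δ) : ∃ Φ, Fam p Φ ∧ ∀ z : ℝ × ℝ, 0 < z.1 → 0 < z.2 → ∫⁻ w, gF p Φ (z, w) ∂μ ≤ oR (rexp ((p.a + p.b) * δ)) * (oR (rexp ((p.a + p.b) * δ)) * vv p μ z.1 z.2 + oR δ) := by
  have hc : ∀ i : ℤ × ℤ, ∃ φ, Can p φ ∧ ∫⁻ w, cst p (rexp (i.1 * δ)) (rexp (i.2 * δ)) (fun t => φ t w) w ∂μ ≤ vv p μ (rexp (i.1 * δ)) (rexp (i.2 * δ)) + oR δ := by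
    intro i
    have h1 := vv_lt_top (p := p) hG (rexp (i.1 * δ)) (rexp (i.2 * δ))
    have h2 : vv p μ (rexp (i.1 * δ)) (rexp (i.2 * δ)) < vv p μ (rexp (i.1 * δ)) (rexp (i.2 * δ)) + oR δ :=
      ENNReal.lt_add_right h1.ne (by simpa using hδ)
    conv_lhs at h2 => unfold vv
    rw [iInf_lt_iff] at h2
    obtain ⟨φ, hφ⟩ := h2
    refine ⟨φ.1, φ.2, ?_⟩
    simpa only [log_exp] using hφ.le
  choose φ hφ hle using hc
  let ix : ℝ × ℝ → ℤ × ℤ := fun z => (⌊Real.log z.1 / δ⌋, ⌊Real.log z.2 / δ⌋)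
  have hix : Measurable ix := by
    refine Measurable.prodMk ?_ ?_
    · exact Int.measurable_floor.comp ((Real.measurable_log.comp measurable_fst).div_const _)
    · exact Int.measurable_floor.comp ((Real.measurable_log.comp measurable_snd).div_const _)
  have habs : ∀ x : ℝ, |x - ⌊x / δ⌋ * δ| ≤ δ := by
    intro x
    have h1 := Int.floor_le (x / δ)
    have h2 := (Int.lt_floor_add_one (x / δ)).le
    rw [le_div_iff₀ hδ] at h1
    rw [div_le_iff₀ hδ] at h2
    rw [abs_le]; constructor <;> linarith
  refine ⟨fun z => φ (ix z), ⟨?_, fun z => hφ _⟩, fun ⟨k, h⟩ hk hh => ?_⟩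
  · have h1 : Measurable fun q : (ℤ × ℤ) × (ℝ × Path) => φ q.1 q.2.1 q.2.2 :=
      measurable_from_prod_countable_right fun i => (hφ i).meas
    exact h1.comp ((hix.comp measurable_fst).prodMk measurable_snd)
  · have h1 := cst_exp_scale (μ := μ) (hφ (ix (k, h))) (habs (Real.log k)) (habs (Real.log h))
    rw [exp_log hk, exp_log hh] at h1
    refine h1.trans ?_
    refine (mul_le_mul_right ((hle (ix (k, h))).trans (add_le_add_left ?_ _)) _)
    refine vv_scale ?_ ?_
    · rw [log_exp, abs_sub_comm]; exact habs _
    · rw [log_exp, abs_sub_comm]; exact habs _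

lemma cst_congr {k h : ℝ} {u u' : ℝ → ℝ} {w : Path} (hu : ∀ s, 0 < s → u s = u' s) : cst p k h u w = cst p k h u' w :=
  setLIntegral_congr_fun measurableSet_Ioi fun _ ht =>
    run_congr ht (fun s hs _ => hu s hs) fun _ _ _ => rfl

variable {P : Measure Ω} {F : Filtration ℝ mΩ} {W : Ω → Path}

lemma Sys.shift0 (hS : Sys μ P F W) (ω : Ω) : HabitModel.shift 0 (W ω) = W ω := by
  ext1 t
  rw [shift_apply, hS.zero ω 0 le_rfl, sub_zero, zero_add]
  rcases le_total t 0 with h | h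
  · rw [max_eq_right h, hS.zero ω t h, hS.zero ω 0 le_rfl]
  · rw [max_eq_left h]

lemma Sys.lint (hS : Sys μ P F W) {s : ℝ} (hs : 0 ≤ s) {Y : Type*} [MeasurableSpace Y] {X : Ω → Y} (hX : Measurable[F s] X) {g : Y × Path → ℝ≥0∞} (hg : Measurable g) : ∫⁻ ω, g (X ω, HabitModel.shift s (W ω)) ∂P = ∫⁻ ω, ∫⁻ w, g (X ω, w) ∂μ ∂P := by
  have := hS.prob
  have hX' : Measurable X := hX.mono (F.le _) le_rfl
  have hm : Measurable fun ω => (X ω, HabitModel.shift s (W ω)) :=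
    hX'.prodMk (Meas.shift hS.measW measurable_const)
  rw [← lintegral_map hg hm, hS.markov_prod hs hX, lintegral_prod _ hg.aemeasurable, lintegral_map hg.lintegral_prod_right' hX']

lemma Sys.lint0 (hS : Sys μ P F W) {Y : Type*} [MeasurableSpace Y] {X : Ω → Y} (hX : Measurable[F 0] X) {g : Y × Path → ℝ≥0∞} (hg : Measurable g) : ∫⁻ ω, g (X ω, W ω) ∂P = ∫⁻ ω, ∫⁻ w, g (X ω, w) ∂μ ∂P := by
  rw [← hS.lint le_rfl hX hg]; simp only [hS.shift0]

lemma Sys.law [IsProbabilityMeasure P] (hS : Sys μ P F W) {g : Path → ℝ≥0∞} (hg : Measurable g) : ∫⁻ ω, g (W ω) ∂P = ∫⁻ w, g w ∂μ := by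
  have := hS.lint0 (X := fun _ => ()) measurable_const (g := fun q => g q.2) (hg.comp measurable_snd)
  simpa using this

lemma frz_shift {s t : ℝ} (ht : 0 ≤ t) {T : ℝ} (hT : s + t ≤ T) (w : Path) : frz t (shift s (frz T w)) = frz t (shift s w) := by
  ext1 r
  simp only [frz_apply, shift_apply]
  rw [min_eq_left (a := s + _), min_eq_left (a := s)]
  · linarith
  · have : max (min r t) 0 ≤ t := max_le (min_le_right _ _) ht
    linarith

lemma frz_frz {s t : ℝ} (h : s ≤ t) (w : Path) : frz s (frz t w) = frz s w := by
  ext1 r; simp only [frz_apply]; rw [min_eq_left (a := min r s)]; exact (min_le_right _ _).trans h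

lemma Kxc_frz (k : ℝ) (u : ℝ → ℝ) (w : Path) {s t : ℝ} (hs : 0 ≤ s) (h : s ≤ t) : Kx p k u (frz t w) s = Kx p k u w s :=
  Kx_congr hs (fun _ _ _ => rfl) (by simp [h])

lemma Hxc_frz (k h : ℝ) (u : ℝ → ℝ) (w : Path) {s t : ℝ} (hs : 0 ≤ s) (hst : s ≤ t) : Hx p k h u (frz t w) s = Hx p k h u w s :=
  Hx_congr hs (fun _ _ _ => rfl) (fun r _ hr => by simp [hr.trans hst])

variable (p) in
def zc (k h x δ : ℝ) (w : Path) : ℝ × ℝ := (Kx p k (fun _ => x) w δ, Hx p k h (fun _ => x) w δ)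

lemma zc_meas' {X : Type*} [MeasurableSpace X] {k h x : X → ℝ} {f : X → Path} (hk : Measurable k) (hh : Measurable h) (hx : Measurable x) (hf : Measurable f) (δ : ℝ) : Measurable fun y => zc p (k y) (h y) (x y) δ (f y) :=
  (meas_Kx (u := fun _ y => x y) (hx.comp measurable_snd) hf hk (measurable_const (a := δ))).prodMk
  (meas_Hx (u := fun _ y => x y) (hx.comp measurable_snd) hf hk hh (measurable_const (a := δ)))

variable (p μ) in
def qq (δ x k h : ℝ) : ℝ≥0∞ := ∫⁻ w, ((∫⁻ t in Ioc 0 δ, run p k h (fun _ => x) w t) + oR (rexp (-p.θ * δ)) * vv p μ (Kx p k (fun _ => x) w δ) (Hx p k h (fun _ => x) w δ)) ∂μ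

lemma ennreal_lim_le {A X : ℝ≥0∞} {c : ℝ} (h : ∀ δ : ℝ, 0 < δ → A ≤ oR (rexp (c * δ)) * (oR (rexp (c * δ)) * X + oR δ)) : A ≤ X := by
  rcases eq_or_ne X ∞ with hX | hX
  · simp [hX]
  have hcv : ∀ f : ℝ → ℝ, Continuous f → Tendsto (fun δ => oR (f δ)) (nhdsWithin 0 (Ioi 0)) (nhds (oR (f 0))) := fun f hf =>
    ((ENNReal.continuous_ofReal.comp hf).tendsto 0).mono_left nhdsWithin_le_nhds
  have h1 := hcv (fun δ => rexp (c * δ)) (by fun_prop)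
  have h2 := hcv (fun δ => δ) continuous_id
  have h3 := ENNReal.Tendsto.mul h1 (Or.inr (by finiteness)) ((ENNReal.Tendsto.mul_const h1 (b := X) (Or.inr hX)).add h2) (Or.inr (by finiteness))
  have h4 : A ≤ oR (rexp (c * 0)) * (oR (rexp (c * 0)) * X + oR 0) :=
    ge_of_tendsto h3 (Filter.eventually_of_mem self_mem_nhdsWithin fun δ hδ => h δ hδ)
  simpa using h4

variable (p μ) in
def HQ : Prop := ∀ δ x k h, 0 ≤ δ → 0 < x → x ≤ p.R → 0 < k → 0 < h → vv p μ k h ≤ qq p μ δ x k h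

lemma vv_le_qq [IsProbabilityMeasure P] (hS : Sys μ P F W) (hG : Gau μ) {δ x k h : ℝ} (hδ : 0 ≤ δ) (hx : 0 < x) (hx' : x ≤ p.R) (hk : 0 < k) (hh : 0 < h) : vv p μ k h ≤ qq p μ δ x k h := by
  have := hS.prob
  refine ennreal_lim_le (c := p.a + p.b) fun ε hε => ?_
  obtain ⟨Φ, hΦ, hle⟩ := exists_fam (p := p) hG hε
  obtain ⟨C, hC⟩ : ∃ C, C = oR (rexp ((p.a + p.b) * ε)) := ⟨_, rfl⟩
  rw [← hC] at hle ⊢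
  let ψ : ℝ → Path → ℝ := fun t w => if t ≤ δ then x else Φ (zc p k h x δ w) (t - δ) (shift δ w)
  have hzm : Measurable (zc p k h x δ) :=
    zc_meas' measurable_const measurable_const measurable_const measurable_id δ
  have hok := OkU.const (p := p) hx hx'
  have hzpos : ∀ w, 0 < (zc p k h x δ w).1 ∧ 0 < (zc p k h x δ w).2 := fun w =>
    ⟨Kx_pos hk _ _ _, Hx_pos hk hh hok _ hδ⟩
  have hψ : Can p ψ := by
    refine ⟨?_, fun t w => ?_, fun t w => ?_, fun t w => ?_⟩
    · refine Measurable.ite (measurableSet_le measurable_fst measurable_const) measurable_const ?_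
      exact hΦ.meas.comp ((hzm.comp measurable_snd).prodMk ((measurable_fst.sub_const δ).prodMk (Meas.shift measurable_snd measurable_const)))
    · simp only [ψ]; split_ifs
      exacts [hx, (hΦ.can _).pos _ _]
    · simp only [ψ]; split_ifs
      exacts [hx', (hΦ.can _).le _ _]
    · simp only [ψ]; split_ifs with ht
      · rfl
      · push Not at ht
        have h1 : zc p k h x δ (frz (max t 0) w) = zc p k h x δ w := by
          unfold zc; rw [Kxc_frz _ _ _ hδ (ht.le.trans (le_max_left _ _)), Hxc_frz _ _ _ _ hδ (ht.le.trans (le_max_left _ _))]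
        rw [h1, (hΦ.can _).nonant, (hΦ.can _).nonant _ (shift δ (frz _ w)), frz_shift]
        · exact le_max_right _ _
        · rw [max_eq_left (by linarith : 0 ≤ t - δ)]; linarith [le_max_left t 0]
  have hsp : ∀ w, cst p k h (fun t => ψ t w) w = (∫⁻ t in Ioc 0 δ, run p k h (fun _ => x) w t) + oR (rexp (-p.θ * δ)) * gF p Φ (zc p k h x δ w, shift δ w) := by
    intro w
    have e0 : ∀ s, 0 < s → s ≤ δ → ψ s w = x := fun s _ hs => if_pos hs
    rw [cst_split k h (hψ.ok w) w hδ]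
    congr 1
    · exact setLIntegral_congr_fun measurableSet_Ioc fun t ht =>
        run_congr ht.1 (fun s hs hs' => e0 s hs (hs'.trans ht.2)) fun _ _ _ => rfl
    · rw [Kx_congr (u' := fun _ => x) (w' := w) hδ e0 rfl, Hx_congr (u' := fun _ => x) (w' := w) hδ e0 fun _ _ _ => rfl]
      congr 1
      refine cst_congr fun s hs => ?_
      simp only [ψ]
      rw [if_neg (by linarith), add_sub_cancel_left]
  have hA : Measurable fun w => ∫⁻ t in Ioc 0 δ, run p k h (fun _ => x) w t :=
    meas_runset (X := Path) (u := fun _ _ => x) measurable_const measurable_id (K := fun _ => k)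
      measurable_const (H := fun _ => h) measurable_const (D := fun _ => Ioc 0 δ)
      (measurable_snd measurableSet_Ioc)
  have hvm : Measurable fun w => vv p μ (zc p k h x δ w).1 (zc p k h x δ w).2 := vv_meas.comp hzm
  have hind : ∫⁻ w, gF p Φ (zc p k h x δ w, shift δ w) ∂μ ≤ ∫⁻ w, C * (C * vv p μ (zc p k h x δ w).1 (zc p k h x δ w).2 + oR ε) ∂μ := by
    have m1 : Measurable fun w => gF p Φ (zc p k h x δ w, shift δ w) :=
      hΦ.gmeas.comp (hzm.prodMk (Meas.shift measurable_id measurable_const))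
    rw [← hS.law m1, ← hS.law (((hvm.const_mul C).add_const _).const_mul C)]
    have hX : Measurable[F δ] fun ω => zc p k h x δ (W ω) := by
      have : (fun ω => zc p k h x δ (W ω)) = fun ω => zc p k h x δ (frz δ (W ω)) := by
        funext ω; unfold zc; rw [Kxc_frz _ _ _ hδ le_rfl, Hxc_frz _ _ _ _ hδ le_rfl]
      rw [this]
      exact hzm.comp (hS.frzF hδ)
    rw [hS.lint hδ hX hΦ.gmeas]
    exact lintegral_mono fun ω => hle _ (hzpos _).1 (hzpos _).2
  refine (vv_le hψ hk hh).trans ?_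
  simp only [hsp]
  rw [lintegral_add_left hA, lintegral_const_mul' _ _ ofReal_ne_top]
  refine (add_le_add_right (mul_le_mul_right hind _) _).trans ?_
  have hD : oR (rexp (-p.θ * δ)) ≤ 1 := by
    rw [ofReal_le_one]; exact exp_le_one_iff.2 (by nlinarith [p.hθ])
  have hC1 : 1 ≤ C := by
    rw [hC, ENNReal.one_le_ofReal]; exact Real.one_le_exp (by nlinarith [p.ha, p.hb])
  have hCt : C ≠ ∞ := hC ▸ ofReal_ne_top
  rw [qq, lintegral_add_left hA, lintegral_const_mul' _ _ hCt, lintegral_const_mul' _ _ ofReal_ne_top, lintegral_add_left (hvm.const_mul C), lintegral_const_mul' _ _ hCt, lintegral_const, measure_univ, mul_one]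
  set I := ∫⁻ w, vv p μ (zc p k h x δ w).1 (zc p k h x δ w).2 ∂μ
  set A := ∫⁻ w, (∫⁻ t in Ioc 0 δ, run p k h (fun _ => x) w t) ∂μ
  set D := oR (rexp (-p.θ * δ))
  change A + D * (C * (C * I + _)) ≤ C * (C * (A + D * I) + _)
  have hAC : A ≤ C * (C * A) := (le_mul_of_one_le_left' hC1).trans (mul_le_mul_right (le_mul_of_one_le_left' hC1) _)
  calc A + D * (C * (C * I + oR ε)) = A + (C * (C * (D * I)) + D * (C * oR ε)) := by ring
    _ ≤ C * (C * A) + (C * (C * (D * I)) + 1 * (C * oR ε)) := by gcongr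
    _ = _ := by ring

end canon

end

section

section piecewise

variable {p : Par} {μ : Measure Path} {P : Measure Ω} {F : Filtration ℝ mΩ} {W : Ω → Path}

def idx (δ t : ℝ) : ℕ := ⌈t / δ⌉₊ - 1

lemma idx_of_le {δ t : ℝ} (hδ : 0 < δ) (h : t ≤ δ) : idx δ t = 0 := by
  unfold idx
  have : ⌈t / δ⌉₊ ≤ 1 := by
    rw [Nat.ceil_le, Nat.cast_one, div_le_one hδ]; exact h
  omega

lemma idx_add {δ t : ℝ} (hδ : 0 < δ) (h : 0 < t) : idx δ (δ + t) = idx δ t + 1 := by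
  unfold idx
  have h1 : ⌈(δ + t) / δ⌉₊ = ⌈t / δ⌉₊ + 1 := by
    rw [add_div, div_self hδ.ne', add_comm, Nat.ceil_add_one (by positivity)]
  have h2 : 0 < ⌈t / δ⌉₊ := Nat.ceil_pos.2 (by positivity)
  omega

lemma idx_meas (δ : ℝ) : Measurable (idx δ) := by
  unfold idx
  exact measurable_from_nat (f := fun n => n - 1) |>.comp (Nat.measurable_ceil.comp (measurable_id.div_const δ))

lemma pc_meas {δ : ℝ} {d : ℕ → Ω → ℝ} (hd : ∀ j, Measurable (d j)) : Measurable fun q : ℝ × Ω => d (idx δ q.1) q.2 := by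
  have h1 : Measurable fun q : ℕ × Ω => d q.1 q.2 := measurable_from_prod_countable_right hd
  exact h1.comp (((idx_meas δ).comp measurable_fst).prodMk measurable_snd)

variable (p μ) in
def gQ (δ : ℝ) (q : (ℝ × ℝ × ℝ) × Path) : ℝ≥0∞ :=
  (∫⁻ t in Ioc 0 δ, run p q.1.1 q.1.2.1 (fun _ => q.1.2.2) q.2 t) +
  oR (rexp (-p.θ * δ)) * vv p μ (Kx p q.1.1 (fun _ => q.1.2.2) q.2 δ) (Hx p q.1.1 q.1.2.1 (fun _ => q.1.2.2) q.2 δ)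

lemma gQ_meas (δ : ℝ) : Measurable (gQ p μ δ) := by
  have m1 : Measurable fun q : (ℝ × ℝ × ℝ) × Path => q.1.1 := by fun_prop
  have m2 : Measurable fun q : (ℝ × ℝ × ℝ) × Path => q.1.2.1 := by fun_prop
  have m3 : Measurable fun q : (ℝ × ℝ × ℝ) × Path => q.1.2.2 := by fun_prop
  have a1 : Measurable fun q : (ℝ × ℝ × ℝ) × Path =>
      ∫⁻ t in Ioc 0 δ, run p q.1.1 q.1.2.1 (fun _ => q.1.2.2) q.2 t := by
    exact meas_runset (X := (ℝ × ℝ × ℝ) × Path) (u := fun _ q => q.1.2.2) (m3.comp measurable_snd)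
      measurable_snd m1 m2 (D := fun _ => Ioc 0 δ) (measurable_snd measurableSet_Ioc)
  have h : Measurable fun q : (ℝ × ℝ × ℝ) × Path => ((Kx p q.1.1 (fun _ => q.1.2.2) q.2 δ, Hx p q.1.1 q.1.2.1 (fun _ => q.1.2.2) q.2 δ) : ℝ × ℝ) := zc_meas' m1 m2 m3 measurable_snd δ
  have a2 : Measurable fun q : (ℝ × ℝ × ℝ) × Path => vv p μ (Kx p q.1.1 (fun _ => q.1.2.2) q.2 δ) (Hx p q.1.1 q.1.2.1 (fun _ => q.1.2.2) q.2 δ) :=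
    by have := (vv_meas (p := p) (μ := μ)).comp h
       exact this
  exact a1.add (a2.const_mul _)

lemma F1 (hq : HQ p μ) {δ x₀ : ℝ} (hδ : 0 < δ) (J : ℕ) : ∀ {F : Filtration ℝ mΩ} {W : Ω → Path} (hS : Sys μ P F W) {K H : Ω → ℝ} (hK : Measurable[F 0] K) (hH : Measurable[F 0] H) (hK0 : ∀ ω, 0 < K ω) (hH0 : ∀ ω, 0 < H ω) {d : ℕ → Ω → ℝ} (hd : ∀ j : ℕ, Measurable[F (j * δ)] (d j)) (hd0 : ∀ j ω, 0 < d j ω) (hdR : ∀ j ω, d j ω ≤ p.R) (hJ : ∀ j, J ≤ j → ∀ ω, d j ω = x₀), ∫⁻ ω, vv p μ (K ω) (H ω) ∂P ≤ ∫⁻ ω, cst p (K ω) (H ω) (fun t => d (idx δ t) ω) (W ω) ∂P := by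
  induction J with
  | zero =>
    intro F W hS K H hK hH hK0 hH0 d hd hd0 hdR hJ
    have e : ∀ ω, (fun t => d (idx δ t) ω) = fun _ => x₀ := fun ω => funext fun t => hJ _ (Nat.zero_le _) ω
    simp only [e]
    rcases isEmpty_or_nonempty Ω with hE | ⟨⟨ω₀⟩⟩
    · simp
    have hx : 0 < x₀ := hJ 0 le_rfl ω₀ ▸ hd0 0 ω₀
    have hx' : x₀ ≤ p.R := hJ 0 le_rfl ω₀ ▸ hdR 0 ω₀
    have := hS.lint0 (X := fun ω => (K ω, H ω)) (Measurable.prodMk hK hH) (Fam.const (p := p) hx hx').gmeas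
    simp only [gF] at this
    rw [this]
    exact lintegral_mono fun ω => vv_le (Can.const hx hx') (hK0 ω) (hH0 ω)
  | succ J ih =>
    intro F W hS K H hK hH hK0 hH0 d hd hd0 hdR hJ
    have hd' : ∀ j, Measurable (d j) := fun j => (hd j).mono (F.le _) le_rfl
    have hok : ∀ ω, OkU p (fun t => d (idx δ t) ω) := fun ω =>
      ⟨(pc_meas (δ := δ) hd').comp measurable_prodMk_right, fun t => hd0 _ ω, fun t => hdR _ ω⟩
    have hok0 : ∀ ω, OkU p (fun _ => d 0 ω) := fun ω => OkU.const (hd0 0 ω) (hdR 0 ω)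
    have hd00 : Measurable[F 0] (d 0) := by
      have := hd 0
      rwa [Nat.cast_zero, zero_mul] at this
    have hcg : ∀ ω s, 0 < s → s ≤ δ → d (idx δ s) ω = d 0 ω := fun ω s _ hs => by rw [idx_of_le hδ hs]
    have hz : Measurable[F δ] fun ω => zc p (K ω) (H ω) (d 0 ω) δ (frz δ (W ω)) :=
      @zc_meas' p Ω (F δ) _ _ _ _ (hK.mono (F.mono hδ.le) le_rfl) (hH.mono (F.mono hδ.le) le_rfl) (hd00.mono (F.mono hδ.le) le_rfl) (hS.frzF hδ.le) δ
    have hKe : ∀ ω, Kx p (K ω) (fun t => d (idx δ t) ω) (W ω) δ = Kx p (K ω) (fun _ => d 0 ω) (W ω) δ :=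
      fun ω => Kx_congr hδ.le (hcg ω) rfl
    have hHe : ∀ ω, Hx p (K ω) (H ω) (fun t => d (idx δ t) ω) (W ω) δ = Hx p (K ω) (H ω) (fun _ => d 0 ω) (W ω) δ :=
      fun ω => Hx_congr hδ.le (hcg ω) fun _ _ _ => rfl
    have hKm : Measurable[F δ] fun ω => Kx p (K ω) (fun _ => d 0 ω) (W ω) δ := by
      have e : (fun ω => Kx p (K ω) (fun _ => d 0 ω) (W ω) δ) = fun ω => (zc p (K ω) (H ω) (d 0 ω) δ (frz δ (W ω))).1 :=
        funext fun ω => (Kxc_frz _ _ _ hδ.le le_rfl).symm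
      rw [e]; exact measurable_fst.comp hz
    have hHm : Measurable[F δ] fun ω => Hx p (K ω) (H ω) (fun _ => d 0 ω) (W ω) δ := by
      have e : (fun ω => Hx p (K ω) (H ω) (fun _ => d 0 ω) (W ω) δ) = fun ω => (zc p (K ω) (H ω) (d 0 ω) δ (frz δ (W ω))).2 :=
        funext fun ω => (Hxc_frz _ _ _ _ hδ.le le_rfl).symm
      rw [e]; exact measurable_snd.comp hz
    have h1 := ih (hS.shift hδ.le) (K := fun ω => Kx p (K ω) (fun _ => d 0 ω) (W ω) δ) (H := fun ω => Hx p (K ω) (H ω) (fun _ => d 0 ω) (W ω) δ) (by change Measurable[F (δ + 0)] _; rwa [add_zero]) (by change Measurable[F (δ + 0)] _; rwa [add_zero]) (fun ω => Kx_pos (hK0 ω) _ _ _) (fun ω => Hx_pos (hK0 ω) (hH0 ω) (hok0 ω) _ hδ.le) (d := fun j => d (j + 1)) (fun j => by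
        have := hd (j + 1)
        have e : ((j + 1 : ℕ) : ℝ) * δ = δ + j * δ := by push_cast; ring
        rw [e] at this; exact this) (fun j => hd0 _) (fun j => hdR _) (fun j hj => hJ _ (by omega))
    have hsp : ∀ ω, cst p (K ω) (H ω) (fun t => d (idx δ t) ω) (W ω) = (∫⁻ t in Ioc 0 δ, run p (K ω) (H ω) (fun _ => d 0 ω) (W ω) t) + oR (rexp (-p.θ * δ)) * cst p (Kx p (K ω) (fun _ => d 0 ω) (W ω) δ) (Hx p (K ω) (H ω) (fun _ => d 0 ω) (W ω) δ) (fun t => d (idx δ t + 1) ω) (shift δ (W ω)) := by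
      intro ω
      rw [cst_split _ _ (hok ω) _ hδ.le, hKe, hHe]
      congr 1
      · exact setLIntegral_congr_fun measurableSet_Ioc fun t ht =>
          run_congr ht.1 (fun s hs hs' => hcg ω s hs (hs'.trans ht.2)) fun _ _ _ => rfl
      · congr 1
        exact cst_congr fun s hs => by rw [idx_add hδ hs]
    simp only [hsp]
    have hK' : Measurable K := hK.mono (F.le _) le_rfl
    have hH' : Measurable H := hH.mono (F.le _) le_rfl
    have hA : Measurable fun ω => ∫⁻ t in Ioc 0 δ, run p (K ω) (H ω) (fun _ => d 0 ω) (W ω) t :=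
      meas_runset (u := fun _ ω => d 0 ω) ((hd' 0).comp measurable_snd) hS.measW hK' hH' (D := fun _ => Ioc 0 δ) (measurable_snd measurableSet_Ioc)
    rw [lintegral_add_left hA, lintegral_const_mul' _ _ ofReal_ne_top]
    refine le_trans ?_ (add_le_add_right (mul_le_mul_right h1 _) _)
    rw [← lintegral_const_mul' _ _ ofReal_ne_top, ← lintegral_add_left hA]
    have h2 := hS.lint0 (X := fun ω => (K ω, H ω, d 0 ω)) (Measurable.prodMk hK (Measurable.prodMk hH hd00)) (gQ_meas (p := p) (μ := μ) δ)
    change _ ≤ ∫⁻ ω, gQ p μ δ ((K ω, H ω, d 0 ω), W ω) ∂P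
    rw [h2]
    exact lintegral_mono fun ω => hq δ _ _ _ hδ.le (hd0 0 ω) (hdR 0 ω) (hK0 ω) (hH0 ω)

end piecewise

end

section

section paste

variable {p : Par} {μ : Measure Path} {P : Measure Ω} {F : Filtration ℝ mΩ} {W : Ω → Path}

variable (p) in
structure Ctl (F : Filtration ℝ mΩ) (u : ℝ → Ω → ℝ) : Prop where
  prog : ∀ t, 0 ≤ t → @Measurable (ℝ × Ω) ℝ (@Prod.instMeasurableSpace ℝ Ω _ (F t)) _ (fun q => u (min q.1 t) q.2)
  pos : ∀ t ω, 0 < u t ω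
  le : ∀ t ω, u t ω ≤ p.R

lemma prodF_le (F : Filtration ℝ mΩ) (t : ℝ) : @Prod.instMeasurableSpace ℝ Ω _ (F t) ≤ Prod.instMeasurableSpace :=
  sup_le_sup le_rfl (MeasurableSpace.comap_mono (F.le t))

lemma Ctl.meas {u : ℝ → Ω → ℝ} (hu : Ctl p F u) : Measurable fun q : ℝ × Ω => u q.1 q.2 := by
  refine measurable_of_tendsto_metrizable (f := fun (n : ℕ) (q : ℝ × Ω) => u (min q.1 n) q.2) (fun n => (hu.prog n (Nat.cast_nonneg n)).mono (prodF_le F n) le_rfl) ?_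
  rw [tendsto_pi_nhds]
  intro q
  refine tendsto_const_nhds.congr' ?_
  obtain ⟨n, hn⟩ := exists_nat_ge q.1
  filter_upwards [Filter.eventually_ge_atTop n] with m hm
  rw [min_eq_left]; exact hn.trans (by exact_mod_cast hm)

lemma Ctl.ok {u : ℝ → Ω → ℝ} (hu : Ctl p F u) (ω : Ω) : OkU p (u · ω) :=
  ⟨hu.meas.comp measurable_prodMk_right, fun t => hu.pos t ω, fun t => hu.le t ω⟩

lemma Ctl.shift {u : ℝ → Ω → ℝ} (hu : Ctl p F u) {s : ℝ} (hs : 0 ≤ s) : Ctl p (shiftF F s) (fun t => u (s + t)) := by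
  refine ⟨fun t ht => ?_, fun t ω => hu.pos _ ω, fun t ω => hu.le _ ω⟩
  have h1 := hu.prog (s + t) (by linarith)
  have h2 : @Measurable (ℝ × Ω) (ℝ × Ω) (@Prod.instMeasurableSpace ℝ Ω _ (F (s + t))) (@Prod.instMeasurableSpace ℝ Ω _ (F (s + t))) (fun q => (s + q.1, q.2)) :=
    Measurable.prodMk ((@measurable_fst ℝ Ω _ (F (s + t))).const_add s) (@measurable_snd ℝ Ω _ (F (s + t)))
  have h3 := h1.comp h2
  have e : (fun q : ℝ × Ω => u (s + min q.1 t) q.2) = (fun q : ℝ × Ω => u (min q.1 (s + t)) q.2) ∘ (fun q : ℝ × Ω => (s + q.1, q.2)) := by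
    funext q; simp only [Function.comp]; rw [min_add_add_left]
  change @Measurable (ℝ × Ω) ℝ (@Prod.instMeasurableSpace ℝ Ω _ (F (s + t))) _ _
  rw [e]; exact h3

variable {u : ℝ → Ω → ℝ} {K H : Ω → ℝ}

lemma Kx_min (k : ℝ) (u : ℝ → ℝ) (w : Path) {s t : ℝ} (hs : 0 ≤ s) (hst : s ≤ t) : Kx p k (fun r => u (min r t)) (frz t w) s = Kx p k u w s :=
  Kx_congr hs (fun r _ hr => by simp only [min_eq_left (hr.trans hst)]) (by simp [hst])

lemma Hx_min (k h : ℝ) (u : ℝ → ℝ) (w : Path) {s t : ℝ} (hs : 0 ≤ s) (hst : s ≤ t) : Hx p k h (fun r => u (min r t)) (frz t w) s = Hx p k h u w s :=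
  Hx_congr hs (fun r _ hr => by simp only [min_eq_left (hr.trans hst)]) (fun r _ hr => by simp [hr.trans hst])

variable (p) in
def zz (K H : Ω → ℝ) (u : ℝ → Ω → ℝ) (W : Ω → Path) (s : ℝ) (ω : Ω) : ℝ × ℝ :=
  (Kx p (K ω) (u · ω) (W ω) s, Hx p (K ω) (H ω) (u · ω) (W ω) s)

lemma Ctl.zF (hu : Ctl p F u) (hS : Sys μ P F W) (hK : Measurable[F 0] K) (hH : Measurable[F 0] H) {t : ℝ} (ht : 0 ≤ t) {s : Ω → ℝ} (hs : Measurable[F t] s) (hs0 : ∀ ω, 0 ≤ s ω) (hst : ∀ ω, s ω ≤ t) : Measurable[F t] fun ω => zz p K H u W (s ω) ω := by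
  have hK' := hK.mono (F.mono ht) le_rfl
  have hH' := hH.mono (F.mono ht) le_rfl
  have h1 := @meas_Kx Ω (F t) p (fun r ω => u (min r t) ω) (hu.prog t ht) (fun ω => frz t (W ω)) (hS.frzF ht) K s hK' hs
  have h2 := @meas_Hx Ω (F t) p (fun r ω => u (min r t) ω) (hu.prog t ht) (fun ω => frz t (W ω)) (hS.frzF ht) K H s hK' hH' hs
  have h3 := Measurable.prodMk h1 h2
  have e : (fun ω => zz p K H u W (s ω) ω) = fun ω =>
      (Kx p (K ω) (fun r => u (min r t) ω) (frz t (W ω)) (s ω), Hx p (K ω) (H ω) (fun r => u (min r t) ω) (frz t (W ω)) (s ω)) := by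
    funext ω
    unfold zz
    rw [Kx_min _ (u · ω) _ (hs0 ω) (hst ω), Hx_min _ _ (u · ω) _ (hs0 ω) (hst ω)]
  rw [e]; exact h3

lemma zz_pos (hu : Ctl p F u) (hK0 : ∀ ω, 0 < K ω) (hH0 : ∀ ω, 0 < H ω) {s : ℝ} (hs : 0 ≤ s) (ω : Ω) : 0 < (zz p K H u W s ω).1 ∧ 0 < (zz p K H u W s ω).2 :=
  ⟨Kx_pos (hK0 ω) _ _ _, Hx_pos (hK0 ω) (hH0 ω) (hu.ok ω) _ hs⟩

variable {τ : Ω → ℝ≥0∞}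

lemma tau_min (hτ : IsStoppingTimeE F τ) {t : ℝ} (ht : 0 ≤ t) : Measurable[F t] fun ω => min (τ ω) (oR t) := by
  refine @measurable_of_Iic _ _ _ _ _ (F t) _ _ _ _ fun x => ?_
  rcases le_or_gt (oR t) x with h | h
  · convert MeasurableSet.univ
    ext ω; simp [h]
  · have hx : x ≠ ∞ := h.ne_top
    have h1 := hτ x.toReal toReal_nonneg
    rw [ENNReal.ofReal_toReal hx] at h1
    have h2 : x.toReal ≤ t := by
      rw [← ENNReal.toReal_ofReal ht]; exact ENNReal.toReal_mono ofReal_ne_top h.le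
    convert F.mono h2 _ h1 using 1
    ext ω; simp [h.not_ge]

lemma tau_meas (hτ : IsStoppingTimeE F τ) : Measurable τ := by
  refine measurable_of_Iic fun x => ?_
  rcases eq_or_ne x ∞ with h | h
  · simp [h]
  · have h1 := hτ x.toReal toReal_nonneg
    rw [ENNReal.ofReal_toReal h] at h1
    exact F.le _ _ h1

lemma tt_meas (hτ : IsStoppingTimeE F τ) {t : ℝ} (ht : 0 ≤ t) : Measurable[F t] fun ω => (min (τ ω) (oR t)).toReal :=
  ENNReal.measurable_toReal.comp (tau_min hτ ht)

lemma tt_le {t : ℝ} (ht : 0 ≤ t) (ω : Ω) : (min (τ ω) (oR t)).toReal ≤ t := by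
  conv_rhs => rw [← ENNReal.toReal_ofReal ht]
  exact ENNReal.toReal_mono ofReal_ne_top (min_le_right _ _)

lemma zz_T_meas (hu : Ctl p F u) (hS : Sys μ P F W) (hK : Measurable[F 0] K) (hH : Measurable[F 0] H) (hτ : IsStoppingTimeE F τ) : Measurable fun ω => zz p K H u W (τ ω).toReal ω := by
  have h1 := meas_Kx (p := p) hu.meas hS.measW (hK.mono (F.le _) le_rfl) (tau_meas hτ).ennreal_toReal
  have h2 := meas_Hx (p := p) hu.meas hS.measW (hK.mono (F.le _) le_rfl) (hH.mono (F.le _) le_rfl) (tau_meas hτ).ennreal_toReal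
  exact h1.prodMk h2

lemma lintS (hu : Ctl p F u) (hS : Sys μ P F W) (hK : Measurable[F 0] K) (hH : Measurable[F 0] H) (hτ : IsStoppingTimeE F τ) {g : (ℝ × (ℝ × ℝ)) × Path → ℝ≥0∞} (hg : Measurable g) : ∫⁻ ω in {ω | τ ω ≠ ∞}, g (((τ ω).toReal, zz p K H u W (τ ω).toReal ω), HabitModel.shift (τ ω).toReal (W ω)) ∂P = ∫⁻ ω in {ω | τ ω ≠ ∞}, ∫⁻ w, g (((τ ω).toReal, zz p K H u W (τ ω).toReal ω), w) ∂μ ∂P := by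
  have := hS.prob
  have hT : Measurable fun ω => (τ ω).toReal := (tau_meas hτ).ennreal_toReal
  have hX : Measurable fun ω => ((τ ω).toReal, zz p K H u W (τ ω).toReal ω) :=
    hT.prodMk (zz_T_meas hu hS hK hH hτ)
  have hm : Measurable fun ω => (((τ ω).toReal, zz p K H u W (τ ω).toReal ω), HabitModel.shift (τ ω).toReal (W ω)) := hX.prodMk (Meas.shift hS.measW hT)
  have key := hS.sm_prod (A := {ω | τ ω ≠ ∞}) hT (fun _ _ => toReal_nonneg) hX ?_
  · refine (lintegral_map hg hm).symm.trans ?_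
    rw [key, lintegral_prod _ hg.aemeasurable, lintegral_map hg.lintegral_prod_right' hX]
  · intro D hD t ht
    have h1 : Measurable[F t] fun ω => ((min (τ ω) (oR t)).toReal, zz p K H u W (min (τ ω) (oR t)).toReal ω) :=
      Measurable.prodMk (tt_meas hτ ht) (hu.zF hS hK hH ht (tt_meas hτ ht) (fun _ => toReal_nonneg) (tt_le ht))
    have h2 := (hτ t ht).inter (h1 hD)
    convert h2 using 1
    ext ω
    simp only [mem_inter_iff, mem_setOf_eq, mem_preimage]
    constructor
    · rintro ⟨⟨h3, h4⟩, h5⟩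
      have h6 : τ ω ≤ oR t := by
        rw [← ENNReal.ofReal_toReal h3]; exact ofReal_le_ofReal h5
      rw [min_eq_left h6]; exact ⟨h6, h4⟩
    · rintro ⟨h3, h4⟩
      rw [min_eq_left h3] at h4
      have h5 : τ ω ≠ ∞ := (h3.trans_lt ofReal_lt_top).ne
      exact ⟨⟨h5, h4⟩, by
        rw [← ENNReal.toReal_ofReal ht]; exact ENNReal.toReal_mono ofReal_ne_top h3⟩

variable (p) in
def pu (K H : Ω → ℝ) (u : ℝ → Ω → ℝ) (W : Ω → Path) (τ : Ω → ℝ≥0∞) (Φ : ℝ × ℝ → ℝ → Path → ℝ) (t : ℝ) (ω : Ω) : ℝ :=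
  if τ ω < oR t then
    Φ (zz p K H u W (τ ω).toReal ω) (t - (τ ω).toReal) (shift (τ ω).toReal (W ω)) else u t ω

variable {Φ : ℝ × ℝ → ℝ → Path → ℝ}

lemma pu_ctl (hu : Ctl p F u) (hS : Sys μ P F W) (hK : Measurable[F 0] K) (hH : Measurable[F 0] H) (hτ : IsStoppingTimeE F τ) (hΦ : Fam p Φ) : Ctl p F (pu p K H u W τ Φ) := by
  refine ⟨fun t ht => ?_, fun t ω => ?_, fun t ω => ?_⟩
  · set S : Ω → ℝ := fun ω => (min (τ ω) (oR t)).toReal with hSd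
    have hSm : Measurable[F t] S := tt_meas hτ ht
    have e : (fun q : ℝ × Ω => pu p K H u W τ Φ (min q.1 t) q.2) = fun q : ℝ × Ω =>
        if min (τ q.2) (oR t) < oR (min q.1 t) then
          Φ (zz p K H u W (S q.2) q.2) (min q.1 t - S q.2) (HabitModel.shift (S q.2) (frz t (W q.2)))
        else u (min q.1 t) q.2 := by
      funext ⟨r, ω⟩
      simp only [pu]
      set r' := min r t
      have hr : r' ≤ t := min_le_right _ _
      have hr' : oR r' ≤ oR t := ofReal_le_ofReal hr
      by_cases h : τ ω < oR r'
      · have h1 : min (τ ω) (oR t) = τ ω := min_eq_left (h.le.trans hr')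
        have h3 : (τ ω).toReal < r' := by
          have := (ENNReal.lt_ofReal_iff_toReal_lt h.ne_top).1 h
          exact this
        simp only [hSd, h1, h, if_true]
        rw [(hΦ.can _).nonant, (hΦ.can _).nonant _ (HabitModel.shift _ (frz _ _)), frz_shift]
        · exact le_max_right _ _
        · rw [max_eq_left (by linarith)]; linarith
      · rw [if_neg h, if_neg]
        rw [min_lt_iff]; push Not; exact ⟨not_lt.1 h, hr'⟩
    rw [e]
    have mf : @Measurable (ℝ × Ω) ℝ (@Prod.instMeasurableSpace ℝ Ω _ (F t)) _ Prod.fst :=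
      @measurable_fst ℝ Ω _ (F t)
    have ms : @Measurable (ℝ × Ω) Ω (@Prod.instMeasurableSpace ℝ Ω _ (F t)) (F t) Prod.snd :=
      @measurable_snd ℝ Ω _ (F t)
    have mr := mf.min (@measurable_const _ _ _ (@Prod.instMeasurableSpace ℝ Ω _ (F t)) t)
    have mz := hu.zF hS hK hH ht hSm (fun _ => toReal_nonneg) (tt_le ht)
    have mS := hSm.comp ms
    have msh := @Meas.shift Ω (F t) _ _ (hS.frzF ht) hSm
    refine Measurable.ite ?_ ?_ (hu.prog t ht)
    · exact measurableSet_lt ((tau_min hτ ht).comp ms) (measurable_ofReal.comp mr)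
    · exact hΦ.meas.comp (Measurable.prodMk (mz.comp ms) (Measurable.prodMk (mr.sub mS) (msh.comp ms)))
  · simp only [pu]; split_ifs; exacts [(hΦ.can _).pos _ _, hu.pos _ _]
  · simp only [pu]; split_ifs; exacts [(hΦ.can _).le _ _, hu.le _ _]

def pre (τ : ℝ≥0∞) : Set ℝ := {t : ℝ | 0 < t ∧ oR t < τ}

lemma pre_top : pre ∞ = Ioi 0 := by ext; simp [pre]

lemma pre_fin {x : ℝ≥0∞} (h : x ≠ ∞) : pre x = Ioo 0 x.toReal := by
  ext t; simp only [pre, mem_setOf_eq, mem_Ioo]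
  refine and_congr_right fun ht => ?_
  rw [ENNReal.ofReal_lt_iff_lt_toReal ht.le h]

lemma pre_int {x : ℝ≥0∞} (h : x ≠ ∞) (f : ℝ → ℝ≥0∞) : ∫⁻ t in pre x, f t = ∫⁻ t in Ioc 0 x.toReal, f t := by
  rw [pre_fin h]; exact setLIntegral_congr Ioo_ae_eq_Ioc

lemma pre_meas (hτ : Measurable τ) : MeasurableSet {q : Ω × ℝ | q.2 ∈ pre (τ q.1)} := by
  exact (measurableSet_lt measurable_const measurable_snd).inter (measurableSet_lt (measurable_ofReal.comp measurable_snd) (hτ.comp measurable_fst))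

lemma pu_split (hu : Ctl p F u) (hp : Ctl p F (pu p K H u W τ Φ)) (ω : Ω) : cst p (K ω) (H ω) (fun t => pu p K H u W τ Φ t ω) (W ω) = (∫⁻ t in pre (τ ω), run p (K ω) (H ω) (u · ω) (W ω) t) + {ω | τ ω ≠ ∞}.indicator (fun ω => oR (rexp (-p.θ * (τ ω).toReal)) * gF p Φ (zz p K H u W (τ ω).toReal ω, shift (τ ω).toReal (W ω))) ω := by
  by_cases h : τ ω = ∞
  · rw [indicator_of_notMem (by simpa using h), add_zero, h, pre_top]
    exact cst_congr fun s hs => by simp [pu, h]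
  · rw [indicator_of_mem (by exact h), pre_int h]
    have hT : 0 ≤ (τ ω).toReal := toReal_nonneg
    have e0 : ∀ s, 0 < s → s ≤ (τ ω).toReal → pu p K H u W τ Φ s ω = u s ω := fun s hs hs' => by
      unfold pu; rw [if_neg]
      rw [not_lt]; exact (ENNReal.ofReal_le_iff_le_toReal h).2 hs'
    rw [cst_split _ _ (hp.ok ω) _ hT]
    congr 1
    · exact setLIntegral_congr_fun measurableSet_Ioc fun t ht =>
        run_congr ht.1 (fun s hs hs' => e0 s hs (hs'.trans ht.2)) fun _ _ _ => rfl
    · rw [Kx_congr (u' := fun t => u t ω) (w' := W ω) hT e0 rfl, Hx_congr (u' := fun t => u t ω) (w' := W ω) hT e0 fun _ _ _ => rfl]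
      congr 1
      refine cst_congr fun s hs => ?_
      simp only [pu]
      rw [if_pos, add_sub_cancel_left]
      · rw [ENNReal.lt_ofReal_iff_toReal_lt h]; linarith

lemma paste_cost (hu : Ctl p F u) (hS : Sys μ P F W) (hK : Measurable[F 0] K) (hH : Measurable[F 0] H) (hτ : IsStoppingTimeE F τ) (hΦ : Fam p Φ) : ∫⁻ ω, cst p (K ω) (H ω) (fun t => pu p K H u W τ Φ t ω) (W ω) ∂P = (∫⁻ ω, (∫⁻ t in pre (τ ω), run p (K ω) (H ω) (u · ω) (W ω) t) ∂P) + ∫⁻ ω in {ω | τ ω ≠ ∞}, oR (rexp (-p.θ * (τ ω).toReal)) * ∫⁻ w, gF p Φ (zz p K H u W (τ ω).toReal ω, w) ∂μ ∂P := by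
  have hp := pu_ctl hu hS hK hH hτ hΦ
  simp only [pu_split hu hp]
  have hD := meas_runset (p := p) hu.meas hS.measW (hK.mono (F.le _) le_rfl) (hH.mono (F.le _) le_rfl) (D := fun ω => pre (τ ω)) (pre_meas (tau_meas hτ))
  have hA : MeasurableSet {ω | τ ω ≠ ∞} :=
    (measurableSet_eq_fun (tau_meas hτ) measurable_const).compl
  rw [lintegral_add_left hD, lintegral_indicator hA]
  congr 1
  have hg : Measurable fun q : (ℝ × (ℝ × ℝ)) × Path => oR (rexp (-p.θ * q.1.1)) * gF p Φ (q.1.2, q.2) := by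
    refine Measurable.mul (by fun_prop) (hΦ.gmeas.comp ?_)
    fun_prop
  have := lintS hu hS hK hH hτ hg
  simp only at this
  rw [this]
  refine lintegral_congr fun ω => ?_
  rw [lintegral_const_mul' _ _ ofReal_ne_top]

end paste

end

section

section lemL

variable {p : Par}

lemma mul_rpow_tan {y M b : ℝ} (hy : 0 < y) (hM : 0 < M) (hb : 0 < b) : M ^ (-b) * (1 + b - b * M⁻¹ * y) ≤ y ^ (-b) := by
  have hx : 0 < y / M := div_pos hy hM
  have h1 := log_le_sub_one_of_pos hx
  have h2 := Real.add_one_le_exp (-b * Real.log (y / M))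
  have h3 : y ^ (-b) = M ^ (-b) * rexp (-b * Real.log (y / M)) := by
    rw [mul_comm (-b), ← rpow_def_of_pos hx, ← Real.mul_rpow hM.le hx.le]
    congr 1; field_simp
  rw [h3]
  refine mul_le_mul_of_nonneg_left ?_ (by positivity)
  have h4 : b * M⁻¹ * y = b * (y / M) := by field_simp
  rw [h4]; nlinarith

lemma OkU.locint {u : ℝ → ℝ} (hu : OkU p u) : LocallyIntegrable u volume :=
  (locallyIntegrable_const p.R).mono hu.meas.aestronglyMeasurable (ae_of_all _ fun t => by
    rw [Real.norm_of_nonneg (hu.pos t).le, Real.norm_of_nonneg p.hR.le]; exact hu.le t)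

lemma OkU.lip {u : ℝ → ℝ} (hu : OkU p u) : LipschitzWith p.R.toNNReal fun t => ∫ s in 0..t, u s := by
  refine LipschitzWith.of_dist_le_mul fun x y => ?_
  rw [Real.dist_eq, intervalIntegral.integral_interval_sub_left (hu.intble _ _) (hu.intble _ _), Real.coe_toNNReal _ p.hR.le, Real.dist_eq, ← Real.norm_eq_abs]
  exact intervalIntegral.norm_integral_le_of_norm_le_const fun t _ => by
    rw [Real.norm_of_nonneg (hu.pos t).le]; exact hu.le t

lemma int_y (hp : 0 < p.R) {u : ℝ → ℝ} (hu : OkU p u) {η r : ℝ} (hη : 0 < η) (hr : 0 < r) (hr1 : r < 1) : IntervalIntegrable (fun t => u t * (η + ∫ s in 0..t, u s) ^ (-r)) volume 0 1 ∧ ∫ t in 0..1, u t * (η + ∫ s in 0..t, u s) ^ (-r) ≤ p.R ^ (1 - r) / (1 - r) := by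
  set U : ℝ → ℝ := fun t => ∫ s in 0..t, u s with hU
  have hUc : Continuous U := hu.int_cont
  have hU0 : ∀ t, 0 ≤ t → 0 ≤ U t := fun t ht => hu.int_nonneg ht
  have hcont : ContinuousOn (fun t => (η + U t) ^ (-r)) (uIcc 0 1) := by
    refine ContinuousOn.rpow_const (by fun_prop) fun t ht => Or.inl ?_
    rw [uIcc_of_le zero_le_one] at ht
    have := hU0 t ht.1; positivity
  have hint : IntervalIntegrable (fun t => u t * (η + U t) ^ (-r)) volume 0 1 :=
    (hu.intble 0 1).mul_continuousOn hcont
  refine ⟨hint, ?_⟩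
  have hdU : ∀ᵐ t, HasDerivAt U (u t) t := by
    filter_upwards [LocallyIntegrable.ae_hasDerivAt_integral hu.locint] with t ht using ht 0
  have hac : AbsolutelyContinuousOnInterval (fun t => (η + U t) ^ (1 - r)) 0 1 := by
    have hg : LipschitzOnWith ((1 - r) * η ^ (-r)).toNNReal (fun x : ℝ => (η + x) ^ (1 - r)) (Ici 0) := by
      refine Convex.lipschitzOnWith_of_nnnorm_hasDerivWithin_le (f' := fun x => (1 - r) * (η + x) ^ (-r)) (convex_Ici 0) (fun x hx => ?_) fun x hx => ?_
      · have h0 : 0 < η + x := add_pos_of_pos_of_nonneg hη hx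
        have := (((hasDerivAt_id x).const_add η).rpow_const (p := 1 - r) (Or.inl h0.ne'))
        refine (this.congr_deriv ?_).hasDerivWithinAt
        simp only [id, one_mul]; rw [show (1 - r - 1) = -r by ring]
      · have h0 : 0 < η + x := add_pos_of_pos_of_nonneg hη hx
        have h1 : 0 ≤ (1 - r) * (η + x) ^ (-r) := mul_nonneg (by linarith) (by positivity)
        rw [← NNReal.coe_le_coe, coe_nnnorm, Real.norm_of_nonneg h1, Real.coe_toNNReal _ (mul_nonneg (by linarith) (by positivity))]
        refine mul_le_mul_of_nonneg_left ?_ (by linarith)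
        exact rpow_le_rpow_of_nonpos hη (by have : 0 ≤ x := hx; linarith) (by linarith)
    refine LipschitzOnWith.absolutelyContinuousOnInterval (hg.comp (hu.lip.lipschitzOnWith) ?_)
    intro t ht
    rw [uIcc_of_le zero_le_one] at ht
    exact hU0 t ht.1
  have e := hac.integral_deriv_eq_sub
  have e2 : ∫ t in 0..1, deriv (fun t => (η + U t) ^ (1 - r)) t = ∫ t in 0..1, (1 - r) * (u t * (η + U t) ^ (-r)) := by
    refine intervalIntegral.integral_congr_ae ?_
    filter_upwards [hdU] with t ht ht'
    rw [uIoc_of_le zero_le_one] at ht'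
    have h0 : 0 < η + U t := by have := hU0 t ht'.1.le; positivity
    have := ((ht.const_add η).rpow_const (p := 1 - r) (Or.inl h0.ne')).deriv
    rw [this]
    rw [show (1 - r - 1) = -r by ring]; ring
  rw [e2, intervalIntegral.integral_const_mul] at e
  rw [le_div_iff₀ (by linarith), mul_comm, e]
  have hU00 : U 0 = 0 := by simp [hU]
  have hU1 : U 1 ≤ p.R := by have := hu.int_le zero_le_one; simpa using this
  have h1 := rpow_add_le_add_rpow (p := 1 - r) hη.le (hU0 1 zero_le_one) (by linarith) (by linarith)
  have h2 := rpow_le_rpow (hU0 1 zero_le_one) hU1 (z := 1 - r) (by linarith)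
  rw [hU00, add_zero]; linarith


lemma tan_int {u : ℝ → ℝ} (hu : OkU p u) {η : ℝ} (hη : 0 < η) : oR ((p.R ^ (1 - p.a / p.b) / (1 - p.a / p.b)) ^ (-p.b)) ≤ ∫⁻ t in Ioc 0 1, oR ((η + ∫ s in 0..t, u s) ^ p.a * u t ^ (-p.b)) := by
  have hb := p.hb; have ha := p.ha; have hR := p.hR
  have hr : 0 < p.a / p.b := div_pos ha hb
  have hr1 : p.a / p.b < 1 := (div_lt_one hb).2 p.hab
  obtain ⟨h1, h2⟩ := int_y hR hu hη hr hr1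
  set U : ℝ → ℝ := fun t => ∫ s in 0..t, u s with hU
  have hUc : Continuous U := hu.int_cont
  set r := p.a / p.b with hrd
  set M := p.R ^ (1 - r) / (1 - r) with hM
  have hM0 : 0 < M := div_pos (by positivity) (by linarith)
  set y : ℝ → ℝ := fun t => u t * (η + U t) ^ (-r) with hy
  have hyz : ∀ t ∈ Ioc (0:ℝ) 1, (η + U t) ^ p.a * u t ^ (-p.b) = y t ^ (-p.b) := fun t ht => by
    have h0 : 0 < η + U t := by have := hu.int_nonneg ht.1.le; positivity
    rw [hy]; simp only
    rw [Real.mul_rpow (hu.pos t).le (by positivity), ← rpow_mul h0.le, mul_comm]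
    congr 2; rw [hrd]; field_simp
  have hy0 : ∀ t ∈ Ioc (0:ℝ) 1, 0 < y t := fun t ht => by
    have h0 : 0 < η + U t := by have := hu.int_nonneg ht.1.le; positivity
    have := hu.pos t; rw [hy]; positivity
  have hym : Measurable y := hu.meas.mul ((hUc.measurable.const_add η).pow_const _)
  rw [setLIntegral_congr_fun measurableSet_Ioc (g := fun t => oR (y t ^ (-p.b))) (fun t ht => by simp only; rw [hyz t ht])]
  by_cases hfin : ∫⁻ t in Ioc 0 1, oR (y t ^ (-p.b)) = ∞
  · rw [hfin]; exact le_top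
  have hpos : 0 ≤ᵐ[volume.restrict (Ioc (0:ℝ) 1)] fun t => y t ^ (-p.b) := by
    filter_upwards [ae_restrict_mem measurableSet_Ioc] with t ht
    exact rpow_nonneg (hy0 t ht).le _
  have hi : IntegrableOn (fun t => y t ^ (-p.b)) (Ioc 0 1) := by
    refine ⟨(hym.pow_const _).aestronglyMeasurable, ?_⟩
    rw [hasFiniteIntegral_iff_ofReal hpos]; exact lt_top_iff_ne_top.2 hfin
  rw [← ofReal_integral_eq_lintegral_ofReal hi hpos]
  refine ofReal_le_ofReal ?_
  rw [intervalIntegrable_iff_integrableOn_Ioc_of_le zero_le_one] at h1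
  rw [intervalIntegral.integral_of_le zero_le_one] at h2
  have hc : IntegrableOn (fun _ : ℝ => (1 + p.b)) (Ioc 0 1) := integrableOn_const (by simp)
  have h3 : ∫ t in Ioc (0:ℝ) 1, M ^ (-p.b) * (1 + p.b - p.b * M⁻¹ * y t) ≤ ∫ t in Ioc (0:ℝ) 1, y t ^ (-p.b) := by
    refine setIntegral_mono_on ((hc.sub (h1.const_mul _)).const_mul _) hi measurableSet_Ioc ?_
    intro t ht
    exact mul_rpow_tan (hy0 t ht) hM0 hb
  refine le_trans ?_ h3
  rw [integral_const_mul, integral_sub hc (h1.const_mul _), integral_const_mul]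
  simp only [integral_const, MeasurableSet.univ, measureReal_restrict_apply, univ_inter, Real.volume_real_Ioc_of_le zero_le_one, sub_zero, smul_eq_mul, one_mul]
  have h4 : p.b * M⁻¹ * (∫ t in Ioc (0:ℝ) 1, y t) ≤ p.b := by
    rw [mul_assoc]
    have : M⁻¹ * (∫ t in Ioc (0:ℝ) 1, y t) ≤ 1 := by
      rw [inv_mul_le_one₀ hM0]; exact h2
    nlinarith
  have h5 : 0 < M ^ (-p.b) := by positivity
  nlinarith

lemma E_bd (p : Par) (N : ℝ) (hN : 0 ≤ N) : ∃ D : ℝ, 0 ≤ D ∧ ∀ (w : Path) (t : ℝ), 0 ≤ t → t ≤ N + 1 → ‖w t‖ ≤ N → rexp (-D) ≤ E1 p w t ∧ E1 p w t ≤ rexp D ∧ rexp (-D) ≤ E2 p w t ∧ E2 p w t ≤ rexp D := by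
  have h1 := p.hβ₁; have h2 := p.hβ₂
  refine ⟨(|p.B - p.β₁ ^ 2 / 2| + |-p.ρ - p.β₂ ^ 2 / 2|) * (N + 1) + (p.β₁ + p.β₂) * N, by positivity, fun w t ht ht1 hw => ?_⟩
  have g1 : |(w t).1| ≤ N := (norm_fst_le (w t)).trans hw
  have g2 : |(w t).2| ≤ N := (norm_snd_le (w t)).trans hw
  unfold E1 E2
  set x := p.B - p.β₁ ^ 2 / 2
  set y := -p.ρ - p.β₂ ^ 2 / 2
  have a1 : |x * t| ≤ |x| * (N + 1) := by
    rw [abs_mul, abs_of_nonneg ht]; exact mul_le_mul_of_nonneg_left ht1 (abs_nonneg _)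
  have a2 : |y * t| ≤ |y| * (N + 1) := by
    rw [abs_mul, abs_of_nonneg ht]; exact mul_le_mul_of_nonneg_left ht1 (abs_nonneg _)
  have a3 : |p.β₁ * (w t).1| ≤ p.β₁ * N := by
    rw [abs_mul, abs_of_pos h1]; exact mul_le_mul_of_nonneg_left g1 h1.le
  have a4 : |p.β₂ * (w t).2| ≤ p.β₂ * N := by
    rw [abs_mul, abs_of_pos h2]; exact mul_le_mul_of_nonneg_left g2 h2.le
  have b1 : 0 ≤ |x| * (N + 1) := by positivity
  have b2 : 0 ≤ |y| * (N + 1) := by positivity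
  have b3 : 0 ≤ p.β₁ * N := by positivity
  have b4 : 0 ≤ p.β₂ * N := by positivity
  rw [abs_le] at a1 a2 a3 a4
  refine ⟨exp_le_exp.2 ?_, exp_le_exp.2 ?_, exp_le_exp.2 ?_, exp_le_exp.2 ?_⟩ <;>
    nlinarith

lemma cst_low (p : Par) (N : ℝ) (hN : 0 ≤ N) : ∃ c : ℝ, 0 < c ∧ ∀ (w : Path), (∀ t, 0 ≤ t → t ≤ 1 → ‖w t‖ ≤ N) → ∀ k h : ℝ, 0 < k → 0 < h → ∀ u : ℝ → ℝ, OkU p u → oR (c * phi p k h) ≤ cst p k h u w := by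
  obtain ⟨D, hD, hE⟩ := E_bd p N hN
  have hb := p.hb; have ha := p.ha; have hR := p.hR; have hρ := p.hρ₀; have hθ := p.hθ
  have hr1 : p.a / p.b < 1 := (div_lt_one hb).2 p.hab
  set M := p.R ^ (1 - p.a / p.b) / (1 - p.a / p.b) with hM
  have hM0 : 0 < M := div_pos (by positivity) (by linarith)
  set c1 := rexp (-D) * min 1 (p.ρ * rexp (-(2 * D + p.R))) with hc1
  have hc10 : 0 < c1 := mul_pos (exp_pos _) (lt_min one_pos (mul_pos hρ (exp_pos _)))
  set c2 := p.b⁻¹ * c1 ^ p.a * rexp D ^ (-p.b) * rexp (-p.θ) with hc2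
  have hc20 : 0 < c2 := by positivity
  set m := min (M ^ (-p.b)) (p.R ^ (-p.b)) with hm
  have hm0 : 0 < m := lt_min (by positivity) (by positivity)
  refine ⟨c2 * m / 2, by positivity, fun w hw k h hk hh u hu => ?_⟩
  have hE' : ∀ t : ℝ, 0 ≤ t → t ≤ 1 → _ := fun t ht ht1 => hE w t ht (by linarith) (hw t ht ht1)
  have hUR : ∀ t, 0 ≤ t → t ≤ 1 → ∫ s in 0..t, u s ≤ p.R := fun t ht ht1 => by
    have := hu.int_le ht; nlinarith
  have hH : ∀ t, 0 ≤ t → t ≤ 1 → c1 * (h + k * ∫ s in 0..t, u s) ≤ Hx p k h u w t := by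
    intro t ht ht1
    obtain ⟨-, -, e3, -⟩ := hE' t ht ht1
    have hi : (k * rexp (-(2 * D + p.R))) * ∫ s in 0..t, u s ≤ ∫ s in 0..t, Hi p k u w s := by
      rw [← intervalIntegral.integral_const_mul]
      refine intervalIntegral.integral_mono_on ht ((hu.intble 0 t).const_mul _) (Hi_intble hu w 0 t) ?_
      intro s hs
      obtain ⟨f1, f2, f3, f4⟩ := hE' s hs.1 (hs.2.trans ht1)
      unfold Hi Kx
      rw [le_div_iff₀ (E2_pos w s)]
      have g1 : rexp (-p.R) ≤ rexp (-∫ r in 0..s, u r) :=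
        exp_le_exp.2 (neg_le_neg (hUR s hs.1 (hs.2.trans ht1)))
      have hus := hu.pos s
      have he1 := E1_pos (p := p) w s
      calc k * rexp (-(2 * D + p.R)) * u s * E2 p w s ≤ k * rexp (-(2 * D + p.R)) * u s * rexp D := by gcongr
        _ = u s * (k * rexp (-D) * rexp (-p.R)) := by
            rw [show -(2 * D + p.R) = -D + (-D) + (-p.R) by ring, exp_add, exp_add, exp_neg D]; field_simp
        _ ≤ _ := by gcongr
    have hU0 := hu.int_nonneg ht
    unfold Hx
    rw [hc1, mul_assoc]
    refine mul_le_mul e3 ?_ (by positivity) (E2_pos w t).le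
    have m1 : min 1 (p.ρ * rexp (-(2 * D + p.R))) * h ≤ 1 * h :=
      mul_le_mul_of_nonneg_right (min_le_left _ _) hh.le
    have m2 : min 1 (p.ρ * rexp (-(2 * D + p.R))) * (k * ∫ s in 0..t, u s) ≤ p.ρ * rexp (-(2 * D + p.R)) * (k * ∫ s in 0..t, u s) :=
      mul_le_mul_of_nonneg_right (min_le_right _ _) (by positivity)
    have m3 := mul_le_mul_of_nonneg_left hi hρ.le
    nlinarith
  have hrun : ∀ t, 0 < t → t ≤ 1 → oR (c2 * k ^ (-p.b) * ((h + k * ∫ s in 0..t, u s) ^ p.a * u t ^ (-p.b))) ≤ run p k h u w t := by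
    intro t ht ht1
    have hU0 := hu.int_nonneg ht.le
    have hut := hu.pos t
    have hKp := Kx_pos (p := p) hk u w t
    have hHp := Hx_pos hk hh hu w ht.le
    unfold run cf
    refine ofReal_le_ofReal ?_
    have q1 : c1 ^ p.a * (h + k * ∫ s in 0..t, u s) ^ p.a ≤ Hx p k h u w t ^ p.a := by
      rw [← Real.mul_rpow hc10.le (by positivity)]
      exact rpow_le_rpow (by positivity) (hH t ht.le ht1) ha.le
    have q2 : rexp D ^ (-p.b) * k ^ (-p.b) ≤ Kx p k u w t ^ (-p.b) := by
      rw [← Real.mul_rpow (exp_pos _).le hk.le]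
      refine rpow_le_rpow_of_nonpos hKp ?_ (by linarith)
      obtain ⟨-, e2, -, -⟩ := hE' t ht.le ht1
      unfold Kx
      have : rexp (-∫ s in 0..t, u s) ≤ 1 := exp_le_one_iff.2 (by linarith)
      have he1 := E1_pos (p := p) w t
      calc k * E1 p w t * rexp (-∫ s in 0..t, u s) ≤ k * rexp D * 1 := by gcongr
        _ = _ := by ring
    have q3 : rexp (-p.θ) ≤ rexp (-p.θ * t) := exp_le_exp.2 (by nlinarith)
    calc _ = p.b⁻¹ * ((c1 ^ p.a * (h + k * ∫ s in 0..t, u s) ^ p.a) * u t ^ (-p.b) * (rexp D ^ (-p.b) * k ^ (-p.b))) * rexp (-p.θ) := by rw [hc2]; ring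
      _ ≤ _ := by gcongr
  have hsub : (∫⁻ t in Ioc 0 1, run p k h u w t) ≤ cst p k h u w :=
    lintegral_mono_set Ioc_subset_Ioi_self
  have L1 : oR (c2 * m * k ^ (p.a - p.b)) ≤ cst p k h u w := by
    refine le_trans ?_ hsub
    have h1 := tan_int hu (div_pos hh hk)
    have h2 : oR (c2 * k ^ (p.a - p.b)) * oR (M ^ (-p.b)) ≤ ∫⁻ t in Ioc 0 1, run p k h u w t := by
      refine (mul_le_mul_right h1 _).trans ?_
      rw [← lintegral_const_mul' _ _ ofReal_ne_top]
      refine setLIntegral_mono' measurableSet_Ioc fun t ht => ?_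
      refine le_trans (le_of_eq ?_) (hrun t ht.1 ht.2)
      have hU0 := hu.int_nonneg ht.1.le
      rw [← ofReal_mul (by positivity)]
      congr 1
      have : h + k * ∫ s in 0..t, u s = k * (h / k + ∫ s in 0..t, u s) := by field_simp
      rw [this, Real.mul_rpow hk.le (by positivity), show p.a - p.b = p.a + (-p.b) by ring, rpow_add hk]; ring
    refine le_trans ?_ h2
    rw [← ofReal_mul (by positivity)]
    refine ofReal_le_ofReal ?_
    have : m ≤ M ^ (-p.b) := min_le_left _ _
    calc _ = c2 * k ^ (p.a - p.b) * m := by ring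
      _ ≤ _ := by gcongr
  have L2 : oR (c2 * m * (h ^ p.a * k ^ (-p.b))) ≤ cst p k h u w := by
    refine le_trans ?_ hsub
    have h2 : ∫⁻ t in Ioc (0:ℝ) 1, oR (c2 * m * (h ^ p.a * k ^ (-p.b))) ≤ ∫⁻ t in Ioc 0 1, run p k h u w t := by
      refine setLIntegral_mono' measurableSet_Ioc fun t ht => ?_
      refine le_trans (ofReal_le_ofReal ?_) (hrun t ht.1 ht.2)
      have hU0 := hu.int_nonneg ht.1.le
      have q1 : h ^ p.a ≤ (h + k * ∫ s in 0..t, u s) ^ p.a :=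
        rpow_le_rpow hh.le (by nlinarith) ha.le
      have q2 : m ≤ u t ^ (-p.b) := (min_le_right _ _).trans (rpow_le_rpow_of_nonpos (hu.pos t) (hu.le t) (by linarith))
      calc _ = c2 * k ^ (-p.b) * (h ^ p.a * m) := by ring
        _ ≤ _ := by gcongr
    simpa using h2
  have : oR (c2 * m / 2 * phi p k h) = (oR (c2 * m * (h ^ p.a * k ^ (-p.b))) + oR (c2 * m * k ^ (p.a - p.b))) / 2 := by
    rw [← ENNReal.ofReal_add (by positivity) (by positivity)]
    rw [show (2 : ℝ≥0∞) = oR 2 by simp, ← ENNReal.ofReal_div_of_pos two_pos]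
    congr 1; unfold phi; ring
  rw [this]
  refine ENNReal.div_le_of_le_mul ?_
  rw [mul_two]; exact add_le_add L2 L1

end lemL

end

section

section tail

variable {p : Par} {μ : Measure Path} {P : Measure Ω} {F : Filtration ℝ mΩ} {W : Ω → Path} {u : ℝ → Ω → ℝ} {K H : Ω → ℝ}

def bset (N : ℝ) : Set Path := {w | ∀ t, 0 ≤ t → t ≤ 1 → ‖w t‖ ≤ N}

lemma rat_clip {f : ℝ → ℝ} (hf : Continuous f) {x y N : ℝ} (hxy : x ≤ y) : (∀ t, x ≤ t → t ≤ y → f t ≤ N) ↔ ∀ q : ℚ, f (max x (min (q:ℝ) y)) ≤ N := by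
  constructor
  · intro h q; exact h _ (le_max_left _ _) (max_le hxy (min_le_right _ _))
  · intro h t h1 h2
    have hc : IsClosed {t : ℝ | f (max x (min t y)) ≤ N} :=
      isClosed_le (by fun_prop) continuous_const
    have hd : Dense (range ((↑) : ℚ → ℝ)) := Rat.denseRange_cast
    have h3 : closure (range ((↑) : ℚ → ℝ)) ⊆ {t : ℝ | f (max x (min t y)) ≤ N} :=
      hc.closure_subset_iff.2 (by rintro _ ⟨q, rfl⟩; exact h q)
    have := h3 (hd t)
    simpa [h1, h2] using this

lemma bset_meas (N : ℝ) : MeasurableSet (bset N) := by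
  have : bset N = ⋂ q : ℚ, {w : Path | ‖w (max 0 (min (q:ℝ) 1))‖ ≤ N} := by
    ext w
    simp only [bset, mem_setOf_eq, mem_iInter]
    exact rat_clip (f := fun t => ‖w t‖) (by fun_prop) zero_le_one
  rw [this]
  exact MeasurableSet.iInter fun q => measurableSet_le (measurable_eval _).norm measurable_const

lemma bset_pos (μ : Measure Path) [IsProbabilityMeasure μ] : ∃ N : ℝ, 0 ≤ N ∧ μ (bset N) ≠ 0 := by
  by_contra hc
  push Not at hc
  have : (⋃ n : ℕ, bset n) = univ := by
    refine eq_univ_of_forall fun w => ?_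
    obtain ⟨C, hC⟩ := (isCompact_Icc (a := (0:ℝ)) (b := 1)).exists_bound_of_continuousOn
      w.continuous.continuousOn
    obtain ⟨n, hn⟩ := exists_nat_ge C
    exact mem_iUnion.2 ⟨n, fun t h0 h1 => (hC t ⟨h0, h1⟩).trans hn⟩
  have h0 : μ univ = 0 := by
    rw [← this, measure_iUnion_null_iff]; exact fun n => hc n (Nat.cast_nonneg n)
  simp at h0

lemma phi_meas : Measurable fun z : ℝ × ℝ => phi p z.1 z.2 := by
  unfold phi; fun_prop

lemma phi_tail (hu : Ctl p F u) (hS : Sys μ P F W) (hK : Measurable[F 0] K) (hH : Measurable[F 0] H) (hK0 : ∀ ω, 0 < K ω) (hH0 : ∀ ω, 0 < H ω) : ∃ C : ℝ≥0∞, C ≠ ∞ ∧ ∀ τ : Ω → ℝ≥0∞, IsStoppingTimeE F τ → ∫⁻ ω in {ω | τ ω ≠ ∞}, oR (rexp (-p.θ * (τ ω).toReal)) * oR (phi p (zz p K H u W (τ ω).toReal ω).1 (zz p K H u W (τ ω).toReal ω).2) ∂P ≤ C * ∫⁻ ω in {ω | τ ω ≠ ∞}, (∫⁻ t in Ioi (τ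 ω).toReal, run p (K ω) (H ω) (u · ω) (W ω) t) ∂P := by
  have := hS.prob
  obtain ⟨N, hN, hμ⟩ := bset_pos μ
  obtain ⟨c, hc, hlow⟩ := cst_low p N hN
  refine ⟨(μ (bset N) * oR c)⁻¹, ?_, fun τ hτ => ?_⟩
  · rw [ENNReal.inv_ne_top]; exact mul_ne_zero hμ (by simpa using hc)
  have hg : Measurable fun q : (ℝ × (ℝ × ℝ)) × Path => oR (rexp (-p.θ * q.1.1)) * oR (c * phi p q.1.2.1 q.1.2.2) * (bset N).indicator 1 q.2 := by
    refine ((by fun_prop : Measurable _).mul (measurable_ofReal.comp ((phi_meas.comp (measurable_snd.comp measurable_fst)).const_mul c))).mul ?_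
    exact (measurable_one.indicator (bset_meas N)).comp measurable_snd
  have key := lintS hu hS hK hH hτ hg
  simp only at key
  have hA : MeasurableSet {ω | τ ω ≠ ∞} :=
    (measurableSet_eq_fun (tau_meas hτ) measurable_const).compl
  have h0 : μ (bset N) * oR c ≠ 0 := mul_ne_zero hμ (by simpa using hc)
  have ht : μ (bset N) * oR c ≠ ∞ := ENNReal.mul_ne_top (measure_ne_top _ _) ofReal_ne_top
  rw [mul_comm, ← div_eq_mul_inv, ENNReal.le_div_iff_mul_le (Or.inl h0) (Or.inl ht), mul_comm, ← lintegral_const_mul' _ _ ht]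
  have e : ∀ ω, ∫⁻ w, oR (rexp (-p.θ * (τ ω).toReal)) * oR (c * phi p (zz p K H u W (τ ω).toReal ω).1 (zz p K H u W (τ ω).toReal ω).2) * (bset N).indicator 1 w ∂μ = (μ (bset N) * oR c) * (oR (rexp (-p.θ * (τ ω).toReal)) * oR (phi p (zz p K H u W (τ ω).toReal ω).1 (zz p K H u W (τ ω).toReal ω).2)) := by
    intro ω
    rw [lintegral_const_mul' _ _ (ENNReal.mul_ne_top ofReal_ne_top ofReal_ne_top), lintegral_indicator_one (bset_meas N), ofReal_mul hc.le]
    ring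
  simp only [e] at key
  rw [← key]
  refine setLIntegral_mono' hA fun ω hω => ?_
  rw [cst_flow _ _ (hu.ok ω)]
  by_cases hw : HabitModel.shift (τ ω).toReal (W ω) ∈ bset N
  · rw [indicator_of_mem hw, Pi.one_apply, mul_one]
    have hz := zz_pos (W := W) hu hK0 hH0 (s := (τ ω).toReal) toReal_nonneg ω
    exact mul_le_mul_right (hlow _ hw _ _ hz.1 hz.2 _ ((hu.ok ω).shift _)) _
  · rw [indicator_of_notMem hw, mul_zero]; exact bot_le

/- hitting time -/
def ztS (W : Ω → Path) (N : ℝ) (ω : Ω) : Set ℝ := {t | 0 ≤ t ∧ N ≤ t + ‖W ω t‖}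
def zt (W : Ω → Path) (N : ℝ) (ω : Ω) : ℝ := sInf (ztS W N ω)

variable {N : ℝ}

lemma ztS_ne (hN : 0 ≤ N) (ω : Ω) : N ∈ ztS W N ω := ⟨hN, by have := norm_nonneg (W ω N); linarith⟩

lemma ztS_bdd (ω : Ω) : BddBelow (ztS W N ω) := ⟨0, fun _ h => h.1⟩

lemma zt_mem (hN : 0 ≤ N) (ω : Ω) : zt W N ω ∈ ztS W N ω := by
  refine IsClosed.csInf_mem ?_ ⟨N, ztS_ne hN ω⟩ (ztS_bdd ω)
  exact (isClosed_le continuous_const continuous_id).inter (isClosed_le continuous_const (continuous_id.add (W ω).continuous.norm))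

lemma zt_le (hN : 0 ≤ N) (ω : Ω) : zt W N ω ≤ N := csInf_le (ztS_bdd ω) (ztS_ne hN ω)

lemma zt_norm (hS : Sys μ P F W) (hN : 0 ≤ N) (ω : Ω) {t : ℝ} (ht : 0 ≤ t) (h : t ≤ zt W N ω) : ‖W ω t‖ ≤ N := by
  have hlt : ∀ s, 0 ≤ s → s < zt W N ω → ‖W ω s‖ ≤ N := fun s hs h => by
    by_contra hc
    push Not at hc
    exact absurd (csInf_le (ztS_bdd ω) (show s ∈ ztS W N ω from ⟨hs, by linarith⟩)) (not_le.2 h)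
  rcases h.lt_or_eq with h1 | h1
  · exact hlt t ht h1
  rcases ht.eq_or_lt with h0 | h0
  · rw [← h0, hS.zero ω 0 le_rfl]; simpa using hN
  · have hc : Tendsto (fun s => ‖W ω s‖) (nhdsWithin t (Iio t)) (nhds ‖W ω t‖) :=
      ((by fun_prop : Continuous fun s => ‖W ω s‖).tendsto t).mono_left nhdsWithin_le_nhds
    refine le_of_tendsto hc ?_
    filter_upwards [Ioo_mem_nhdsLT h0] with s hs
    exact hlt s hs.1.le (h1 ▸ hs.2)

lemma zt_stop (hS : Sys μ P F W) (hN : 0 ≤ N) : IsStoppingTimeE F fun ω => oR (zt W N ω) := by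
  intro t ht
  have e : {ω | oR (zt W N ω) ≤ oR t} = (⋃ m : ℕ, ⋂ q : ℚ, {ω | max 0 (min (q:ℝ) t) + ‖W ω (max 0 (min (q:ℝ) t))‖ ≤ N - 1 / ((m:ℝ) + 1)})ᶜ := by
    ext ω
    have hcont : Continuous fun s => s + ‖W ω s‖ := by fun_prop
    simp only [mem_setOf_eq, mem_compl_iff, mem_iInter, mem_iUnion, ENNReal.ofReal_le_ofReal_iff ht, ← rat_clip hcont ht]
    constructor
    · rintro h ⟨m, hm⟩
      have hz := zt_mem (W := W) hN ω
      have h1 := hm _ hz.1 h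
      have : 0 < 1 / ((m:ℝ) + 1) := by positivity
      linarith [hz.2]
    · intro h
      by_contra hc
      push Not at hc
      apply h
      obtain ⟨x, hx, hmax⟩ := (isCompact_Icc (a := (0:ℝ)) (b := t)).exists_isMaxOn ⟨0, le_rfl, ht⟩
        hcont.continuousOn
      have hxN : x + ‖W ω x‖ < N := by
        by_contra hc'
        push Not at hc'
        exact absurd (csInf_le (ztS_bdd ω) (show x ∈ ztS W N ω from ⟨hx.1, hc'⟩)) (not_le.2 (hx.2.trans_lt hc))
      obtain ⟨m, hm⟩ := exists_nat_one_div_lt (sub_pos.2 hxN)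
      refine ⟨m, fun s h0 h1 => ?_⟩
      have : s + ‖W ω s‖ ≤ x + ‖W ω x‖ := hmax ⟨h0, h1⟩
      linarith
  rw [e]
  refine MeasurableSet.compl (MeasurableSet.iUnion fun m => MeasurableSet.iInter fun q => ?_)
  have h1 : Measurable[F t] fun ω => W ω (max 0 (min (q:ℝ) t)) :=
    (hS.adapted _ (le_max_left _ _)).mono (F.mono (max_le ht (min_le_right _ _))) le_rfl
  have h2 : Measurable[F t] fun ω => max 0 (min (q:ℝ) t) + ‖W ω (max 0 (min (q:ℝ) t))‖ :=
    (measurable_norm.comp h1).const_add _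
  exact h2 measurableSet_Iic

lemma zt_big (W : Ω → Path) (ω : Ω) (T : ℝ) : ∀ᶠ n : ℕ in atTop, T < zt W n ω := by
  obtain ⟨C, hC⟩ := (isCompact_Icc (a := (0:ℝ)) (b := T)).exists_bound_of_continuousOn (W ω).continuous.continuousOn
  obtain ⟨n, hn⟩ := exists_nat_gt (T + C)
  filter_upwards [Filter.eventually_ge_atTop n] with m hm
  have hm' : (n:ℝ) ≤ m := by exact_mod_cast hm
  by_contra hc
  push Not at hc
  have hz := zt_mem (W := W) (N := m) (Nat.cast_nonneg m) ω
  have := hC _ ⟨hz.1, hc⟩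
  linarith [hz.2]

end tail

end

section

section dom

variable {p : Par}

lemma run_dom {x₀ m A : ℝ} (hx0 : 0 < x₀) (hxR : x₀ ≤ p.R) (hm : 0 < m) {v : ℝ → ℝ} (hv : OkU p v) (h1 : ∀ t, 0 ≤ t → |(∫ s in 0..t, v s) - x₀ * t| ≤ A) (hmv : ∀ t, m ≤ v t) {k h : ℝ} (hk : 0 < k) (hh : 0 < h) (w : Path) {t : ℝ} (ht : 0 ≤ t) : (∀ s, 0 ≤ s → Hi p k v w s ≤ p.R / x₀ * rexp A * Hi p k (fun _ => x₀) w s) ∧ run p k h v w t ≤ oR ((p.R / x₀ * rexp A) ^ p.a * (m / x₀) ^ (-p.b) * rexp (-A) ^ (-p.b)) * run p k h (fun _ => x₀) w t := by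
  have hc := OkU.const (p := p) hx0 hxR
  have hA : 0 ≤ A := (abs_nonneg _).trans (h1 0 le_rfl)
  have hR := p.hR
  have hHi : ∀ s, 0 ≤ s → Hi p k v w s ≤ p.R / x₀ * rexp A * Hi p k (fun _ => x₀) w s := by
    intro s hs
    have e1 := E1_pos (p := p) w s
    have e2 := E2_pos (p := p) w s
    have h2 := (abs_le.1 (h1 s hs)).1
    unfold Hi Kx
    have q1 : rexp (-∫ r in 0..s, v r) ≤ rexp A * rexp (-∫ r in 0..s, x₀) := by
      rw [← exp_add]; refine exp_le_exp.2 ?_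
      simp only [intervalIntegral.integral_const, smul_eq_mul, sub_zero]; linarith
    have q2 := hv.le s
    have q3 := hv.pos s
    calc v s * (k * E1 p w s * rexp (-∫ r in 0..s, v r)) / E2 p w s ≤ p.R * (k * E1 p w s * (rexp A * rexp (-∫ r in 0..s, x₀))) / E2 p w s := by gcongr
      _ = _ := by field_simp
  refine ⟨hHi, run_le_of hk hh hk hh hc hv w ht (div_pos hm hx0) (exp_pos _) ?_ ?_ ?_⟩
  · refine Hx_le_of hk hk hc hv w ht ?_ fun s hs _ => hHi s hs
    have : 1 ≤ p.R / x₀ * rexp A := by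
      have q1 : 1 ≤ p.R / x₀ := (one_le_div hx0).2 hxR
      have q2 : 1 ≤ rexp A := Real.one_le_exp hA
      nlinarith
    nlinarith
  · rw [div_mul_cancel₀ _ hx0.ne']; exact hmv t
  · have h2 := (abs_le.1 (h1 t ht)).2
    unfold Kx
    have e1 := E1_pos (p := p) w t
    have q1 : rexp (-A) * rexp (-∫ r in 0..t, x₀) ≤ rexp (-∫ r in 0..t, v r) := by
      rw [← exp_add]; refine exp_le_exp.2 ?_
      simp only [intervalIntegral.integral_const, smul_eq_mul, sub_zero]; linarith
    calc _ = k * E1 p w t * (rexp (-A) * rexp (-∫ r in 0..t, x₀)) := by ring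
      _ ≤ _ := by gcongr

lemma cst_tendsto {x₀ m A : ℝ} (hx0 : 0 < x₀) (hxR : x₀ ≤ p.R) (hm : 0 < m) {v : ℕ → ℝ → ℝ} (hv : ∀ n, OkU p (v n)) {u : ℝ → ℝ} (hu : OkU p u) (h1 : ∀ n, ∀ t, 0 ≤ t → |(∫ s in 0..t, v n s) - x₀ * t| ≤ A) (hmv : ∀ n t, m ≤ v n t) (hlim : ∀ᵐ t, 0 < t → Tendsto (fun n => v n t) atTop (nhds (u t))) {k h : ℝ} (hk : 0 < k) (hh : 0 < h) (w : Path) (hfin : cst p k h (fun _ => x₀) w ≠ ∞) : Tendsto (fun n => cst p k h (v n) w) atTop (nhds (cst p k h u w)) := by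
  have hc := OkU.const (p := p) hx0 hxR
  have hR := p.hR
  have hlim' : ∀ t, 0 ≤ t → ∀ᵐ s ∂volume, s ∈ uIoc 0 t → Tendsto (fun n => v n s) atTop (nhds (u s)) := by
    intro t ht
    filter_upwards [hlim] with s hs hs'
    rw [uIoc_of_le ht] at hs'
    exact hs hs'.1
  have hU : ∀ t, 0 ≤ t → Tendsto (fun n => ∫ s in 0..t, v n s) atTop (nhds (∫ s in 0..t, u s)) := by
    intro t ht
    refine intervalIntegral.tendsto_integral_filter_of_dominated_convergence (fun _ => p.R) (Filter.Eventually.of_forall fun n => (hv n).meas.aestronglyMeasurable) (Filter.Eventually.of_forall fun n => ae_of_all _ fun s _ => ?_) intervalIntegrable_const (hlim' t ht)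
    rw [Real.norm_of_nonneg ((hv n).pos s).le]; exact (hv n).le s
  have hK : ∀ t, 0 ≤ t → Tendsto (fun n => Kx p k (v n) w t) atTop (nhds (Kx p k u w t)) := fun t ht => by
    unfold Kx
    exact ((Real.continuous_exp.tendsto _).comp (hU t ht).neg).const_mul _
  have hH : ∀ t, 0 ≤ t → Tendsto (fun n => Hx p k h (v n) w t) atTop (nhds (Hx p k h u w t)) := fun t ht => by
    unfold Hx
    refine ((Filter.Tendsto.const_mul _ ?_).const_add _).const_mul _
    refine intervalIntegral.tendsto_integral_filter_of_dominated_convergence (fun s => p.R / x₀ * rexp A * Hi p k (fun _ => x₀) w s) (Filter.Eventually.of_forall fun n => (Hi_intble (hv n) w 0 t).aestronglyMeasurable.mono_measure ?_) (Filter.Eventually.of_forall fun n => ae_of_all _ fun s hs => ?_) ((Hi_intble hc w 0 t).const_mul _) ?_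
    · rw [uIoc_of_le ht]
    · rw [uIoc_of_le ht] at hs
      rw [Real.norm_of_nonneg (Hi_pos hk (hv n) w s).le]
      exact (run_dom hx0 hxR hm (hv n) (h1 n) (hmv n) hk hh w hs.1.le).1 s hs.1.le
    · filter_upwards [hlim' t ht] with s hs hs'
      have h0 : 0 ≤ s := by rw [uIoc_of_le ht] at hs'; exact hs'.1.le
      unfold Hi
      exact ((hs hs').mul (hK s h0)).div_const _
  unfold cst
  refine tendsto_lintegral_of_dominated_convergence (fun t => oR ((p.R / x₀ * rexp A) ^ p.a * (m / x₀) ^ (-p.b) * rexp (-A) ^ (-p.b)) * run p k h (fun _ => x₀) w t) (fun n => run_meas k h (hv n) w) ?_ ?_ ?_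
  · intro n
    filter_upwards [ae_restrict_mem measurableSet_Ioi] with t ht
    exact (run_dom hx0 hxR hm (hv n) (h1 n) (hmv n) hk hh w (le_of_lt ht)).2
  · rw [lintegral_const_mul' _ _ ofReal_ne_top]
    exact ENNReal.mul_ne_top ofReal_ne_top hfin
  · filter_upwards [ae_restrict_of_ae hlim, ae_restrict_mem measurableSet_Ioi] with t h2 ht
    have ht : 0 < t := ht
    unfold run cf
    refine (ENNReal.continuous_ofReal.tendsto _).comp ?_
    refine Filter.Tendsto.mul_const _ (Filter.Tendsto.const_mul _ ?_)
    refine Filter.Tendsto.mul (Filter.Tendsto.mul ?_ ?_) ?_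
    · exact (hH t ht.le).rpow_const (Or.inl (Hx_pos hk hh hu w ht.le).ne')
    · exact (h2 ht).rpow_const (Or.inl (hu.pos t).ne')
    · exact (hK t ht.le).rpow_const (Or.inl (Kx_pos hk u w t).ne')

end dom
section avg

variable {p : Par}

lemma idx_spec {δ t : ℝ} (hδ : 0 < δ) (ht : 0 < t) : (idx δ t : ℝ) * δ < t ∧ t ≤ ((idx δ t : ℝ) + 1) * δ := by
  unfold idx
  have h0 : 0 < t / δ := div_pos ht hδ
  have h1 : 1 ≤ ⌈t / δ⌉₊ := Nat.one_le_iff_ne_zero.2 (Nat.ceil_pos.2 h0).ne'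
  rw [Nat.cast_sub h1, Nat.cast_one]
  have h2 := Nat.ceil_lt_add_one h0.le
  have h3 := Nat.le_ceil (t / δ)
  constructor
  · rw [← lt_div_iff₀ hδ]; linarith
  · rw [← div_le_iff₀ hδ]; linarith

def av (δ : ℝ) (J : ℕ) (x₀ : ℝ) (u : ℝ → ℝ) (j : ℕ) : ℝ :=
  if j = 0 ∨ J ≤ j then x₀ else δ⁻¹ * ∫ s in (j * δ - δ)..(j * δ), u s

lemma av_ge {δ x₀ lo : ℝ} (hδ : 0 < δ) {J : ℕ} {u : ℝ → ℝ} (hu : OkU p u) (h : ∀ t, lo ≤ u t) (hx : lo ≤ x₀) (j : ℕ) : lo ≤ av δ J x₀ u j := by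
  unfold av; split_ifs
  · exact hx
  · have := intervalIntegral.integral_mono_on (a := j * δ - δ) (b := j * δ) (by linarith) (intervalIntegrable_const (c := lo)) (hu.intble _ _) (fun x _ => h x)
    simp at this
    rw [inv_mul_eq_div, le_div_iff₀ hδ]; linarith

lemma av_le {δ x₀ : ℝ} (hδ : 0 < δ) {J : ℕ} {u : ℝ → ℝ} (hu : OkU p u) (hx : x₀ ≤ p.R) (j : ℕ) : av δ J x₀ u j ≤ p.R := by
  unfold av; split_ifs
  · exact hx
  · have := intervalIntegral.integral_mono_on (a := j * δ - δ) (b := j * δ) (by linarith) (hu.intble _ _) (intervalIntegrable_const (c := p.R)) (fun x _ => hu.le x)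
    simp at this
    rw [inv_mul_eq_div, div_le_iff₀ hδ]; linarith

lemma av_tendsto {x₀ : ℝ} {N : ℕ} {u : ℝ → ℝ} (hu : OkU p u) (hN : ∀ t, (N:ℝ) < t → u t = x₀) : ∀ᵐ t, 0 < t → Tendsto (fun n : ℕ => av (1 / ((n:ℝ) + 1)) (N * (n + 1) + 1) x₀ u (idx (1 / ((n:ℝ) + 1)) t)) atTop (nhds (u t)) := by
  filter_upwards [IsUnifLocDoublingMeasure.ae_tendsto_average volume hu.locint 3, (Set.finite_singleton (N:ℝ)).measure_zero volume |> measure_eq_zero_iff_ae_notMem.1] with t h1 h2 ht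
  have hd0 : Tendsto (fun n : ℕ => 1 / ((n:ℝ) + 1)) atTop (nhds 0) :=
    tendsto_one_div_add_atTop_nhds_zero_nat
  have hdp : ∀ n : ℕ, (0:ℝ) < 1 / ((n:ℝ) + 1) := fun n => by positivity
  rcases lt_or_gt_of_ne (show t ≠ N from h2) with h3 | h3
  · have ha : Tendsto (fun n : ℕ => 1 / ((n:ℝ) + 1) / 2) atTop (nhdsWithin 0 (Ioi 0)) := by
      refine tendsto_nhdsWithin_iff.2 ⟨by simpa using hd0.div_const 2, Filter.Eventually.of_forall fun n => ?_⟩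
      exact half_pos (hdp n)
    have key := h1 (fun n : ℕ => (idx (1 / ((n:ℝ) + 1)) t : ℝ) * (1 / ((n:ℝ) + 1)) - 1 / ((n:ℝ) + 1) / 2)
      _ ha ?_
    · refine key.congr' ?_
      filter_upwards [hd0.eventually (gt_mem_nhds ht)] with n hn
      obtain ⟨δ, hδ⟩ : ∃ δ, δ = 1 / ((n:ℝ) + 1) := ⟨_, rfl⟩
      have hδ0 : 0 < δ := hδ ▸ hdp n
      rw [← hδ] at hn ⊢
      obtain ⟨s1, s2⟩ := idx_spec hδ0 ht
      unfold av
      rw [if_neg, Real.closedBall_eq_Icc, setAverage_eq, integral_Icc_eq_integral_Ioc, ← intervalIntegral.integral_of_le (by linarith)]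
      · simp only [Real.volume_real_Icc, smul_eq_mul]
        rw [max_eq_left (by linarith)]
        congr 1
        · congr 1; ring
        · congr 1 <;> ring
      · push Not
        constructor
        · intro h0; rw [h0] at s2; simp at s2; linarith
        · have : ((idx δ t : ℕ) : ℝ) < N * (n + 1) := by
            have h4 : (idx δ t : ℝ) * δ < N := s1.trans h3
            rw [hδ, mul_one_div, div_lt_iff₀ (by positivity)] at h4
            rw [hδ]; exact h4
          have h5 : idx δ t < N * (n + 1) := by exact_mod_cast this
          omega
    · refine Filter.Eventually.of_forall fun n => ?_
      obtain ⟨δ, hδ⟩ : ∃ δ, δ = 1 / ((n:ℝ) + 1) := ⟨_, rfl⟩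
      have hδ0 : 0 < δ := hδ ▸ hdp n
      rw [← hδ]
      obtain ⟨s1, s2⟩ := idx_spec hδ0 ht
      rw [Metric.mem_closedBall, Real.dist_eq, abs_le]
      constructor <;> nlinarith
  · rw [hN t h3]
    refine tendsto_const_nhds.congr' ?_
    filter_upwards [hd0.eventually (gt_mem_nhds (half_pos (sub_pos.2 h3)))] with n hn
    unfold av
    rw [if_pos]
    right
    obtain ⟨δ, hδ⟩ : ∃ δ, δ = 1 / ((n:ℝ) + 1) := ⟨_, rfl⟩
    have hδ0 : 0 < δ := hδ ▸ hdp n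
    have hδn : δ * (n + 1) = 1 := by rw [hδ]; field_simp
    rw [← hδ] at hn ⊢
    obtain ⟨s1, s2⟩ := idx_spec hδ0 ht
    have h4 : (N:ℝ) + 2 * δ < (idx δ t + 1) * δ := by linarith
    have h5 : ((N:ℝ) * (n + 1) + 1) * δ < (idx δ t) * δ := by nlinarith
    have h6 := lt_of_mul_lt_mul_right h5 hδ0.le
    exact_mod_cast h6.le

lemma av_far {δ x₀ : ℝ} {N n : ℕ} (hδ : δ = 1 / ((n:ℝ) + 1)) (u : ℝ → ℝ) {t : ℝ} (ht : (N:ℝ) + 2 < t) : av δ (N * (n + 1) + 1) x₀ u (idx δ t) = x₀ := by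
  unfold av
  rw [if_pos]
  right
  have hδ0 : 0 < δ := by rw [hδ]; positivity
  have hδ1 : δ ≤ 1 := by
    rw [hδ, div_le_one (by positivity)]; have := Nat.cast_nonneg (α := ℝ) n; linarith
  have hδn : δ * (n + 1) = 1 := by rw [hδ]; field_simp
  have hN := Nat.cast_nonneg (α := ℝ) N
  obtain ⟨s1, s2⟩ := idx_spec hδ0 (by linarith : 0 < t)
  have h5 : ((N:ℝ) * (n + 1) + 1) * δ < (idx δ t) * δ := by nlinarith
  have h6 := lt_of_mul_lt_mul_right h5 hδ0.le
  exact_mod_cast h6.le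

lemma int_far {x₀ T : ℝ} (hT : 0 ≤ T) {v : ℝ → ℝ} (hv : OkU p v) (hx0 : 0 < x₀) (hxR : x₀ ≤ p.R) (hf : ∀ t, T < t → v t = x₀) {t : ℝ} (ht : 0 ≤ t) :
    |(∫ s in 0..t, v s) - x₀ * t| ≤ p.R * T := by
  have hR := p.hR
  have key : ∀ s, 0 ≤ s → s ≤ T → |(∫ r in 0..s, v r) - x₀ * s| ≤ p.R * T := by
    intro s hs hsT
    have h1 := hv.int_nonneg hs
    have h2 := hv.int_le hs
    have h3 : x₀ * s ≤ p.R * s := by gcongr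
    have h4 : p.R * s ≤ p.R * T := by gcongr
    have h5 : 0 ≤ x₀ * s := by positivity
    rw [abs_le]; constructor <;> linarith
  rcases le_or_gt t T with h | h
  · exact key t ht h
  · have e : ∫ s in T..t, v s = x₀ * (t - T) := by
      rw [intervalIntegral.integral_congr_ae (g := fun _ => x₀)]
      · simp [mul_comm]
      · rw [uIoc_of_le h.le]; exact ae_of_all _ fun s hs => hf s hs.1
    rw [← intervalIntegral.integral_add_adjacent_intervals (hv.intble 0 T) (hv.intble T t), e]
    have := key T hT le_rfl
    convert this using 2; ring

end avg

end

section

section f3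

variable {p : Par} {μ : Measure Path} {P : Measure Ω} {F : Filtration ℝ mΩ} {W : Ω → Path} {u : ℝ → Ω → ℝ} {K H : Ω → ℝ}

lemma av_meas (hu : Ctl p F u) {δ x₀ : ℝ} (hδ : 0 < δ) (J j : ℕ) : Measurable[F (j * δ)] fun ω => av δ J x₀ (u · ω) j := by
  unfold av
  by_cases h : j = 0 ∨ J ≤ j
  · simp only [h, if_true]; exact measurable_const
  · simp only [h, if_false]
    have hj : 1 ≤ (j:ℝ) := by
      have : 1 ≤ j := by omega
      exact_mod_cast this
    have hj0 : 0 ≤ (j:ℝ) * δ := by positivity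
    have hm := hu.prog (j * δ) hj0
    have e : (fun ω => δ⁻¹ * ∫ s in (j * δ - δ)..(j * δ), u s ω) = fun ω =>
        δ⁻¹ * ((∫ s in 0..(j * δ), u (min s (j * δ)) ω) - ∫ s in 0..(j * δ - δ), u (min s (j * δ)) ω) := by
      funext ω
      have hi : ∀ c d : ℝ, IntervalIntegrable (fun s => u (min s (j * δ)) ω) volume c d := fun c d =>
        OkU.intble (p := p) (u := fun s => u (min s (j * δ)) ω) ⟨(hu.ok ω).meas.comp (measurable_id.min measurable_const), fun t => hu.pos _ ω, fun t => hu.le _ ω⟩ c d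
      rw [intervalIntegral.integral_interval_sub_left (hi _ _) (hi _ _)]
      congr 1
      refine intervalIntegral.integral_congr fun s hs => ?_
      rw [uIcc_of_le (by linarith)] at hs
      show u s ω = u (min s (j * δ)) ω
      rw [min_eq_left hs.2]
    rw [e]
    exact ((@meas_int Ω (F (j * δ)) (fun s ω => u (min s (j * δ)) ω) hm (fun _ => j * δ)
      measurable_const).sub (@meas_int Ω (F (j * δ)) (fun s ω => u (min s (j * δ)) ω) hm
      (fun _ => j * δ - δ) measurable_const)).const_mul _

lemma cst_const_fin (hS : Sys μ P F W) {x₀ C : ℝ} (hx0 : 0 < x₀) (hxR : x₀ ≤ p.R) (hC : 0 ≤ C) (hM : ∀ k h : ℝ, 0 < k → 0 < h → ∫⁻ w, cst p k h (fun _ => x₀) w ∂μ ≤ oR (C * phi p k h)) (hK : Measurable[F 0] K) (hH : Measurable[F 0] H) (hK0 : ∀ ω, 0 < K ω) (hH0 : ∀ ω, 0 < H ω) {M : ℝ} (hphi : ∀ ω, phi p (K ω) (H ω) ≤ M) : ∫⁻ ω, cst p (K ω) (H ω) (fun _ => x₀) (W ω) ∂P ≠ ∞ := by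
  have := hS.fin
  have h1 := hS.lint0 (X := fun ω => (K ω, H ω)) (Measurable.prodMk hK hH) (Fam.const (p := p) hx0 hxR).gmeas
  simp only [gF] at h1
  rw [h1]
  refine ((lintegral_mono fun ω => (hM _ _ (hK0 ω) (hH0 ω)).trans (ofReal_le_ofReal (mul_le_mul_of_nonneg_left (hphi ω) hC))).trans_lt ?_).ne
  rw [lintegral_const]
  exact ENNReal.mul_lt_top ofReal_lt_top (measure_lt_top _ _)

lemma F3B (hq : HQ p μ) (hS : Sys μ P F W) {x₀ C : ℝ} (hx0 : 0 < x₀) (hxR : x₀ ≤ p.R) (hC : 0 ≤ C) (hM : ∀ k h : ℝ, 0 < k → 0 < h → ∫⁻ w, cst p k h (fun _ => x₀) w ∂μ ≤ oR (C * phi p k h)) (hK : Measurable[F 0] K) (hH : Measurable[F 0] H) (hK0 : ∀ ω, 0 < K ω) (hH0 : ∀ ω, 0 < H ω) {M : ℝ} (hphi : ∀ ω, phi p (K ω) (H ω) ≤ M) (hu : Ctl p F u) {m : ℝ} (hm : 0 < m) (hmx : m ≤ x₀) (hmu : ∀ t ω, m ≤ u t ω) {N : ℕ} (hN : ∀ (t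 : ℝ) ω, (N:ℝ) < t → u t ω = x₀) : ∫⁻ ω, vv p μ (K ω) (H ω) ∂P ≤ ∫⁻ ω, cst p (K ω) (H ω) (u · ω) (W ω) ∂P := by
  have hfin := cst_const_fin hS hx0 hxR hC hM hK hH hK0 hH0 hphi
  have hKm := hK.mono (F.le _) le_rfl
  have hHm := hH.mono (F.le _) le_rfl
  have hd : ∀ n : ℕ, (0:ℝ) < 1 / ((n:ℝ) + 1) := fun n => by positivity
  obtain ⟨v, hvd⟩ : ∃ v : ℕ → ℝ → Ω → ℝ, v = fun (n : ℕ) t ω => av (1 / ((n:ℝ) + 1)) (N * (n + 1) + 1) x₀ (u · ω) (idx (1 / ((n:ℝ) + 1)) t) := ⟨_, rfl⟩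
  have hvm : ∀ n t ω, m ≤ v n t ω := fun n t ω => by
    rw [hvd]; exact av_ge (hd n) (hu.ok ω) (hmu · ω) hmx _
  have hvmeas : ∀ n, Measurable fun q : ℝ × Ω => v n q.1 q.2 := fun n => by
    rw [hvd]
    exact pc_meas (d := fun j ω => av (1 / ((n:ℝ) + 1)) (N * (n + 1) + 1) x₀ (u · ω) j) (fun j => (av_meas hu (hd n) _ j).mono (F.le _) le_rfl)
  have hvok : ∀ n ω, OkU p (fun t => v n t ω) := fun n ω =>
    ⟨(hvmeas n).comp measurable_prodMk_right, fun t => hm.trans_le (hvm n t ω), fun t => by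
      rw [hvd]; exact av_le (hd n) (hu.ok ω) hxR _⟩
  have hfar : ∀ n ω, ∀ t, 0 ≤ t → |(∫ s in 0..t, v n s ω) - x₀ * t| ≤ p.R * (N + 2) :=
    fun n ω t ht => int_far (by positivity) (hvok n ω) hx0 hxR (fun t ht => by rw [hvd]; exact av_far rfl _ ht) ht
  have h1 : ∀ n, ∫⁻ ω, vv p μ (K ω) (H ω) ∂P ≤ ∫⁻ ω, cst p (K ω) (H ω) (fun t => v n t ω) (W ω) ∂P := fun n => by
    have h := F1 (P := P) hq (hd n) (x₀ := x₀) (N * (n + 1) + 1) hS hK hH hK0 hH0 (d := fun j ω => av (1 / ((n:ℝ) + 1)) (N * (n + 1) + 1) x₀ (u · ω) j) (fun j => av_meas hu (hd n) _ j) (fun j ω => hm.trans_le (av_ge (hd n) (hu.ok ω) (hmu · ω) hmx _)) (fun j ω => av_le (hd n) (hu.ok ω) hxR _) (fun j hj ω => by unfold av; rw [if_pos (Or.inr hj)])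
    rw [hvd]; exact h
  refine ge_of_tendsto' (x := atTop) ?_ h1
  refine tendsto_lintegral_of_dominated_convergence (fun ω => oR ((p.R / x₀ * rexp (p.R * (N + 2))) ^ p.a * (m / x₀) ^ (-p.b) * rexp (-(p.R * (N + 2))) ^ (-p.b)) * cst p (K ω) (H ω) (fun _ => x₀) (W ω)) (fun n => meas_cst (hvmeas n) hS.measW hKm hHm) (fun n => ae_of_all _ fun ω => ?_) ?_ ?_
  · unfold cst; beta_reduce
    rw [← lintegral_const_mul' _ _ ofReal_ne_top]
    exact setLIntegral_mono' measurableSet_Ioi fun t ht =>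
      (run_dom hx0 hxR hm (hvok n ω) (hfar n ω) (fun t => hvm n t ω) (hK0 ω) (hH0 ω) _ (le_of_lt ht)).2
  · rw [lintegral_const_mul' _ _ ofReal_ne_top]
    exact ENNReal.mul_ne_top ofReal_ne_top hfin
  · filter_upwards [ae_lt_top (meas_cst (p := p) (u := fun _ _ => x₀) measurable_const hS.measW hKm hHm) hfin] with ω hω
    refine cst_tendsto hx0 hxR hm (hvok · ω) (hu.ok ω) (hfar · ω) (fun n t => hvm n t ω)
      ?_ (hK0 ω) (hH0 ω) _ hω.ne
    rw [hvd]
    exact av_tendsto (hu.ok ω) fun t ht => hN t ω ht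

end f3

end

section

section f3a

variable {p : Par} {μ : Measure Path} {P : Measure Ω} {F : Filtration ℝ mΩ} {W : Ω → Path} {u : ℝ → Ω → ℝ} {K H : Ω → ℝ}

lemma int_zeta {f g : ℝ → ℝ} (hf : ∀ s t, IntervalIntegrable f volume s t) (hg : ∀ s t, IntervalIntegrable g volume s t) {c ζ t : ℝ} (hc : 0 ≤ c) (hζ : 0 ≤ ζ) (ht : 0 ≤ t) (h1 : ∀ s, 0 ≤ s → s ≤ ζ → f s ≤ g s + c) (h2 : ∀ s, ζ < s → f s ≤ g s) : ∫ s in 0..t, f s ≤ (∫ s in 0..t, g s) + c * ζ := by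
  have key : ∀ r, 0 ≤ r → r ≤ ζ → ∫ s in 0..r, f s ≤ (∫ s in 0..r, g s) + c * ζ := by
    intro r hr hrζ
    have := intervalIntegral.integral_mono_on hr (hf 0 r) ((hg 0 r).add (intervalIntegrable_const (c := c))) (fun s hs => h1 s hs.1 (hs.2.trans hrζ))
    rw [intervalIntegral.integral_add (hg 0 r) intervalIntegrable_const] at this
    simp at this
    nlinarith
  rcases le_or_gt t ζ with h | h
  · exact key t ht h
  · rw [← intervalIntegral.integral_add_adjacent_intervals (hf 0 ζ) (hf ζ t), ← intervalIntegral.integral_add_adjacent_intervals (hg 0 ζ) (hg ζ t)]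
    have := intervalIntegral.integral_mono_on_of_le_Ioo h.le (hf ζ t) (hg ζ t) (fun s hs => h2 s hs.1)
    have := key ζ hζ le_rfl
    linarith

lemma cst_max {v : ℝ → ℝ} (hv : OkU p v) {δ x₀ ζ N M D k h : ℝ} (hδ : 0 < δ) (hδx : δ ≤ x₀) (hxR : x₀ ≤ p.R) (hζ : 0 ≤ ζ) (hζN : ζ ≤ N) (hfar : ∀ t, ζ < t → v t = x₀) (hk : 0 < k) (hh : 0 < h) (hM : 0 ≤ M) (hkh : k ≤ M * h) {w : Path} (hD : ∀ t, 0 ≤ t → t ≤ ζ → E1 p w t ≤ rexp D ∧ rexp (-D) ≤ E2 p w t) : cst p k h (fun t => max (v t) δ) w ≤ oR ((1 + δ * (p.ρ * M * rexp D * rexp D * N)) ^ p.a * 1 ^ (-p.b) * rexp (-(δ * N)) ^ (-p.b)) * cst p k h v w := by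
  have hv' : OkU p (fun t => max (v t) δ) := ⟨hv.meas.max measurable_const, fun t => lt_max_of_lt_right hδ, fun t => max_le (hv.le t) (hδx.trans hxR)⟩
  have hN : 0 ≤ N := hζ.trans hζN
  have hρ := p.hρ₀
  have hmx : ∀ s, ζ < s → max (v s) δ = v s := fun s hs => by
    rw [hfar s hs]; exact max_eq_left hδx
  have hI : ∀ t, 0 ≤ t → ∫ s in 0..t, max (v s) δ ≤ (∫ s in 0..t, v s) + δ * N := by
    intro t ht
    have := int_zeta hv'.intble hv.intble hδ.le hζ ht (fun s _ _ => max_le (by linarith) (by have := hv.pos s; linarith)) (fun s hs => (hmx s hs).le)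
    have : δ * ζ ≤ δ * N := by gcongr
    linarith
  have hKle : ∀ t, 0 ≤ t → Kx p k (fun t => max (v t) δ) w t ≤ Kx p k v w t := by
    intro t ht
    unfold Kx
    have h1 : ∫ s in 0..t, v s ≤ ∫ s in 0..t, max (v s) δ :=
      intervalIntegral.integral_mono_on ht (hv.intble 0 t) (hv'.intble 0 t) (fun s _ => le_max_left _ _)
    have := E1_pos (p := p) w t
    gcongr
  have hHi : ∀ t, 0 ≤ t → ∫ s in 0..t, Hi p k (fun t => max (v t) δ) w s ≤ (∫ s in 0..t, Hi p k v w s) + δ * k * rexp D * rexp D * N := by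
    intro t ht
    have := int_zeta (Hi_intble (k := k) hv' w) (Hi_intble (k := k) hv w) (c := δ * k * rexp D * rexp D) (by positivity) hζ ht (fun s hs hs' => ?_) (fun s hs => ?_)
    · have : δ * k * rexp D * rexp D * ζ ≤ δ * k * rexp D * rexp D * N := by gcongr
      linarith
    · obtain ⟨d1, d2⟩ := hD s hs hs'
      have e2 := E2_pos (p := p) w s
      have e1 := E1_pos (p := p) w s
      have hK := hKle s hs
      have hKp := Kx_pos (p := p) hk v w s
      have hKp' := (Kx_pos (p := p) hk (fun t => max (v t) δ) w s).le
      have hvp := hv.pos s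
      have hKb : Kx p k v w s ≤ k * rexp D := by
        unfold Kx
        have : rexp (-∫ r in 0..s, v r) ≤ 1 := exp_le_one_iff.2 (by
          have := hv.int_nonneg hs; linarith)
        calc k * E1 p w s * rexp (-∫ r in 0..s, v r) ≤ k * E1 p w s * 1 := by gcongr
          _ ≤ k * rexp D := by rw [mul_one]; gcongr
      have hinv : 1 / E2 p w s ≤ rexp D := by
        rw [div_le_iff₀ e2]
        calc (1:ℝ) = rexp D * rexp (-D) := by rw [← exp_add]; simp
          _ ≤ _ := by gcongr
      have hm : max (v s) δ ≤ v s + δ := max_le (by linarith) (by linarith)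
      have hm0 : 0 ≤ max (v s) δ := hvp.le.trans (le_max_left _ _)
      unfold Hi
      calc max (v s) δ * Kx p k (fun t => max (v t) δ) w s / E2 p w s ≤ (v s + δ) * Kx p k v w s / E2 p w s := by gcongr
        _ = v s * Kx p k v w s / E2 p w s + δ * Kx p k v w s * (1 / E2 p w s) := by ring
        _ ≤ v s * Kx p k v w s / E2 p w s + δ * (k * rexp D) * rexp D := by gcongr
        _ = _ := by ring
    · unfold Hi
      simp only [hmx s hs]
      have := hKle s (hζ.trans hs.le)
      have := E2_pos (p := p) w s
      have := hv.pos s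
      gcongr
  unfold cst
  rw [← lintegral_const_mul' _ _ ofReal_ne_top]
  refine setLIntegral_mono' measurableSet_Ioi fun t ht => ?_
  have ht0 : 0 ≤ t := le_of_lt ht
  refine run_le_of hk hh hk hh hv hv' w ht0 one_pos (exp_pos _) ?_ ?_ ?_
  · unfold Hx
    have h1 := hHi t ht0
    have h2 := Hi_int_nonneg hk hv w ht0
    have h3 := E2_pos (p := p) w t
    have h4 : δ * k * rexp D * rexp D * N ≤ δ * (M * h) * rexp D * rexp D * N := by gcongr
    obtain ⟨I, hId⟩ : ∃ I, I = ∫ s in 0..t, Hi p k v w s := ⟨_, rfl⟩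
    rw [← hId] at h1 h2 ⊢
    have h5 : 0 ≤ δ * (p.ρ * M * rexp D * rexp D * N) * (p.ρ * I) := by positivity
    calc E2 p w t * (h + p.ρ * ∫ s in 0..t, Hi p k (fun t => max (v t) δ) w s) ≤ E2 p w t * (h + p.ρ * (I + δ * (M * h) * rexp D * rexp D * N)) := by
          gcongr; linarith
      _ ≤ E2 p w t * ((1 + δ * (p.ρ * M * rexp D * rexp D * N)) * (h + p.ρ * I)) := by
          gcongr; nlinarith
      _ = _ := by ring
  · simp
  · unfold Kx
    have h1 := hI t ht0
    have h3 := E1_pos (p := p) w t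
    calc rexp (-(δ * N)) * (k * E1 p w t * rexp (-∫ s in 0..t, v s)) = k * E1 p w t * rexp (-((∫ s in 0..t, v s) + δ * N)) := by
          rw [neg_add, exp_add]; ring
      _ ≤ _ := by gcongr

lemma Ctl.max (hu : Ctl p F u) {δ : ℝ} (hδ : 0 < δ) (hδR : δ ≤ p.R) : Ctl p F fun t ω => Max.max (u t ω) δ :=
  ⟨fun t ht => (hu.prog t ht).max measurable_const, fun t ω => lt_max_of_lt_right hδ, fun t ω => max_le (hu.le t ω) hδR⟩

lemma F3a (hq : HQ p μ) (hS : Sys μ P F W) {x₀ C : ℝ} (hx0 : 0 < x₀) (hxR : x₀ ≤ p.R) (hC : 0 ≤ C) (hM : ∀ k h : ℝ, 0 < k → 0 < h → ∫⁻ w, cst p k h (fun _ => x₀) w ∂μ ≤ oR (C * phi p k h)) (hK : Measurable[F 0] K) (hH : Measurable[F 0] H) (hK0 : ∀ ω, 0 < K ω) (hH0 : ∀ ω, 0 < H ω) {M : ℝ} (hM0 : 0 ≤ M) (hphi : ∀ ω, phi p (K ω) (H ω) ≤ M) (hKH : ∀ ω, K ω ≤ M * H ω) (hu : Ctl p F u)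 {N : ℕ} (hN : ∀ (t : ℝ) ω, zt W N ω < t → u t ω = x₀) : ∫⁻ ω, vv p μ (K ω) (H ω) ∂P ≤ ∫⁻ ω, cst p (K ω) (H ω) (u · ω) (W ω) ∂P := by
  have hN0 : (0:ℝ) ≤ N := Nat.cast_nonneg N
  obtain ⟨D, hD0, hD⟩ := E_bd p N hN0
  obtain ⟨c, hc⟩ : ∃ c : ℝ → ℝ, c = fun δ => (1 + δ * (p.ρ * M * rexp D * rexp D * N)) ^ p.a * 1 ^ (-p.b) * rexp (-(δ * N)) ^ (-p.b) := ⟨_, rfl⟩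
  have hdp : ∀ n : ℕ, 0 < x₀ * (1 / ((n:ℝ) + 1)) := fun n => by positivity
  have hdx : ∀ n : ℕ, x₀ * (1 / ((n:ℝ) + 1)) ≤ x₀ := fun n => by
    have : 1 / ((n:ℝ) + 1) ≤ 1 := by
      rw [div_le_one (by positivity)]; have := Nat.cast_nonneg (α := ℝ) n; linarith
    nlinarith
  have key : ∀ n : ℕ, ∫⁻ ω, vv p μ (K ω) (H ω) ∂P ≤ oR (c (x₀ * (1 / ((n:ℝ) + 1)))) * ∫⁻ ω, cst p (K ω) (H ω) (u · ω) (W ω) ∂P := by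
    intro n
    have h1 := F3B (P := P) hq hS hx0 hxR hC hM hK hH hK0 hH0 hphi (hu.max (hdp n) ((hdx n).trans hxR)) (hdp n) (hdx n) (fun t ω => le_max_right _ _) (N := N) (fun t ω ht => by
        have h2 := zt_le (W := W) hN0 ω
        rw [hN t ω (h2.trans_lt ht)]; exact max_eq_left (hdx n))
    refine h1.trans ?_
    rw [← lintegral_const_mul' _ _ ofReal_ne_top]
    refine lintegral_mono fun ω => ?_
    rw [hc]
    refine cst_max (hu.ok ω) (hdp n) (hdx n) hxR (zt_mem hN0 ω).1 (zt_le hN0 ω) (fun t ht => hN t ω ht) (hK0 ω) (hH0 ω) hM0 (hKH ω) fun t ht htz => ?_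
    have := hD (W ω) t ht (by have := zt_le (W := W) hN0 ω; linarith) (zt_norm hS hN0 ω ht htz)
    exact ⟨this.2.1, this.2.2.1⟩
  have hlim : Tendsto (fun n : ℕ => oR (c (x₀ * (1 / ((n:ℝ) + 1)))) * ∫⁻ ω, cst p (K ω) (H ω) (u · ω) (W ω) ∂P) atTop (nhds (1 * ∫⁻ ω, cst p (K ω) (H ω) (u · ω) (W ω) ∂P)) := by
    refine ENNReal.Tendsto.mul_const ?_ (Or.inl one_ne_zero)
    have h1 : ContinuousAt c 0 := by
      rw [hc]
      refine ContinuousAt.mul (ContinuousAt.mul (ContinuousAt.rpow_const (by fun_prop) (Or.inl (by simp)))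
        continuousAt_const) (ContinuousAt.rpow_const (by fun_prop) (Or.inl (by simp)))
    have h2 : Tendsto (fun n : ℕ => x₀ * (1 / ((n:ℝ) + 1))) atTop (nhds 0) := by
      simpa using tendsto_one_div_add_atTop_nhds_zero_nat (𝕜 := ℝ) |>.const_mul x₀
    have h3 := ENNReal.tendsto_ofReal (h1.tendsto.comp h2)
    have h4 : c 0 = 1 := by rw [hc]; simp
    rw [h4, ENNReal.ofReal_one] at h3
    exact h3
  rw [one_mul] at hlim
  exact ge_of_tendsto' hlim key

end f3a

end

section

section f3c

variable {p : Par} {μ : Measure Path} {P : Measure Ω} {F : Filtration ℝ mΩ} {W : Ω → Path} {u : ℝ → Ω → ℝ} {K H : Ω → ℝ}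

lemma tail_zero (hS : Sys μ P F W) (hu : Ctl p F u) (hK : Measurable K) (hH : Measurable H) (hfin : ∫⁻ ω, cst p (K ω) (H ω) (u · ω) (W ω) ∂P ≠ ∞) (hz : ∀ n : ℕ, Measurable (zt W n)) : Tendsto (fun n : ℕ => ∫⁻ ω, (∫⁻ t in Ioi (zt W n ω), run p (K ω) (H ω) (u · ω) (W ω) t) ∂P) atTop (nhds 0) := by
  have h0 : (0:ℝ≥0∞) = ∫⁻ ω, 0 ∂P := by simp
  rw [h0]
  have hrm : ∀ ω, Measurable fun t => run p (K ω) (H ω) (u · ω) (W ω) t := fun ω =>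
    run_meas _ _ (hu.ok ω) _
  refine tendsto_lintegral_of_dominated_convergence (fun ω => cst p (K ω) (H ω) (u · ω) (W ω)) (fun n => ?_) (fun n => ae_of_all _ fun ω => ?_)
    hfin ?_
  · exact meas_runset hu.meas hS.measW hK hH (D := fun ω => Ioi (zt W n ω)) (measurableSet_lt ((hz n).comp measurable_fst) measurable_snd)
  · exact lintegral_mono_set (Ioi_subset_Ioi (zt_mem (Nat.cast_nonneg n) ω).1)
  · filter_upwards [ae_lt_top (meas_cst (p := p) hu.meas hS.measW hK hH) hfin] with ω hω
    have e : ∀ n : ℕ, ∫⁻ t in Ioi (zt W n ω), run p (K ω) (H ω) (u · ω) (W ω) t = ∫⁻ t in Ioi 0, (Ioi (zt W n ω)).indicator (fun t => run p (K ω) (H ω) (u · ω) (W ω) t) t := by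
      intro n
      rw [lintegral_indicator measurableSet_Ioi, Measure.restrict_restrict measurableSet_Ioi, inter_eq_left.2 (Ioi_subset_Ioi (zt_mem (Nat.cast_nonneg n) ω).1)]
    simp only [e]
    have h1 : (0:ℝ≥0∞) = ∫⁻ t in Ioi (0:ℝ), 0 := by simp
    rw [h1]
    refine tendsto_lintegral_of_dominated_convergence (fun t => run p (K ω) (H ω) (u · ω) (W ω) t) (fun n => (hrm ω).indicator measurableSet_Ioi) (fun n => ae_of_all _ fun t => indicator_le_self _ _ t) hω.ne (ae_of_all _ fun t => ?_)
    refine tendsto_const_nhds.congr' ?_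
    filter_upwards [zt_big W ω t] with n hn
    rw [indicator_of_notMem]
    simpa using hn.le

lemma F3c (hq : HQ p μ) (hS : Sys μ P F W) {x₀ C : ℝ} (hx0 : 0 < x₀) (hxR : x₀ ≤ p.R) (hC : 0 ≤ C) (hM : ∀ k h : ℝ, 0 < k → 0 < h → ∫⁻ w, cst p k h (fun _ => x₀) w ∂μ ≤ oR (C * phi p k h)) (hK : Measurable[F 0] K) (hH : Measurable[F 0] H) (hK0 : ∀ ω, 0 < K ω) (hH0 : ∀ ω, 0 < H ω) {M : ℝ} (hM0 : 0 ≤ M) (hphi : ∀ ω, phi p (K ω) (H ω) ≤ M) (hKH : ∀ ω, K ω ≤ M * H ω) (hu : Ctl p F u) : ∫⁻ ω, vv p μ (K ω) (H ω) ∂P ≤ ∫⁻ ω, cst p (K ω) (H ω) (u · ω) (W ω) ∂P := by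
  by_cases hfin : ∫⁻ ω, cst p (K ω) (H ω) (u · ω) (W ω) ∂P = ∞
  · rw [hfin]; exact le_top
  have hN0 : ∀ n : ℕ, (0:ℝ) ≤ n := fun n => Nat.cast_nonneg n
  obtain ⟨C', hC', hT⟩ := phi_tail hu hS hK hH hK0 hH0
  have hΦ := Fam.const (p := p) hx0 hxR
  have hst := fun n : ℕ => zt_stop hS (hN0 n)
  have htr : ∀ n : ℕ, ∀ ω, (oR (zt W n ω)).toReal = zt W n ω := fun n ω =>
    ENNReal.toReal_ofReal (zt_mem (hN0 n) ω).1
  have hz : ∀ n : ℕ, Measurable (zt W n) := fun n => by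
    have := (tau_meas (hst n)).ennreal_toReal
    simpa only [htr] using this
  have key : ∀ n : ℕ, ∫⁻ ω, vv p μ (K ω) (H ω) ∂P ≤ (∫⁻ ω, cst p (K ω) (H ω) (u · ω) (W ω) ∂P) + oR C * C' * ∫⁻ ω, (∫⁻ t in Ioi (zt W n ω), run p (K ω) (H ω) (u · ω) (W ω) t) ∂P := by
    intro n
    have h1 := F3a (P := P) hq hS hx0 hxR hC hM hK hH hK0 hH0 hM0 hphi hKH (pu_ctl hu hS hK hH (hst n) hΦ) (N := n) (fun t ω ht => by
        unfold pu; rw [if_pos]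
        exact (ENNReal.ofReal_lt_ofReal_iff ((zt_mem (hN0 n) ω).1.trans_lt ht)).2 ht)
    refine h1.trans ?_
    rw [paste_cost hu hS hK hH (hst n) hΦ]
    refine add_le_add (lintegral_mono fun ω => lintegral_mono_set fun t ht => ht.1) ?_
    have h2 := hT _ (hst n)
    have hne : {ω : Ω | oR (zt W n ω) ≠ ∞} = univ := by ext; simp
    rw [hne, Measure.restrict_univ] at h2 ⊢
    simp only [htr] at h2 ⊢
    rw [mul_assoc]
    refine le_trans ?_ (mul_le_mul_right h2 _)
    rw [← lintegral_const_mul' _ _ ofReal_ne_top]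
    refine lintegral_mono fun ω => ?_
    obtain ⟨z1, z2⟩ := zz_pos (W := W) hu hK0 hH0 (zt_mem (W := W) (hN0 n) ω).1 ω
    have h3 := hM _ _ z1 z2
    rw [ofReal_mul hC] at h3
    simp only [gF]
    calc _ ≤ _ := mul_le_mul_right h3 _
      _ = _ := by ring
  have hlim := ((ENNReal.Tendsto.const_mul (tail_zero hS hu (hK.mono (F.le _) le_rfl) (hH.mono (F.le _) le_rfl) hfin hz) (a := oR C * C') (Or.inr (ENNReal.mul_ne_top ofReal_ne_top hC')))).const_add (∫⁻ ω, cst p (K ω) (H ω) (u · ω) (W ω) ∂P)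
  rw [mul_zero, add_zero] at hlim
  exact ge_of_tendsto' hlim key

lemma F3 (hG : Gau μ) (hq : HQ p μ) (hS : Sys μ P F W) (hK : Measurable[F 0] K) (hH : Measurable[F 0] H) (hK0 : ∀ ω, 0 < K ω) (hH0 : ∀ ω, 0 < H ω) (hu : Ctl p F u) : ∫⁻ ω, vv p μ (K ω) (H ω) ∂P ≤ ∫⁻ ω, cst p (K ω) (H ω) (u · ω) (W ω) ∂P := by
  have := hS.prob
  obtain ⟨x₀, C, hx0, hxR, hC, hM⟩ := hG.M1 p
  obtain ⟨A, hA⟩ : ∃ A : ℕ → Set Ω, A = fun n : ℕ =>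
    {ω | phi p (K ω) (H ω) ≤ n} ∩ {ω | K ω * (H ω)⁻¹ ≤ n} := ⟨_, rfl⟩
  have hAm : ∀ n, MeasurableSet[F 0] (A n) := fun n => by
    rw [hA]
    have h1 : Measurable[F 0] fun ω => phi p (K ω) (H ω) := phi_meas.comp (Measurable.prodMk hK hH)
    have h2 : Measurable[F 0] fun ω => K ω * (H ω)⁻¹ := hK.mul hH.inv
    exact (h1 measurableSet_Iic).inter (h2 measurableSet_Iic)
  have hmono : Monotone A := by
    intro i j hij ω hω
    rw [hA] at hω ⊢
    have : (i:ℝ) ≤ j := by exact_mod_cast hij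
    exact ⟨le_trans hω.1 this, le_trans hω.2 this⟩
  have hU : ⋃ n, A n = univ := by
    refine eq_univ_of_forall fun ω => mem_iUnion.2 ?_
    obtain ⟨n, hn⟩ := exists_nat_ge (max (phi p (K ω) (H ω)) (K ω * (H ω)⁻¹))
    rw [hA]
    exact ⟨n, (le_max_left _ _).trans hn, (le_max_right _ _).trans hn⟩
  have key : ∀ n, ∫⁻ ω in A n, vv p μ (K ω) (H ω) ∂P ≤ ∫⁻ ω, cst p (K ω) (H ω) (u · ω) (W ω) ∂P := by
    intro n
    classical
    have hm := F.le 0 _ (hAm n)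
    have hM2 : (0:ℝ) ≤ max (n:ℝ) 2 := by positivity
    have h := F3c (P := P.restrict (A n)) hq (hS.restrict (hAm n)) hx0 hxR hC hM (K := fun ω => if ω ∈ A n then K ω else 1) (H := fun ω => if ω ∈ A n then H ω else 1) (Measurable.ite (hAm n) hK measurable_const) (Measurable.ite (hAm n) hH measurable_const) (fun ω => by split_ifs; exacts [hK0 ω, one_pos]) (fun ω => by split_ifs; exacts [hH0 ω, one_pos]) (M := max (n:ℝ) 2) hM2 (fun ω => by
        split_ifs with h
        · rw [hA] at h; exact le_trans h.1 (le_max_left _ _)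
        · simp only [phi, Real.one_rpow]; norm_num)
      (fun ω => by
        split_ifs with h
        · rw [hA] at h
          have h2 : K ω * (H ω)⁻¹ ≤ max (n:ℝ) 2 := le_trans h.2 (le_max_left _ _)
          rwa [← div_eq_mul_inv, div_le_iff₀ (hH0 ω)] at h2
        · simp)
      hu
    refine le_trans (le_of_eq ?_) (h.trans (le_trans (le_of_eq ?_) (setLIntegral_le_lintegral (A n) _)))
    · exact setLIntegral_congr_fun hm fun ω hω => by simp only [hω, if_true]
    · exact setLIntegral_congr_fun hm fun ω hω => by simp only [hω, if_true]
  rw [← setLIntegral_univ (fun ω => vv p μ (K ω) (H ω)), ← hU, setLIntegral_iUnion_of_directed _ (Monotone.directed_le hmono)]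
  exact iSup_le key

end f3c

end

section

section conv

variable {p : Par}

lemma expU {u : ℝ → ℝ} (hu : OkU p u) (c : ℝ) {T : ℝ} (hT : 0 ≤ T) : AbsolutelyContinuousOnInterval (fun t => rexp (c * ∫ s in 0..t, u s)) 0 T ∧ ∀ᵐ t, HasDerivAt (fun t => rexp (c * ∫ s in 0..t, u s)) (rexp (c * ∫ s in 0..t, u s) * (c * u t)) t := by
  have hdU : ∀ᵐ t, HasDerivAt (fun t => ∫ s in 0..t, u s) (u t) t := by
    filter_upwards [LocallyIntegrable.ae_hasDerivAt_integral hu.locint] with t ht using ht 0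
  refine ⟨?_, by filter_upwards [hdU] with t ht using (ht.const_mul c).exp⟩
  have hR := p.hR
  have hg : LipschitzOnWith (rexp (|c| * (p.R * T)) * |c|).toNNReal (fun x : ℝ => rexp (c * x)) (Icc 0 (p.R * T)) := by
    refine Convex.lipschitzOnWith_of_nnnorm_hasDerivWithin_le (f' := fun x => rexp (c * x) * (c * 1)) (convex_Icc _ _) (fun x hx => (((hasDerivAt_id x).const_mul c).exp).hasDerivWithinAt) fun x hx => ?_
    rw [← NNReal.coe_le_coe, coe_nnnorm, Real.coe_toNNReal _ (by positivity), norm_mul, mul_one, Real.norm_eq_abs, Real.norm_eq_abs, Real.abs_exp]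
    have : c * x ≤ |c| * (p.R * T) :=
      (mul_le_mul_of_nonneg_right (le_abs_self c) hx.1).trans (mul_le_mul_of_nonneg_left hx.2 (abs_nonneg c))
    gcongr
  refine LipschitzOnWith.absolutelyContinuousOnInterval (K := (rexp (|c| * (p.R * T)) * |c|).toNNReal * _) (hg.comp (hu.lip.lipschitzOnWith (s := uIcc 0 T)) fun t ht => ?_)
  rw [uIcc_of_le hT] at ht
  exact ⟨hu.int_nonneg ht.1, (hu.int_le ht.1).trans (by have := ht.2; gcongr)⟩

lemma lin_eq {u f : ℝ → ℝ} (hu : OkU p u) {k : ℝ} (hf : ∀ t : ℝ, 0 ≤ t → IntervalIntegrable f volume 0 t) (he : ∀ᵐ t, 0 < t → f t = u t * (k - ∫ s in 0..t, f s)) {t : ℝ} (ht : 0 ≤ t) : k - ∫ s in 0..t, f s = k * rexp (-∫ s in 0..t, u s) := by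
  obtain ⟨h1, h2⟩ := expU hu 1 ht
  have h3 := (hf t ht).absolutelyContinuousOnInterval_intervalIntegral (c := 0) left_mem_uIcc
  have h4 : AbsolutelyContinuousOnInterval (fun t => k - ∫ s in 0..t, f s) 0 t := by
    have : AbsolutelyContinuousOnInterval (fun _ : ℝ => k) 0 t :=
      ((LipschitzWith.const k).lipschitzOnWith (s := uIcc 0 t)).absolutelyContinuousOnInterval
    exact this.sub h3
  obtain ⟨C, hC⟩ := (h4.mul h1).const_of_ae_hasDerivAt_zero (by
    filter_upwards [h2, (hf t ht).ae_hasDerivAt_integral, he, measure_eq_zero_iff_ae_notMem.1 (Set.finite_singleton (0:ℝ) |>.measure_zero volume)] with x a1 a2 a3 a4 hx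
    have hx0 : 0 < x := by
      rw [uIcc_of_le ht] at hx
      exact lt_of_le_of_ne hx.1 fun h => a4 h.symm
    have d1 := ((a2 hx 0 left_mem_uIcc).const_sub k).mul a1
    refine d1.congr_deriv ?_
    rw [a3 hx0]; ring)
  have c0 := hC 0 left_mem_uIcc
  have ct := hC t right_mem_uIcc
  simp only [Pi.mul_apply, intervalIntegral.integral_same, mul_zero, exp_zero, sub_zero, mul_one, one_mul] at c0 ct
  rw [← c0] at ct
  nth_rewrite 2 [← ct]
  rw [mul_assoc, ← exp_add, add_neg_cancel, exp_zero, mul_one]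

lemma exp_int {u : ℝ → ℝ} (hu : OkU p u) {k : ℝ} {t : ℝ} (ht : 0 ≤ t) : k - ∫ s in 0..t, u s * (k * rexp (-∫ r in 0..s, u r)) = k * rexp (-∫ s in 0..t, u s) := by
  obtain ⟨h1, h2⟩ := expU hu (-1) ht
  have hi : IntervalIntegrable (fun s => u s * (k * rexp (-∫ r in 0..s, u r))) volume 0 t :=
    (hu.intble 0 t).mul_continuousOn (continuous_const.mul (Real.continuous_exp.comp hu.int_cont.neg)).continuousOn
  have h3 := hi.absolutelyContinuousOnInterval_intervalIntegral (c := 0) left_mem_uIcc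
  obtain ⟨C, hC⟩ := ((h1.const_mul k).add h3).const_of_ae_hasDerivAt_zero (by
    filter_upwards [h2, hi.ae_hasDerivAt_integral] with x a1 a2 hx
    have d1 := (a1.const_mul k).add (a2 hx 0 left_mem_uIcc)
    refine d1.congr_deriv ?_
    simp only [neg_one_mul]; ring)
  have c0 := hC 0 left_mem_uIcc
  have ct := hC t right_mem_uIcc
  simp only [Pi.add_apply, intervalIntegral.integral_same, mul_zero, exp_zero, mul_one, add_zero, neg_one_mul] at c0 ct
  rw [← c0, neg_zero, exp_zero, mul_one] at ct
  linarith

end conv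

end

section

section setting

def Setting.par (S : Setting Ω) (hA : Assumption1 S) (hγσ : S.γ * (S.σ - 1) ≤ 1) : Par where
  B := S.B
  β₁ := S.β₁
  β₂ := S.β₂
  ρ := S.ρ
  θ := S.θ
  b := S.σ - 1
  a := S.γ * (S.σ - 1)
  R := S.R
  hB := S.hB
  hβ₁ := S.hβ₁
  hβ₂ := S.hβ₂
  hρ₀ := S.hρ₀
  hθ := S.hθ
  hb := by have := S.hσ; linarith
  ha := mul_pos hA.2.1 (by have := S.hσ; linarith)
  hab := by have := S.hσ; have := S.hγ₁; nlinarith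
  ha1 := hγσ
  hR := S.hR
  hBR := hA.1
  as1 := fun h => by have := hA.2.2.1 h; nlinarith
  as2 := fun h => by have := hA.2.2.2 h; nlinarith

variable (S : Setting Ω) (hA : Assumption1 S) (hγσ : S.γ * (S.σ - 1) ≤ 1)

local notation "pS" => Setting.par S hA hγσ

def Setting.W (S : Setting Ω) : Ω → Path := Wpath S.bm1 S.bm2

lemma W_one {t : ℝ} (ht : 0 ≤ t) (ω : Ω) : S.W ω t = (S.W1 t ω, S.W2 t ω) := by
  simp [Setting.W, Wpath, max_eq_left ht]

/-- running cost integrand of the frozen statement -/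
def ig (h : ℝ) (c : ℝ → Ω → ℝ) (t : ℝ) (ω : Ω) : ℝ≥0∞ :=
  oR ((S.σ - 1)⁻¹ * ((hProc S h c t ω) ^ S.γ / c t ω) ^ (S.σ - 1) * rexp (-S.θ * t))

lemma kProc_eq (k : ℝ) (c : ℝ → Ω → ℝ) {t : ℝ} (ht : 0 ≤ t) (ω : Ω) : kProc S k c t ω = E1 pS (S.W ω) t * (k - ∫ s in 0..t, c s ω / E1 pS (S.W ω) s) := by
  unfold kProc E1
  rw [W_one S ht]
  congr 2
  refine intervalIntegral.integral_congr fun s hs => ?_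
  rw [uIcc_of_le ht] at hs
  simp only [W_one S hs.1, Setting.par, div_eq_mul_inv]
  rw [← exp_neg]; congr 2; ring

lemma hProc_eq (h : ℝ) (c : ℝ → Ω → ℝ) {t : ℝ} (ht : 0 ≤ t) (ω : Ω) : hProc S h c t ω = E2 pS (S.W ω) t * (h + S.ρ * ∫ s in 0..t, c s ω / E2 pS (S.W ω) s) := by
  unfold hProc E2
  rw [W_one S ht]
  congr 3
  refine intervalIntegral.integral_congr fun s hs => ?_
  rw [uIcc_of_le ht] at hs
  simp only [W_one S hs.1, Setting.par, div_eq_mul_inv]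
  rw [← exp_neg]; congr 2; ring

structure Good (k h : ℝ) (c : ℝ → Ω → ℝ) (u : ℝ → Ω → ℝ) (ω : Ω) : Prop where
  k_eq : ∀ t : ℝ, 0 ≤ t → kProc S k c t ω = Kx pS k (u · ω) (S.W ω) t
  h_eq : ∀ t : ℝ, 0 ≤ t → hProc S h c t ω = Hx pS k h (u · ω) (S.W ω) t
  r_eq : ∀ᵐ t : ℝ, 0 < t → ig S h c t ω = run pS k h (u · ω) (S.W ω) t

lemma good_of {k h : ℝ} (hk : 0 < k) (hh : 0 < h) {c u : ℝ → Ω → ℝ} {ω : Ω} (hu : OkU pS (u · ω)) (hc : ∀ᵐ t : ℝ, 0 < t → c t ω = u t ω * Kx pS k (u · ω) (S.W ω) t) : Good S hA hγσ k h c u ω := by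
  have k_eq : ∀ t : ℝ, 0 ≤ t → kProc S k c t ω = Kx pS k (u · ω) (S.W ω) t := by
    intro t ht
    rw [kProc_eq S hA hγσ k c ht]
    have e := exp_int hu (k := k) ht
    rw [show Kx pS k (u · ω) (S.W ω) t = E1 pS (S.W ω) t * (k * rexp (-∫ s in 0..t, u s ω)) by unfold Kx; ring, ← e]
    congr 2
    refine intervalIntegral.integral_congr_ae ?_
    filter_upwards [hc] with s hs hs'
    rw [uIoc_of_le ht] at hs'
    rw [hs hs'.1]
    have := E1_pos (p := pS) (S.W ω) s
    unfold Kx; field_simp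
  have h_eq : ∀ t : ℝ, 0 ≤ t → hProc S h c t ω = Hx pS k h (u · ω) (S.W ω) t := by
    intro t ht
    rw [hProc_eq S hA hγσ h c ht]
    unfold Hx
    congr 3
    refine intervalIntegral.integral_congr_ae ?_
    filter_upwards [hc] with s hs hs'
    rw [uIoc_of_le ht] at hs'
    rw [hs hs'.1]
    rfl
  refine ⟨k_eq, h_eq, ?_⟩
  filter_upwards [hc] with t ht h0
  unfold ig run cf
  rw [ht h0, h_eq t h0.le]
  have hK := Kx_pos (p := pS) hk (u · ω) (S.W ω) t
  have hH := Hx_pos hk hh hu (S.W ω) h0.le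
  have hup : 0 < u t ω := hu.pos t
  congr 2
  beta_reduce
  revert hK hH hup
  generalize Hx pS k h (u · ω) (S.W ω) t = Y
  generalize Kx pS k (u · ω) (S.W ω) t = X
  generalize u t ω = v
  intro hK hH hup
  change _ = (S.σ - 1)⁻¹ * (Y ^ (S.γ * (S.σ - 1)) * v ^ (-(S.σ - 1)) * X ^ (-(S.σ - 1)))
  rw [Real.div_rpow (by positivity) (by positivity), ← rpow_mul hH.le, Real.mul_rpow hup.le hK.le, rpow_neg hup.le, rpow_neg hK.le]
  field_simp

lemma prog_c {F : Filtration ℝ mΩ} {c : ℝ → Ω → ℝ} (h : ProgMeasurable F c) (t : ℝ) : @Measurable (ℝ × Ω) ℝ (@Prod.instMeasurableSpace ℝ Ω _ (F t)) _ (fun q => c (min q.1 t) q.2) :=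
  ((h t).measurable).comp (Measurable.prodMk ((measurable_fst.min measurable_const).subtype_mk (h := fun q => mem_Iic.2 (min_le_right _ _))) measurable_snd)

/-- the clipped consumption rate -/
def kk (k : ℝ) (c : ℝ → Ω → ℝ) (t : ℝ) (ω : Ω) : ℝ :=
  E1 pS (S.W ω) t * (k - ∫ s in 0..t, c s ω / E1 pS (S.W ω) s)

def uc (k : ℝ) (c : ℝ → Ω → ℝ) (t : ℝ) (ω : Ω) : ℝ :=
  if 0 < c t ω ∧ c t ω ≤ S.R * kk S hA hγσ k c t ω ∧ 0 < kk S hA hγσ k c t ω then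
    c t ω / kk S hA hγσ k c t ω else S.R

lemma sysW : Sys (S.P.map S.W) S.P S.F S.W := by
  have := S.isProb
  exact Wpath_sys S.bm1 S.bm2 S.indepW

lemma gauW : Gau (S.P.map S.W) := by
  have := S.isProb
  exact Wpath_gau S.bm1 S.bm2 S.indepW

lemma kk_meas (k : ℝ) {c : ℝ → Ω → ℝ} (h : ProgMeasurable S.F c) {t : ℝ} (ht : 0 ≤ t) : @Measurable (ℝ × Ω) ℝ (@Prod.instMeasurableSpace ℝ Ω _ (S.F t)) _ (fun q => kk S hA hγσ k c (min q.1 t) q.2) := by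
  have hc := prog_c h t
  have hW : @Measurable (ℝ × Ω) Path (@Prod.instMeasurableSpace ℝ Ω _ (S.F t)) _ (fun q => frz t (S.W q.2)) := ((sysW S).frzF ht).comp measurable_snd
  have hT : @Measurable (ℝ × Ω) ℝ (@Prod.instMeasurableSpace ℝ Ω _ (S.F t)) _ (fun q => min q.1 t) := measurable_fst.min measurable_const
  have h1 := @meas_E1 (ℝ × Ω) (@Prod.instMeasurableSpace ℝ Ω _ (S.F t)) pS (fun q => frz t (S.W q.2)) hW (fun q => min q.1 t) hT
  have h2 := @meas_E1 (ℝ × ℝ × Ω) (@Prod.instMeasurableSpace ℝ (ℝ × Ω) _ (@Prod.instMeasurableSpace ℝ Ω _ (S.F t)))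
    pS (fun q => frz t (S.W q.2.2)) (hW.comp measurable_snd) (fun q => q.1) measurable_fst
  have hc2 : @Measurable (ℝ × ℝ × Ω) ℝ (@Prod.instMeasurableSpace ℝ (ℝ × Ω) _ (@Prod.instMeasurableSpace ℝ Ω _ (S.F t))) _ (fun q => c (min q.1 t) q.2.2) :=
    hc.comp (Measurable.prodMk measurable_fst (measurable_snd.comp measurable_snd))
  have h3 := @meas_int (ℝ × Ω) (@Prod.instMeasurableSpace ℝ Ω _ (S.F t)) (fun s q => c (min s t) q.2 / E1 pS (frz t (S.W q.2)) s) (hc2.div h2) (fun q => min q.1 t) hT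
  have h4 := h1.mul (h3.const_sub k)
  convert h4 using 1
  funext q
  unfold kk
  simp only [Pi.mul_apply]
  congr 1
  · simp [E1]
  · congr 1
    refine intervalIntegral.integral_congr fun s hs => ?_
    have hst : s ≤ t := by
      rcases hs with ⟨_, hs⟩
      exact hs.trans (max_le ht (min_le_right _ _))
    simp [E1, min_eq_left hst]

lemma uc_ctl {k : ℝ} {c : ℝ → Ω → ℝ} (h : ProgMeasurable S.F c) : Ctl pS S.F (uc S hA hγσ k c) := by
  refine ⟨fun t ht => ?_, fun t ω => ?_, fun t ω => ?_⟩
  · have hc := prog_c h t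
    have hk := kk_meas S hA hγσ k h ht
    unfold uc
    refine Measurable.ite ?_ (hc.div hk) measurable_const
    exact (measurableSet_lt measurable_const hc).inter ((measurableSet_le hc (hk.const_mul S.R)).inter (measurableSet_lt measurable_const hk))
  · unfold uc; split_ifs with h
    · exact div_pos h.1 h.2.2
    · exact S.hR
  · unfold uc; split_ifs with h
    · show _ ≤ S.R
      rw [div_le_iff₀ h.2.2]; exact h.2.1
    · exact le_rfl

lemma adm_good {k h : ℝ} (hk : 0 < k) (hh : 0 < h) {c : ℝ → Ω → ℝ} (hc : IsAdmissible S k h c) : ∀ᵐ ω ∂S.P, Good S hA hγσ k h c (uc S hA hγσ k c) ω := by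
  filter_upwards [hc.locInt, hc.cpos, hc.kpos, hc.cbdd] with ω h1 h2 h3 h4
  have hu := (uc_ctl S hA hγσ (k := k) hc.prog).ok ω
  rw [ae_restrict_iff' measurableSet_Ici] at h2 h4
  have hkk : ∀ t : ℝ, 0 ≤ t → kProc S k c t ω = kk S hA hγσ k c t ω := fun t ht =>
    kProc_eq S hA hγσ k c ht ω
  have hcu : ∀ᵐ t : ℝ, 0 < t → c t ω = uc S hA hγσ k c t ω * kk S hA hγσ k c t ω := by
    filter_upwards [h2, h4] with t a2 a4 ht
    have b2 := a2 ht.le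
    have b4 := a4 ht.le
    have b3 := h3 t ht.le
    rw [hkk t ht.le] at b4 b3
    unfold uc
    rw [if_pos ⟨b2, b4, b3⟩, div_mul_cancel₀ _ b3.ne']
  have hE := E1_cont (p := pS) (S.W ω)
  have hEp := E1_pos (p := pS) (S.W ω)
  have hlin : ∀ t : ℝ, 0 ≤ t → kk S hA hγσ k c t ω = Kx pS k (fun t => uc S hA hγσ k c t ω) (S.W ω) t := by
    intro t ht
    have := lin_eq hu (k := k) (f := fun s => c s ω / E1 pS (S.W ω) s) (fun t ht => by
        have := (h1 t ht).mul_continuousOn (hE.inv₀ fun s => (hEp s).ne').continuousOn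
        simpa only [div_eq_mul_inv, Pi.inv_apply] using this) (by
        filter_upwards [hcu] with s hs hs0
        rw [hs hs0]
        unfold kk
        have := (hEp s).ne'
        field_simp) ht
    unfold kk Kx
    rw [this]; ring
  refine good_of S hA hγσ hk hh hu ?_
  filter_upwards [hcu] with t ht h0
  rw [← hlin t h0.le]; exact ht h0

end setting

end

section

section back

variable (S : Setting Ω) (hA : Assumption1 S) (hγσ : S.γ * (S.σ - 1) ≤ 1)

local notation "pS" => Setting.par S hA hγσ

def cu (k : ℝ) (u : ℝ → Ω → ℝ) (t : ℝ) (ω : Ω) : ℝ :=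
  if 0 < t then u t ω * Kx pS k (u · ω) (S.W ω) t else 1

lemma cu_good {k h : ℝ} (hk : 0 < k) (hh : 0 < h) {u : ℝ → Ω → ℝ} (hu : Ctl pS S.F u) (ω : Ω) : Good S hA hγσ k h (cu S hA hγσ k u) u ω :=
  good_of S hA hγσ hk hh (hu.ok ω) (ae_of_all _ fun t ht => by simp only [cu, if_pos ht])

lemma cu_prog (k : ℝ) {u : ℝ → Ω → ℝ} (hu : Ctl pS S.F u) : ProgMeasurable S.F (cu S hA hγσ k u) := by
  intro i
  refine Measurable.stronglyMeasurable ?_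
  rcases lt_or_ge i 0 with hi | hi
  · have : (fun q : Iic i × Ω => cu S hA hγσ k u q.1 q.2) = fun _ => 1 := by
      funext q
      have : ¬ (0:ℝ) < q.1 := not_lt.2 ((mem_Iic.1 q.1.2).trans hi.le)
      simp only [cu, if_neg this]
    rw [this]; exact measurable_const
  · let m : MeasurableSpace (Iic i × Ω) := Subtype.instMeasurableSpace.prod (S.F i)
    have m1 : @Measurable _ _ m _ (fun q : Iic i × Ω => (q.1 : ℝ)) :=
      measurable_subtype_coe.comp measurable_fst
    have m2 : @Measurable _ _ m (S.F i) (fun q : Iic i × Ω => q.2) := measurable_snd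
    have h1 : @Measurable _ _ m _ (fun q : Iic i × Ω => u (min q.1 i) q.2) :=
      (hu.prog i hi).comp (m1.prodMk m2)
    have h2 : @Measurable _ _ (@Prod.instMeasurableSpace ℝ (Iic i × Ω) _ m) _ (fun q : ℝ × (Iic i × Ω) => u (min q.1 i) q.2.2) :=
      (hu.prog i hi).comp (measurable_fst.prodMk (m2.comp measurable_snd))
    have h3 := @meas_Kx (Iic i × Ω) m pS (fun r q => u (min r i) q.2) h2 (fun q => frz i (S.W q.2)) (((sysW S).frzF hi).comp m2) (fun _ => k) (fun q => q.1)
      measurable_const m1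
    have e : (fun q : Iic i × Ω => cu S hA hγσ k u q.1 q.2) = fun q => if 0 < (q.1:ℝ) then
        u (min q.1 i) q.2 * Kx pS k (fun r => u (min r i) q.2) (frz i (S.W q.2)) q.1 else 1 := by
      funext q
      unfold cu
      split_ifs with h0
      · rw [Kx_min k (fun r => u r q.2) (S.W q.2) h0.le q.1.2, min_eq_left (mem_Iic.1 q.1.2)]
      · rfl
    rw [e]
    exact Measurable.ite (measurableSet_lt (@measurable_const _ _ _ m _) m1) (h1.mul h3) measurable_const

lemma cu_adm {k h : ℝ} (hk : 0 < k) (hh : 0 < h) {u : ℝ → Ω → ℝ} (hu : Ctl pS S.F u) : IsAdmissible S k h (cu S hA hγσ k u) := by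
  have G := fun ω => cu_good S hA hγσ hk hh hu ω
  have hK := fun ω t => Kx_pos (p := pS) hk (u · ω) (S.W ω) t
  refine ⟨cu_prog S hA hγσ k hu, ae_of_all _ fun ω t ht => ?_, ae_of_all _ fun ω => ae_of_all _ fun t => ?_, ae_of_all _ fun ω t ht => ?_, ae_of_all _ fun ω t ht => ?_, ae_of_all _ fun ω => ?_⟩
  · have h1 := (((hu.ok ω).intble 0 t)).mul_continuousOn (Kx_cont (k := k) (hu.ok ω) (S.W ω)).continuousOn
    refine h1.congr_ae ?_
    refine (ae_restrict_iff' measurableSet_uIoc).2 (ae_of_all _ fun s hs => ?_)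
    rw [uIoc_of_le ht] at hs
    simp only [cu, if_pos hs.1]
  · unfold cu; split_ifs
    · exact mul_pos (hu.pos _ _) (hK _ _)
    · exact one_pos
  · rw [(G ω).k_eq t ht]; exact hK _ _
  · rw [(G ω).h_eq t ht]; exact Hx_pos hk hh (hu.ok ω) _ ht
  · refine (ae_restrict_iff' measurableSet_Ici).2 ?_
    have : ∀ᵐ t : ℝ, t ≠ 0 := by simp [ae_iff]
    filter_upwards [this] with t ht0 ht
    have ht' : 0 < t := lt_of_le_of_ne ht (Ne.symm ht0)
    rw [(G ω).k_eq t ht'.le]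
    simp only [cu, if_pos ht']
    exact mul_le_mul_of_nonneg_right (hu.le _ _) (hK _ _).le

end back

end

section

section dpp

variable {p : Par} {μ : Measure Path} {P : Measure Ω} {F : Filtration ℝ mΩ} {W : Ω → Path} {u : ℝ → Ω → ℝ} {K H : Ω → ℝ} {τ : Ω → ℝ≥0∞}

lemma tau_slice (hτ : IsStoppingTimeE F τ) (t : ℝ) (ht : 0 ≤ t) : MeasurableSet[F t] ({ω | τ ω ≠ ∞} ∩ {ω | (τ ω).toReal ≤ t}) := by
  convert hτ t ht using 1
  ext ω
  simp only [mem_inter_iff, mem_setOf_eq]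
  constructor
  · rintro ⟨h1, h2⟩; exact (ENNReal.le_ofReal_iff_toReal_le h1 ht).2 h2
  · intro h
    have h1 : τ ω ≠ ∞ := (h.trans_lt ofReal_lt_top).ne
    exact ⟨h1, (ENNReal.le_ofReal_iff_toReal_le h1 ht).1 h⟩

lemma fin_meas (hτ : IsStoppingTimeE F τ) : MeasurableSet {ω | τ ω ≠ ∞} :=
  (measurableSet_eq_fun (tau_meas hτ) measurable_const).compl

lemma dpp_step (hG : Gau μ) (hq : HQ p μ) (hS : Sys μ P F W) (hK : Measurable[F 0] K) (hH : Measurable[F 0] H) (hK0 : ∀ ω, 0 < K ω) (hH0 : ∀ ω, 0 < H ω) (hu : Ctl p F u) {s : ℝ} (hs : 0 ≤ s) {A : Set Ω} (hA : MeasurableSet[F s] A) : ∫⁻ ω in A, oR (rexp (-p.θ * s)) * vv p μ (zz p K H u W s ω).1 (zz p K H u W s ω).2 ∂P ≤ ∫⁻ ω in A, (∫⁻ t in Ioi s, run p (K ω) (H ω) (u · ω) (W ω) t) ∂P := by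
  have e0 : (shiftF F s) 0 = F s := by
    change F (s + 0) = F s
    rw [add_zero]
  have hz := hu.zF hS hK hH hs (s := fun _ => s) measurable_const (fun _ => hs) (fun _ => le_rfl)
  have h1 : Measurable[(shiftF F s) 0] fun ω => (zz p K H u W s ω).1 := by
    rw [e0]; exact measurable_fst.comp hz
  have h2 : Measurable[(shiftF F s) 0] fun ω => (zz p K H u W s ω).2 := by
    rw [e0]; exact measurable_snd.comp hz
  have hA' : MeasurableSet[(shiftF F s) 0] A := by rw [e0]; exact hA
  have := F3 (P := P.restrict A) (K := fun ω => (zz p K H u W s ω).1) (H := fun ω => (zz p K H u W s ω).2) (u := fun t => u (s + t)) hG hq ((hS.shift hs).restrict hA') h1 h2 (fun ω => (zz_pos hu hK0 hH0 hs ω).1) (fun ω => (zz_pos hu hK0 hH0 hs ω).2) (hu.shift hs)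
  have e : ∀ ω, (∫⁻ t in Ioi s, run p (K ω) (H ω) (u · ω) (W ω) t) = oR (rexp (-p.θ * s)) * cst p (zz p K H u W s ω).1 (zz p K H u W s ω).2 (fun t => u (s + t) ω) (shift s (W ω)) := fun ω => cst_flow (K ω) (H ω) (hu.ok ω) (W ω) s
  simp only [e]
  rw [lintegral_const_mul' _ _ ofReal_ne_top, lintegral_const_mul' _ _ ofReal_ne_top]
  exact mul_le_mul_right this _

lemma dpp_dyc (hG : Gau μ) (hq : HQ p μ) (hS : Sys μ P F W) (hK : Measurable[F 0] K) (hH : Measurable[F 0] H) (hK0 : ∀ ω, 0 < K ω) (hH0 : ∀ ω, 0 < H ω) (hu : Ctl p F u) (hτ : IsStoppingTimeE F τ) (m : ℕ) : ∫⁻ ω in {ω | τ ω ≠ ∞}, oR (rexp (-p.θ * dyc m (τ ω).toReal)) * vv p μ (zz p K H u W (dyc m (τ ω).toReal) ω).1 (zz p K H u W (dyc m (τ ω).toReal) ω).2 ∂P ≤ ∫⁻ ω in {ω | τ ω ≠ ∞}, (∫⁻ t in Ioi (τ ω).toReal, run p (K ω) (H ω) (u · ω) (W ω) t) ∂P :=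 by
  have hsl := fun j : ℕ => dyc_slice (tau_slice hτ) m j
  have hm := fun j : ℕ => F.le _ _ (hsl j)
  have hU : {ω | τ ω ≠ ∞} = ⋃ j : ℕ, {ω | τ ω ≠ ∞} ∩ {ω | ⌈(τ ω).toReal * 2 ^ m⌉₊ = j} := by
    ext ω; simp
  have hd : Pairwise (Function.onFun Disjoint fun j : ℕ =>
      {ω | τ ω ≠ ∞} ∩ {ω | ⌈(τ ω).toReal * 2 ^ m⌉₊ = j}) := by
    intro i j hij
    refine Set.disjoint_left.2 fun ω h1 h2 => hij (h1.2.symm.trans h2.2)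
  rw [hU, lintegral_iUnion hm hd, lintegral_iUnion hm hd]
  refine ENNReal.tsum_le_tsum fun j => ?_
  have hs : (0:ℝ) ≤ (j:ℝ) / 2 ^ m := by positivity
  have hdy : ∀ ω ∈ {ω | τ ω ≠ ∞} ∩ {ω | ⌈(τ ω).toReal * 2 ^ m⌉₊ = j}, dyc m (τ ω).toReal = (j:ℝ) / 2 ^ m := fun ω hω => by
    have := hω.2
    simp only [mem_setOf_eq] at this
    simp only [dyc, this]
  calc _ = ∫⁻ ω in {ω | τ ω ≠ ∞} ∩ {ω | ⌈(τ ω).toReal * 2 ^ m⌉₊ = j}, oR (rexp (-p.θ * ((j:ℝ) / 2 ^ m))) * vv p μ (zz p K H u W ((j:ℝ) / 2 ^ m) ω).1 (zz p K H u W ((j:ℝ) / 2 ^ m) ω).2 ∂P :=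
        setLIntegral_congr_fun (hm j) fun ω hω => by simp only [hdy ω hω]
    _ ≤ _ := dpp_step hG hq hS hK hH hK0 hH0 hu hs (hsl j)
    _ ≤ _ := by
        refine setLIntegral_mono' (hm j) fun ω hω => lintegral_mono_set (Ioi_subset_Ioi ?_)
        rw [← hdy ω hω]; exact le_dyc _ _

lemma dpp_fin (hG : Gau μ) (hq : HQ p μ) (hS : Sys μ P F W) (hK : Measurable[F 0] K) (hH : Measurable[F 0] H) (hK0 : ∀ ω, 0 < K ω) (hH0 : ∀ ω, 0 < H ω) (hu : Ctl p F u) (hτ : IsStoppingTimeE F τ) : ∫⁻ ω in {ω | τ ω ≠ ∞}, oR (rexp (-p.θ * (τ ω).toReal)) * vv p μ (zz p K H u W (τ ω).toReal ω).1 (zz p K H u W (τ ω).toReal ω).2 ∂P ≤ ∫⁻ ω in {ω | τ ω ≠ ∞}, (∫⁻ t in Ioi (τ ω).toReal, run p (K ω) (H ω) (u · ω) (W ω) t) ∂P := by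
  obtain ⟨f, hf⟩ : ∃ f : ℕ → Ω → ℝ≥0∞, f = fun m ω =>
      oR (rexp (-p.θ * dyc m (τ ω).toReal)) * vv p μ (zz p K H u W (dyc m (τ ω).toReal) ω).1 (zz p K H u W (dyc m (τ ω).toReal) ω).2 := ⟨_, rfl⟩
  have hfm : ∀ m, Measurable (f m) := fun m => by
    rw [hf]
    have hT : Measurable fun ω => dyc m (τ ω).toReal := (dyc_meas m).comp (tau_meas hτ).ennreal_toReal
    have h1 := meas_Kx (p := p) hu.meas hS.measW (hK.mono (F.le _) le_rfl) hT
    have h2 := meas_Hx (p := p) hu.meas hS.measW (hK.mono (F.le _) le_rfl) (hH.mono (F.le _) le_rfl) hT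
    have h3 := (vv_meas (p := p) (μ := μ)).comp (h1.prodMk h2)
    have h4 : Measurable fun ω => oR (rexp (-p.θ * dyc m (τ ω).toReal)) :=
      measurable_ofReal.comp (Real.measurable_exp.comp (hT.const_mul _))
    exact h4.mul h3
  have hlim : ∀ ω, Tendsto (f · ω) atTop (nhds (oR (rexp (-p.θ * (τ ω).toReal)) * vv p μ (zz p K H u W (τ ω).toReal ω).1 (zz p K H u W (τ ω).toReal ω).2)) := fun ω => by
    have ht := dyc_tendsto (x := (τ ω).toReal) toReal_nonneg
    have h0 := zz_pos (W := W) hu hK0 hH0 (s := (τ ω).toReal) toReal_nonneg ω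
    have h1 := ((Kx_cont (k := K ω) (hu.ok ω) (W ω)).tendsto (τ ω).toReal).comp ht
    have h2 := ((Hx_cont (k := K ω) (h := H ω) (hu.ok ω) (W ω)).tendsto (τ ω).toReal).comp ht
    have h3 := vv_tendsto (p := p) (μ := μ) h0.1 h0.2 h1 h2
    have hc : Continuous fun t : ℝ => oR (rexp (-p.θ * t)) :=
      ENNReal.continuous_ofReal.comp (Real.continuous_exp.comp (continuous_const.mul continuous_id))
    have h4 := (hc.tendsto (τ ω).toReal).comp ht
    rw [hf]
    refine ENNReal.Tendsto.mul h4 (Or.inl ?_) h3 (Or.inr ofReal_ne_top)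
    rw [Ne, ENNReal.ofReal_eq_zero, not_le]; exact exp_pos _
  have e : ∀ ω, oR (rexp (-p.θ * (τ ω).toReal)) * vv p μ (zz p K H u W (τ ω).toReal ω).1 (zz p K H u W (τ ω).toReal ω).2 = liminf (f · ω) atTop := fun ω => (hlim ω).liminf_eq.symm
  simp only [e]
  refine (lintegral_liminf_le hfm).trans ?_
  refine Filter.liminf_le_of_le (by isBoundedDefault) fun b hb => ?_
  obtain ⟨m, hm⟩ := hb.exists
  refine hm.trans ?_
  rw [hf]
  exact dpp_dyc hG hq hS hK hH hK0 hH0 hu hτ m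

lemma dpp_lo (hG : Gau μ) (hq : HQ p μ) (hS : Sys μ P F W) (hK : Measurable[F 0] K) (hH : Measurable[F 0] H) (hK0 : ∀ ω, 0 < K ω) (hH0 : ∀ ω, 0 < H ω) (hu : Ctl p F u) (hτ : IsStoppingTimeE F τ) : (∫⁻ ω, (∫⁻ t in pre (τ ω), run p (K ω) (H ω) (u · ω) (W ω) t) ∂P) + ∫⁻ ω in {ω | τ ω ≠ ∞}, oR (rexp (-p.θ * (τ ω).toReal)) * vv p μ (zz p K H u W (τ ω).toReal ω).1 (zz p K H u W (τ ω).toReal ω).2 ∂P ≤ ∫⁻ ω, cst p (K ω) (H ω) (u · ω) (W ω) ∂P := by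
  refine (add_le_add_right (dpp_fin hG hq hS hK hH hK0 hH0 hu hτ) _).trans ?_
  have hD := meas_runset (p := p) hu.meas hS.measW (hK.mono (F.le _) le_rfl) (hH.mono (F.le _) le_rfl) (D := fun ω => pre (τ ω)) (pre_meas (tau_meas hτ))
  rw [← lintegral_indicator (fin_meas hτ), ← lintegral_add_left hD]
  refine lintegral_mono fun ω => ?_
  by_cases h : τ ω = ∞
  · rw [indicator_of_notMem (by simpa using h), add_zero, h, pre_top]; exact le_rfl
  · rw [indicator_of_mem (by exact h), pre_int h, ← lintegral_union measurableSet_Ioi (Set.disjoint_left.2 fun t h1 h2 => (not_lt.2 h1.2) h2), Ioc_union_Ioi_eq_Ioi toReal_nonneg]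
    exact le_rfl

lemma dpp_hi [IsProbabilityMeasure P] (hG : Gau μ) (hS : Sys μ P F W) (hK : Measurable[F 0] K) (hH : Measurable[F 0] H) (hK0 : ∀ ω, 0 < K ω) (hH0 : ∀ ω, 0 < H ω) (hu : Ctl p F u) (hτ : IsStoppingTimeE F τ) {v : ℝ≥0∞} (hv : ∀ u', Ctl p F u' → v ≤ ∫⁻ ω, cst p (K ω) (H ω) (fun t => u' t ω) (W ω) ∂P) : v ≤ (∫⁻ ω, (∫⁻ t in pre (τ ω), run p (K ω) (H ω) (u · ω) (W ω) t) ∂P) + ∫⁻ ω in {ω | τ ω ≠ ∞}, oR (rexp (-p.θ * (τ ω).toReal)) * vv p μ (zz p K H u W (τ ω).toReal ω).1 (zz p K H u W (τ ω).toReal ω).2 ∂P := by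
  have := hS.prob
  refine ennreal_lim_le (c := p.a + p.b) fun δ hδ => ?_
  obtain ⟨Φ, hΦ, hle⟩ := exists_fam (p := p) hG hδ
  obtain ⟨C, hC⟩ : ∃ C, C = oR (rexp ((p.a + p.b) * δ)) := ⟨_, rfl⟩
  rw [← hC] at hle ⊢
  have hCt : C ≠ ∞ := by rw [hC]; exact ofReal_ne_top
  have hC1 : 1 ≤ C := by
    rw [hC, ENNReal.one_le_ofReal]; exact Real.one_le_exp (by have := p.ha; have := p.hb; positivity)
  refine (hv _ (pu_ctl hu hS hK hH hτ hΦ)).trans ?_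
  rw [paste_cost hu hS hK hH hτ hΦ]
  obtain ⟨X, hX⟩ : ∃ X, X = ∫⁻ ω, (∫⁻ t in pre (τ ω), run p (K ω) (H ω) (u · ω) (W ω) t) ∂P := ⟨_, rfl⟩
  obtain ⟨Y, hY⟩ : ∃ Y, Y = ∫⁻ ω in {ω | τ ω ≠ ∞}, oR (rexp (-p.θ * (τ ω).toReal)) * vv p μ (zz p K H u W (τ ω).toReal ω).1 (zz p K H u W (τ ω).toReal ω).2 ∂P := ⟨_, rfl⟩
  rw [← hX, ← hY]
  have key : ∫⁻ ω in {ω | τ ω ≠ ∞}, oR (rexp (-p.θ * (τ ω).toReal)) * ∫⁻ w, gF p Φ (zz p K H u W (τ ω).toReal ω, w) ∂μ ∂P ≤ C * (C * Y + oR δ) := by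
    have h1 : ∀ ω, oR (rexp (-p.θ * (τ ω).toReal)) * ∫⁻ w, gF p Φ (zz p K H u W (τ ω).toReal ω, w) ∂μ ≤ C * (C * (oR (rexp (-p.θ * (τ ω).toReal)) * vv p μ (zz p K H u W (τ ω).toReal ω).1 (zz p K H u W (τ ω).toReal ω).2) + oR δ) := fun ω => by
      have h0 := zz_pos (W := W) hu hK0 hH0 (s := (τ ω).toReal) toReal_nonneg ω
      have hD : oR (rexp (-p.θ * (τ ω).toReal)) ≤ 1 := by
        rw [ofReal_le_one]
        exact exp_le_one_iff.2 (by nlinarith [p.hθ, toReal_nonneg (a := τ ω)])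
      refine (mul_le_mul_right (hle _ h0.1 h0.2) _).trans ?_
      generalize oR (rexp (-p.θ * (τ ω).toReal)) = D at hD ⊢
      generalize vv p μ (zz p K H u W (τ ω).toReal ω).1 (zz p K H u W (τ ω).toReal ω).2 = v
      calc D * (C * (C * v + oR δ)) = C * (C * (D * v) + D * oR δ) := by ring
        _ ≤ C * (C * (D * v) + 1 * oR δ) := by gcongr
        _ = _ := by rw [one_mul]
    refine (lintegral_mono h1).trans ?_
    rw [lintegral_const_mul' _ _ hCt, lintegral_add_right _ measurable_const, lintegral_const_mul' _ _ hCt, ← hY]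
    gcongr
    rw [lintegral_const, Measure.restrict_apply_univ]
    exact mul_le_of_le_one_right' prob_le_one
  refine (add_le_add_right key X).trans ?_
  calc X + C * (C * Y + oR δ) = 1 * (1 * X) + C * (C * Y + oR δ) := by rw [one_mul, one_mul]
    _ ≤ C * (C * X) + C * (C * Y + oR δ) := by gcongr
    _ = _ := by ring

end dpp

end

section

section final

variable (S : Setting Ω) (hA : Assumption1 S) (hγσ : S.γ * (S.σ - 1) ≤ 1)

local notation "pS" => Setting.par S hA hγσ

lemma pre_ms (x : ℝ≥0∞) : MeasurableSet (pre x) :=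
  (measurableSet_lt measurable_const measurable_id).inter (measurableSet_lt measurable_ofReal measurable_const)

variable {S hA hγσ} in
lemma Good.int {k h : ℝ} {c u : ℝ → Ω → ℝ} {ω : Ω} (hg : Good S hA hγσ k h c u ω) {D : Set ℝ} (hD : MeasurableSet D) (hD' : ∀ t ∈ D, 0 < t) : ∫⁻ t in D, ig S h c t ω = ∫⁻ t in D, run pS k h (u · ω) (S.W ω) t := by
  refine lintegral_congr_ae ((ae_restrict_iff' hD).2 ?_)
  filter_upwards [hg.r_eq] with t ht h0 using ht (hD' t h0)

lemma jc {k h : ℝ} {c u : ℝ → Ω → ℝ} (hg : ∀ᵐ ω ∂S.P, Good S hA hγσ k h c u ω) : Jcost S k h c = ∫⁻ ω, cst pS k h (u · ω) (S.W ω) ∂S.P := by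
  refine lintegral_congr_ae ?_
  filter_upwards [hg] with ω h
  exact h.int measurableSet_Ioi fun _ => id

lemma hqS (δ x k h : ℝ) (h1 : 0 ≤ δ) (h2 : 0 < x) (h3 : x ≤ (pS).R) (h4 : 0 < k) (h5 : 0 < h) : vv pS (S.P.map S.W) k h ≤ qq pS (S.P.map S.W) δ x k h := by
  have := S.isProb
  exact vv_le_qq (sysW S) (gauW S) h1 h2 h3 h4 h5

lemma can_ctl {φ : ℝ → Path → ℝ} (hφ : Can pS φ) : Ctl pS S.F (fun t ω => φ t (S.W ω)) := by
  refine ⟨fun t ht => ?_, fun t ω => hφ.pos _ _, fun t ω => hφ.le _ _⟩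
  have e : (fun q : ℝ × Ω => φ (min q.1 t) (S.W q.2)) = fun q => φ (min q.1 t) (frz t (S.W q.2)) := by
    funext q
    rw [hφ.nonant _ (S.W q.2), hφ.nonant _ (frz t (S.W q.2))]
    congr 1
    ext1 s
    have : min s (max (min q.1 t) 0) ≤ t := (min_le_right _ _).trans (max_le (min_le_right _ _) ht)
    simp only [frz_apply, min_eq_left this]
  have hW : @Measurable (ℝ × Ω) Path (@Prod.instMeasurableSpace ℝ Ω _ (S.F t)) _ (fun q => frz t (S.W q.2)) := ((sysW S).frzF ht).comp measurable_snd
  rw [e]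
  exact hφ.meas.comp ((measurable_fst.min measurable_const).prodMk hW)

lemma vv_le_ctl {k h : ℝ} (hk : 0 < k) (hh : 0 < h) {u : ℝ → Ω → ℝ} (hu : Ctl pS S.F u) : vv pS (S.P.map S.W) k h ≤ ∫⁻ ω, cst pS k h (u · ω) (S.W ω) ∂S.P := by
  have := S.isProb
  have := F3 (P := S.P) (K := fun _ => k) (H := fun _ => h) (gauW S) (hqS S hA hγσ) (sysW S)
    measurable_const measurable_const (fun _ => hk) (fun _ => hh) hu
  simpa using this

lemma Vcost_eq {k h : ℝ} (hk : 0 < k) (hh : 0 < h) : Vcost S k h = vv pS (S.P.map S.W) k h := by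
  have := S.isProb
  refine le_antisymm ?_ ?_
  · unfold vv
    refine le_iInf fun φ => ?_
    rw [exp_log hk, exp_log hh]
    have hu := can_ctl S hA hγσ φ.2
    refine (iInf_le (fun c : {c : ℝ → Ω → ℝ // IsAdmissible S k h c} => Jcost S k h c.1) ⟨_, cu_adm S hA hγσ hk hh hu⟩).trans ?_
    rw [jc S hA hγσ (ae_of_all _ (cu_good S hA hγσ hk hh hu))]
    have hm : Measurable fun w => cst pS k h (fun t => φ.1 t w) w :=
      meas_cst φ.2.meas measurable_id measurable_const measurable_const
    exact ((sysW S).law hm).le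
  · refine le_iInf fun c => ?_
    rw [jc S hA hγσ (adm_good S hA hγσ hk hh c.2)]
    exact vv_le_ctl S hA hγσ hk hh (uc_ctl S hA hγσ c.2.prog)

/-- stopped cost -/
def sc (k₀ h₀ : ℝ) (c : ℝ → Ω → ℝ) (τ : Ω → ℝ≥0∞) : ℝ≥0∞ :=
  ∫⁻ ω, ((∫⁻ t in pre (τ ω), ig S h₀ c t ω) + (if τ ω = ∞ then 0 else
          oR (rexp (-S.θ * (τ ω).toReal)) * Vcost S (kProc S k₀ c ((τ ω).toReal) ω) (hProc S h₀ c ((τ ω).toReal) ω))) ∂S.P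

lemma sc_eq {k h : ℝ} (hk : 0 < k) (hh : 0 < h) {c u : ℝ → Ω → ℝ} (hu : Ctl pS S.F u) (hg : ∀ᵐ ω ∂S.P, Good S hA hγσ k h c u ω) {τ : Ω → ℝ≥0∞} (hτ : IsStoppingTimeE S.F τ) : sc S k h c τ = (∫⁻ ω, (∫⁻ t in pre (τ ω), run pS k h (u · ω) (S.W ω) t) ∂S.P) + ∫⁻ ω in {ω | τ ω ≠ ∞}, oR (rexp (-(pS).θ * (τ ω).toReal)) * vv pS (S.P.map S.W) (zz pS (fun _ => k) (fun _ => h) u S.W (τ ω).toReal ω).1 (zz pS (fun _ => k) (fun _ => h) u S.W (τ ω).toReal ω).2 ∂S.P := by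
  have hD := meas_runset (p := pS) (K := fun _ => k) (H := fun _ => h) hu.meas (sysW S).measW
    measurable_const measurable_const (D := fun ω => pre (τ ω)) (pre_meas (tau_meas hτ))
  rw [← lintegral_indicator (fin_meas hτ), ← lintegral_add_left hD]
  refine lintegral_congr_ae ?_
  filter_upwards [hg] with ω h
  have h0 := (toReal_nonneg (a := τ ω))
  rw [h.int (pre_ms _) fun _ h => h.1]
  congr 1
  split_ifs with ht
  · rw [indicator_of_notMem (by simpa using ht)]
  · rw [indicator_of_mem (by exact ht), h.k_eq _ h0, h.h_eq _ h0, Vcost_eq S hA hγσ (Kx_pos hk _ _ _) (Hx_pos hk hh (hu.ok ω) _ h0)]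
    rfl

include hA hγσ in
lemma V_eq {k₀ h₀ : ℝ} (hk₀ : 0 < k₀) (hh₀ : 0 < h₀) (τ : (ℝ → Ω → ℝ) → Ω → ℝ≥0∞) (hτ : ∀ c : ℝ → Ω → ℝ, IsAdmissible S k₀ h₀ c → IsStoppingTimeE S.F (τ c)) : Vcost S k₀ h₀ = ⨅ c : {c : ℝ → Ω → ℝ // IsAdmissible S k₀ h₀ c}, sc S k₀ h₀ c.1 (τ c.1) := by
  have := S.isProb
  refine le_antisymm (le_iInf fun c => ?_) (iInf_mono fun c => ?_)
  · have hu := uc_ctl S hA hγσ (k := k₀) c.2.prog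
    rw [sc_eq S hA hγσ hk₀ hh₀ hu (adm_good S hA hγσ hk₀ hh₀ c.2) (hτ _ c.2), Vcost_eq S hA hγσ hk₀ hh₀]
    exact dpp_hi (K := fun _ => k₀) (H := fun _ => h₀) (gauW S) (sysW S) measurable_const measurable_const (fun _ => hk₀) (fun _ => hh₀) hu (hτ _ c.2) fun u' hu' => vv_le_ctl S hA hγσ hk₀ hh₀ hu'
  · have hu := uc_ctl S hA hγσ (k := k₀) c.2.prog
    have hg := adm_good S hA hγσ hk₀ hh₀ c.2
    rw [sc_eq S hA hγσ hk₀ hh₀ hu hg (hτ _ c.2), jc S hA hγσ hg]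
    exact dpp_lo (K := fun _ => k₀) (H := fun _ => h₀) (gauW S) (hqS S hA hγσ) (sysW S) measurable_const
      measurable_const (fun _ => hk₀) (fun _ => hh₀) hu (hτ _ c.2)

lemma neg_iInf_coe {ι : Type*} (f : ι → ℝ≥0∞) : -((⨅ i, f i : ℝ≥0∞) : EReal) = ⨆ i, -(f i : EReal) := by
  refine le_antisymm ?_ (iSup_le fun i => EReal.neg_le_neg_iff.2 (by exact_mod_cast iInf_le f i))
  rw [EReal.neg_le]
  obtain ⟨X, hX⟩ : ∃ X, X = ⨆ i, -(f i : EReal) := ⟨_, rfl⟩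
  have hi : ∀ i, -X ≤ (f i : EReal) := fun i => by
    rw [EReal.neg_le, hX]; exact le_iSup (fun i => -(f i : EReal)) i
  rw [← hX]
  have h2 : ∀ i, (-X).toENNReal ≤ f i := fun i => by
    have := EReal.toENNReal_le_toENNReal (hi i)
    rwa [EReal.toENNReal_coe] at this
  have h3 : (-X).toENNReal ≤ ⨅ i, f i := le_iInf h2
  refine le_trans ?_ (EReal.coe_ennreal_le_coe_ennreal_iff.2 h3)
  rw [EReal.coe_toENNReal_eq_max]; exact le_max_right _ _

end final

end

/-- Dynamic programming principle: for any family of stopping times `τ_c`, indexed by the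
admissible controls, `V(k₀,h₀)` is the supremum over admissible `c` of the expected reward
up to `τ_c` plus the discounted value at `τ_c`. -/
theorem dynamic_programming_principle (S : Setting Ω) (hA : Assumption1 S)
    (hγσ : S.γ * (S.σ - 1) ≤ 1) (k₀ h₀ : ℝ) (hk₀ : 0 < k₀) (hh₀ : 0 < h₀)
    (τ : (ℝ → Ω → ℝ) → Ω → ℝ≥0∞)
    (hτ : ∀ c : ℝ → Ω → ℝ, IsAdmissible S k₀ h₀ c → IsStoppingTimeE S.F (τ c)) :
    V S k₀ h₀ = ⨆ c : {c : ℝ → Ω → ℝ // IsAdmissible S k₀ h₀ c},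
      stoppedReward S k₀ h₀ c.1 (τ c.1) := by
  unfold V
  rw [V_eq S hA hγσ hk₀ hh₀ τ hτ, neg_iInf_coe]
  rfl

end HabitModel
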